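/- arXiv:2602.07927 — 6 statements merged into one kernel-verified Lean document; each statement's English description precedes it below -/
import Mathlib

section
/- If G is a finite cactus graph, then γ_b(G) ≤ (3/2)·MP(G) + 11/2, where γ_b(G) is the broadcast domination number and MP(G) is the multipacking number of G. -/
open SimpleGraph

variable {V : Type*}

/-- The diameter of a graph: the supremum of distances between pairs of vertices. -/
noncomputable def gDiam (G : SimpleGraph V) : ℕ :=
  sSup (Set.range fun p : V × V => G.dist p.1 p.2)

/-- A multipacking of a graph `G` is a set `M` of vertices such that for every vertex `v`
and every integer `r ≥ 1`, the ball of radius `r` around `v` contains at most `r`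
vertices of `M`. -/
def IsMultipacking (G : SimpleGraph V) (M : Set V) : Prop :=
  ∀ v : V, ∀ r : ℕ, 1 ≤ r → (M ∩ {u | G.dist u v ≤ r}).ncard ≤ r

/-- The multipacking number of `G`: the maximum size of a multipacking. -/
noncomputable def multipackingNumber (G : SimpleGraph V) : ℕ :=
  sSup {n | ∃ M : Set V, IsMultipacking G M ∧ M.ncard = n}

/-- A dominating broadcast: a function `f : V → ℕ` bounded above by the diameter,
such that every vertex `u` is within distance `f v` of some vertex `v` with `f v > 0`. -/
def IsDominatingBroadcast (G : SimpleGraph V) (f : V → ℕ) : Prop :=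
  (∀ v : V, f v ≤ gDiam G) ∧ ∀ u : V, ∃ v : V, 0 < f v ∧ G.dist u v ≤ f v

/-- The broadcast domination number of `G`: the minimum cost of a dominating broadcast. -/
noncomputable def broadcastDominationNumber (G : SimpleGraph V) : ℕ :=
  sInf {c | ∃ f : V → ℕ, IsDominatingBroadcast G f ∧ ∑ᶠ v : V, f v = c}

/-- A cactus is a connected graph in which every edge belongs to at most one cycle:
if two cycles share an edge, they have the same edge set. -/
def IsCactus (G : SimpleGraph V) : Prop :=
  G.Connected ∧ ∀ ⦃u v : V⦄ (c₁ : G.Walk u u) (c₂ : G.Walk v v),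
    c₁.IsCycle → c₂.IsCycle → ∀ e ∈ c₁.edges, e ∈ c₂.edges →
      {e' : Sym2 V | e' ∈ c₁.edges} = {e' : Sym2 V | e' ∈ c₂.edges}

/-- The distance between the positions `x, y < n` on a cycle of length `n`. -/
def cyclicDist (n x y : ℕ) : ℕ := min ((x - y) + (y - x)) (n - ((x - y) + (y - x)))

lemma cyclicDist_comm (n x y : ℕ) : cyclicDist n x y = cyclicDist n y x := by
  simp only [cyclicDist, add_comm]

/-- `IsCycleGate G n gate height` says that the graph `G` consists of a cycle of length `n` with
pairwise disjoint graphs hanging from its vertices: `gate v` is the position on the cycle of the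
vertex from which `v` hangs, and `height v` is the distance from `v` to that vertex. -/
structure IsCycleGate (G : SimpleGraph V) (n : ℕ) (gate height : V → ℕ) : Prop where
  gate_lt : ∀ v, gate v < n
  adj : ∀ u v, G.Adj u v →
    (gate u = gate v ∧ height u ≤ height v + 1 ∧ height v ≤ height u + 1) ∨
      (height u = 0 ∧ height v = 0 ∧ cyclicDist n (gate u) (gate v) = 1)
  exists_height_eq : ∀ v, ∀ k ≤ height v, ∃ w, gate w = gate v ∧ height w = k
  exists_gate_eq : ∀ i < n, ∃ w, gate w = i ∧ height w = 0
  dist_le : ∀ u v, G.dist u v ≤ height u + cyclicDist n (gate u) (gate v) + height v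

namespace IsCycleGate

variable {G : SimpleGraph V} {n : ℕ} {gate height : V → ℕ}

lemma le_length (hG : IsCycleGate G n gate height) {u v : V} (w : G.Walk u v) :
    (gate u = gate v → height u ≤ height v + w.length ∧ height v ≤ height u + w.length) ∧
    (gate u ≠ gate v → height u + cyclicDist n (gate u) (gate v) + height v ≤ w.length) := by
  induction w with
  | nil => simp
  | @cons u v w h p ih =>
    have hu := hG.gate_lt u
    have hv := hG.gate_lt v
    have hw := hG.gate_lt w
    obtain ⟨ih₁, ih₂⟩ := ih
    rw [Walk.length_cons]
    rcases hG.adj u v h with ⟨h₁, h₂, h₃⟩ | ⟨h₁, h₂, h₃⟩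
    · rw [h₁]
      refine ⟨fun e => ?_, fun e => ?_⟩
      · have := ih₁ e
        omega
      · have := ih₂ e
        omega
    · have hne : gate u ≠ gate v := by
        intro e
        simp [cyclicDist, e] at h₃
      by_cases e : gate v = gate w
      · have := ih₁ e
        rw [← e]
        refine ⟨fun e' => absurd e' hne, fun _ => ?_⟩
        omega
      · have := ih₂ e
        unfold cyclicDist at *
        refine ⟨fun _ => ?_, fun _ => ?_⟩ <;> omega

lemma height_le (hG : IsCycleGate G n gate height) (hc : G.Connected) {u v : V}
    (h : gate u = gate v) :
    height u ≤ height v + G.dist u v ∧ height v ≤ height u + G.dist u v := by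
  obtain ⟨w, hw⟩ := hc.exists_walk_length_eq_dist u v
  rw [← hw]
  exact (hG.le_length w).1 h

lemma le_dist (hG : IsCycleGate G n gate height) (hc : G.Connected) {u v : V}
    (h : gate u ≠ gate v) :
    height u + cyclicDist n (gate u) (gate v) + height v ≤ G.dist u v := by
  obtain ⟨w, hw⟩ := hc.exists_walk_length_eq_dist u v
  rw [← hw]
  exact (hG.le_length w).2 h

lemma comp (hG : IsCycleGate G n gate height) {σ τ : ℕ → ℕ} (hσ : ∀ i < n, σ i < n)
    (hτ : ∀ i < n, τ i < n ∧ σ (τ i) = i)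
    (hd : ∀ i < n, ∀ j < n, cyclicDist n (σ i) (σ j) = cyclicDist n i j) :
    IsCycleGate G n (σ ∘ gate) height where
  gate_lt v := hσ _ (hG.gate_lt v)
  adj u v h := by
    simp only [Function.comp, hd _ (hG.gate_lt u) _ (hG.gate_lt v)]
    exact (hG.adj u v h).imp_left fun h => ⟨congrArg σ h.1, h.2⟩
  exists_height_eq v k hk := by
    obtain ⟨w, h₁, h₂⟩ := hG.exists_height_eq v k hk
    exact ⟨w, congrArg σ h₁, h₂⟩
  exists_gate_eq i hi := by
    obtain ⟨w, h₁, h₂⟩ := hG.exists_gate_eq (τ i) (hτ i hi).1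
    exact ⟨w, by simp [h₁, (hτ i hi).2], h₂⟩
  dist_le u v := by
    simp only [Function.comp, hd _ (hG.gate_lt u) _ (hG.gate_lt v)]
    exact hG.dist_le u v

/-- Two distinct gates can be moved to the position `0` and to the second half of the cycle. -/
lemma exists_normalized (hG : IsCycleGate G n gate height) {a b : V} (hab : gate a ≠ gate b) :
    ∃ gate' : V → ℕ, IsCycleGate G n gate' height ∧ gate' a = 0 ∧ 0 < gate' b ∧
      n ≤ 2 * gate' b := by
  have ha := hG.gate_lt a
  have hb := hG.gate_lt b
  generalize hα : gate a = α at *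
  generalize hβ : gate b = β at *
  by_cases h : n ≤ 2 * (if α ≤ β then β - α else β + n - α)
  · refine ⟨_, hG.comp (σ := fun i => if α ≤ i then i - α else i + n - α)
      (τ := fun i => if i + α < n then i + α else i + α - n) ?_ ?_ ?_, ?_, ?_, ?_⟩
    · intro i hi
      split_ifs <;> omega
    · intro i hi
      split_ifs <;> omega
    · intro i hi j hj
      simp only [cyclicDist]
      split_ifs <;> omega
    · simp [hα]
    · simp only [Function.comp, hβ]
      split_ifs <;> omega
    · simpa [Function.comp, hβ] using h
  · refine ⟨_, hG.comp (σ := fun i => if i ≤ α then α - i else n + α - i)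
      (τ := fun i => if i ≤ α then α - i else n + α - i) ?_ ?_ ?_, ?_, ?_, ?_⟩
    · intro i hi
      split_ifs <;> omega
    · intro i hi
      split_ifs <;> omega
    · intro i hi j hj
      simp only [cyclicDist]
      split_ifs <;> omega
    · simp [hα]
    · simp only [Function.comp, hβ]
      split_ifs <;> omega
    · simp only [Function.comp, hβ]
      split_ifs at h ⊢ <;> omega

end IsCycleGate

lemma reachable_getVert {G H : SimpleGraph V} {u v : V} (c : G.Walk u v) {i j : ℕ} (hij : i ≤ j)
    (h : ∀ k, i ≤ k → k < j → H.Adj (c.getVert k) (c.getVert (k + 1))) :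
    H.Reachable (c.getVert i) (c.getVert j) := by
  induction j, hij using Nat.le_induction with
  | base => exact .refl _
  | succ j hij ih =>
    exact (ih fun k h₁ h₂ => h k h₁ (by omega)).trans (h j hij (by omega)).reachable

lemma dist_getVert_le {G : SimpleGraph V} {u v : V} (c : G.Walk u v) {i j : ℕ} (hij : i ≤ j)
    (hj : j ≤ c.length) : G.dist (c.getVert i) (c.getVert j) ≤ j - i := by
  induction j, hij using Nat.le_induction with
  | base => simp
  | succ j hij ih =>
    have h := c.adj_getVert_succ (i := j) (by omega)
    have h₁ := h.reachable.dist_triangle_right (c.getVert i)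
    rw [dist_eq_one_iff_adj.mpr h] at h₁
    have := ih (by omega)
    omega

lemma mk_getVert_mem_edges {G : SimpleGraph V} {u v : V} (c : G.Walk u v) {i : ℕ}
    (hi : i < c.length) : s(c.getVert i, c.getVert (i + 1)) ∈ c.edges :=
  c.mk_mem_edges_iff_exists.mpr ⟨i, hi, rfl⟩

lemma mk_getVert_ne {G : SimpleGraph V} {u v : V} {c : G.Walk u v} (hc : c.IsTrail) {i j : ℕ}
    (hi : i < c.length) (hj : j < c.length) (hij : i ≠ j) :
    s(c.getVert i, c.getVert (i + 1)) ≠ s(c.getVert j, c.getVert (j + 1)) := by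
  have hi' : i < c.edges.length := by rwa [Walk.length_edges]
  have hj' : j < c.edges.length := by rwa [Walk.length_edges]
  rw [← Walk.getElem_edges hi', ← Walk.getElem_edges hj']
  exact fun h => hij ((hc.edges_nodup.getElem_inj_iff).mp h)

/-- Two distinct edges of a cycle in a cactus separate the graph. -/
lemma IsCactus.not_reachable {G : SimpleGraph V} (hG : IsCactus G) {u x y : V} {c : G.Walk u u}
    (hc : c.IsCycle) (he : s(x, y) ∈ c.edges) {e : Sym2 V} (he' : e ∈ c.edges)
    (hne : s(x, y) ≠ e) : ¬ ((G.deleteEdges {e}).deleteEdges {s(x, y)}).Reachable x y := by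
  intro hr
  have hadj : (G.deleteEdges {e}).Adj x y := by
    rw [deleteEdges_adj]
    exact ⟨c.adj_of_mem_edges he, hne⟩
  obtain ⟨v, c', hc', hmem⟩ := adj_and_reachable_delete_edges_iff_exists_cycle.mp ⟨hadj, hr⟩
  have hle : G.deleteEdges {e} ≤ G := deleteEdges_le _
  have h := hG.2 c (c'.mapLe hle) hc (hc'.mapLe hle) _ he
    (by rwa [Walk.edges_mapLe_eq_edges])
  have h' : e ∈ (c'.mapLe hle).edges := (Set.ext_iff.mp h e).mp he'
  rw [Walk.edges_mapLe_eq_edges] at h'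
  have := c'.edges_subset_edgeSet h'
  simp at this

/-- In a cactus, distinct vertices of a cycle are disconnected by deleting the cycle's edges. -/
lemma IsCactus.getVert_not_reachable {G : SimpleGraph V} (hG : IsCactus G) {u : V}
    {c : G.Walk u u} (hc : c.IsCycle) {i j : ℕ} (hij : i < j) (hj : j < c.length) :
    ¬ (G.deleteEdges {e | e ∈ c.edges}).Reachable (c.getVert i) (c.getVert j) := by
  intro hr
  refine hG.not_reachable hc (mk_getVert_mem_edges c (hij.trans hj)) (mk_getVert_mem_edges c hj)
    (mk_getVert_ne hc.isTrail (hij.trans hj) hj hij.ne) ?_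
  refine Reachable.trans (hr.mono ?_) (Reachable.symm (reachable_getVert c hij ?_))
  · intro x y hxy
    simp only [deleteEdges_adj, Set.mem_ofPred_eq, Set.mem_singleton_iff] at hxy ⊢
    refine ⟨⟨hxy.1, fun h => hxy.2 ?_⟩, fun h => hxy.2 ?_⟩
    · rw [h]; exact mk_getVert_mem_edges c hj
    · rw [h]; exact mk_getVert_mem_edges c (hij.trans hj)
  · intro k hk₁ hk₂
    simp only [deleteEdges_adj, Set.mem_singleton_iff]
    exact ⟨⟨c.adj_getVert_succ (hk₂.trans hj), mk_getVert_ne hc.isTrail (by omega) hj (by omega)⟩,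
      mk_getVert_ne hc.isTrail (by omega) (by omega) (by omega)⟩

lemma Walk.exists_getVert_of_mem_support {G : SimpleGraph V} {u v : V} {c : G.Walk u u}
    (hc : c.IsCycle) (hv : v ∈ c.support) : ∃ i < c.length, c.getVert i = v := by
  obtain ⟨i, hi, hle⟩ := Walk.mem_support_iff_exists_getVert.mp hv
  rcases hle.lt_or_eq with h | h
  · exact ⟨i, h, hi⟩
  · refine ⟨0, by have := hc.three_le_length; omega, ?_⟩
    rw [← hi, h, Walk.getVert_length, Walk.getVert_zero]

lemma exists_reachable_getVert {G : SimpleGraph V} (hG : G.Connected) {u : V} {c : G.Walk u u}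
    (hc : c.IsCycle) (v : V) :
    ∃ i < c.length, (G.deleteEdges {e | e ∈ c.edges}).Reachable v (c.getVert i) := by
  obtain ⟨w⟩ := hG.preconnected v u
  have key : ∀ {x y : V} (w : G.Walk x y), y ∈ c.support →
      ∃ i < c.length, (G.deleteEdges {e | e ∈ c.edges}).Reachable x (c.getVert i) := by
    intro x y w hy
    induction w with
    | nil =>
      obtain ⟨i, hi, rfl⟩ := Walk.exists_getVert_of_mem_support hc hy
      exact ⟨i, hi, .refl _⟩
    | @cons x z y h p ih =>
      by_cases he : s(x, z) ∈ c.edges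
      · obtain ⟨i, hi, rfl⟩ :=
          Walk.exists_getVert_of_mem_support hc (c.fst_mem_support_of_mem_edges he)
        exact ⟨i, hi, .refl _⟩
      · obtain ⟨i, hi, hr⟩ := ih hy
        have hadj : (G.deleteEdges {e | e ∈ c.edges}).Adj x z := by
          rw [deleteEdges_adj]
          exact ⟨h, he⟩
        exact ⟨i, hi, hadj.reachable.trans hr⟩
  exact key w c.start_mem_support

lemma exists_dist_eq_and_dist_eq_sub {G : SimpleGraph V} {a b : V} (h : G.Reachable a b) {k : ℕ}
    (hk : k ≤ G.dist a b) :
    ∃ w, G.Reachable w b ∧ G.dist a w = k ∧ G.dist w b = G.dist a b - k := by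
  obtain ⟨p, hp⟩ := h.exists_walk_length_eq_dist
  have h₁ := dist_getVert_le p (Nat.zero_le k) (by omega)
  have h₂ := dist_getVert_le p (i := k) (j := p.length) (by omega) le_rfl
  rw [Walk.getVert_zero] at h₁
  rw [Walk.getVert_length] at h₂
  have hr : G.Reachable (p.getVert k) b := by
    have := reachable_getVert (H := G) p (i := k) (j := p.length) (by omega)
      fun i _ hi => p.adj_getVert_succ hi
    rwa [Walk.getVert_length] at this
  have h₃ := hr.dist_triangle_right a
  exact ⟨_, hr, by omega, by omega⟩

/-- Every cycle of a cactus gives a decomposition of the cactus. -/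
lemma IsCactus.exists_isCycleGate {G : SimpleGraph V} (hG : IsCactus G) {u : V} {c : G.Walk u u}
    (hc : c.IsCycle) :
    ∃ (n : ℕ) (gate height : V → ℕ), IsCycleGate G n gate height ∧
      ∀ v ∈ c.support, height v = 0 := by
  have hn := hc.three_le_length
  choose gate hlt hreach using exists_reachable_getVert hG.1 hc
  set H := G.deleteEdges {e | e ∈ c.edges} with hH
  have hHG : H ≤ G := deleteEdges_le _
  have huniq : ∀ v, ∀ i < c.length, H.Reachable v (c.getVert i) → gate v = i := by
    intro v i hi hr
    have h := (hreach v).symm.trans hr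
    rcases lt_trichotomy (gate v) i with hlt' | heq | hlt'
    · exact absurd h (hG.getVert_not_reachable hc hlt' hi)
    · exact heq
    · exact absurd h.symm (hG.getVert_not_reachable hc hlt' (hlt v))
  have hgate : ∀ i < c.length, gate (c.getVert i) = i := fun i hi => huniq _ i hi (.refl _)
  have hheight : ∀ i < c.length, H.dist (c.getVert i) (c.getVert (gate (c.getVert i))) = 0 := by
    intro i hi
    rw [hgate i hi, dist_self]
  refine ⟨c.length, gate, fun v => H.dist v (c.getVert (gate v)), ⟨hlt, ?_, ?_, ?_, ?_⟩, ?_⟩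
  · have hedge : ∀ x y, H.Adj x y →
        gate x = gate y ∧ H.dist x (c.getVert (gate x)) ≤ H.dist y (c.getVert (gate y)) + 1 := by
      intro x y hxy
      have hg := huniq x (gate y) (hlt y) (hxy.reachable.trans (hreach y))
      have h₁ := hxy.reachable.dist_triangle_left (c.getVert (gate y))
      rw [dist_eq_one_iff_adj.mpr hxy] at h₁
      refine ⟨hg, ?_⟩
      rw [hg]
      omega
    have hcyc : ∀ i < c.length, cyclicDist c.length (gate (c.getVert i))
        (gate (c.getVert (i + 1))) = 1 ∧ H.dist (c.getVert (i + 1))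
          (c.getVert (gate (c.getVert (i + 1)))) = 0 := by
      intro i hi
      rcases (Nat.succ_le_of_lt hi).lt_or_eq with h | h
      · refine ⟨?_, hheight _ h⟩
        rw [hgate i hi, hgate _ h]
        unfold cyclicDist
        omega
      · have h0 : c.getVert (i + 1) = c.getVert 0 := by
          rw [show i + 1 = c.length from h, Walk.getVert_length, Walk.getVert_zero]
        rw [h0]
        refine ⟨?_, hheight _ (by omega)⟩
        rw [hgate i hi, hgate 0 (by omega)]
        unfold cyclicDist
        omega
    intro x y hxy
    by_cases he : s(x, y) ∈ c.edges
    · right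
      obtain ⟨i, hi, h⟩ := c.mk_mem_edges_iff_exists.mp he
      rcases Sym2.eq_iff.mp h with ⟨rfl, rfl⟩ | ⟨rfl, rfl⟩
      · exact ⟨hheight i hi, (hcyc i hi).2, (hcyc i hi).1⟩
      · refine ⟨(hcyc i hi).2, hheight i hi, ?_⟩
        rw [cyclicDist_comm]
        exact (hcyc i hi).1
    · left
      have hadj : H.Adj x y := by
        rw [hH, deleteEdges_adj]
        exact ⟨hxy, he⟩
      exact ⟨(hedge x y hadj).1, (hedge x y hadj).2, (hedge y x hadj.symm).2⟩
  · intro v k hk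
    obtain ⟨w, hr, -, hd⟩ := exists_dist_eq_and_dist_eq_sub (hreach v)
      (k := H.dist v (c.getVert (gate v)) - k) (by omega)
    have hg := huniq w _ (hlt v) hr
    refine ⟨w, hg, ?_⟩
    simp only [hg]
    omega
  · exact fun i hi => ⟨c.getVert i, hgate i hi, hheight i hi⟩
  · intro x y
    have hx := (hreach x).dist_anti hHG
    have hy := (hreach y).dist_anti hHG
    have h₁ := hG.1.dist_triangle (u := x) (v := c.getVert (gate x)) (w := y)
    have h₂ := hG.1.dist_triangle (u := c.getVert (gate x)) (v := c.getVert (gate y)) (w := y)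
    have hyc : G.dist (c.getVert (gate y)) y = G.dist y (c.getVert (gate y)) :=
      SimpleGraph.dist_comm
    have key : ∀ i j, i ≤ j → j < c.length →
        G.dist (c.getVert i) (c.getVert j) ≤ cyclicDist c.length i j := by
      intro i j hij hj
      have h₁ := dist_getVert_le c hij hj.le
      have h₂ := dist_getVert_le c (Nat.zero_le i) (by omega)
      have h₃ := dist_getVert_le c hj.le le_rfl
      have h₄ := hG.1.dist_triangle (u := c.getVert j) (v := u) (w := c.getVert i)
      rw [Walk.getVert_zero] at h₂
      rw [Walk.getVert_length] at h₃
      rw [SimpleGraph.dist_comm] at h₄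
      unfold cyclicDist
      omega
    have h₃ : G.dist (c.getVert (gate x)) (c.getVert (gate y)) ≤
        cyclicDist c.length (gate x) (gate y) := by
      rcases le_total (gate x) (gate y) with h | h
      · exact key _ _ h (hlt y)
      · have := key _ _ h (hlt x)
        rwa [SimpleGraph.dist_comm, cyclicDist_comm]
    omega
  · intro v hv
    obtain ⟨i, hi, rfl⟩ := Walk.exists_getVert_of_mem_support hc hv
    exact hheight i hi


/-- A set of natural numbers is at most as large as the interval it spans. -/
lemma exists_card_le_add_one_sub (X : Finset ℕ) :
    X = ∅ ∨ ∃ a ∈ X, ∃ b ∈ X, a ≤ b ∧ X.card ≤ b + 1 - a := by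
  rcases X.eq_empty_or_nonempty with h | h
  · exact .inl h
  · refine .inr ⟨X.min' h, X.min'_mem h, X.max' h, X.max'_mem h, X.min'_le_max' h, ?_⟩
    rw [← Nat.card_Icc]
    exact Finset.card_le_card fun x hx => Finset.mem_Icc.mpr ⟨X.min'_le x hx, X.le_max' x hx⟩

lemma exists_card_le_add {X : Finset ℕ} {A B : ℕ → Prop} (h : ∀ x ∈ X, A x ∨ B x) :
    ∃ xA xB, X.card ≤ xA + xB ∧
      (xA = 0 ∨ ∃ a ∈ X, ∃ b ∈ X, A a ∧ A b ∧ a ≤ b ∧ xA ≤ b + 1 - a) ∧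
      (xB = 0 ∨ ∃ a ∈ X, ∃ b ∈ X, B a ∧ B b ∧ a ≤ b ∧ xB ≤ b + 1 - a) := by
  classical
  have key : ∀ C : ℕ → Prop, (X.filter C).card = 0 ∨ ∃ a ∈ X, ∃ b ∈ X, C a ∧ C b ∧ a ≤ b ∧
      (X.filter C).card ≤ b + 1 - a := by
    intro C
    rcases exists_card_le_add_one_sub (X.filter C) with h | ⟨a, ha, b, hb, hab⟩
    · exact .inl (by rw [h, Finset.card_empty])
    · rw [Finset.mem_filter] at ha hb
      exact .inr ⟨a, ha.1, b, hb.1, ha.2, hb.2, hab⟩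
  refine ⟨(X.filter A).card, (X.filter B).card, ?_, key A, key B⟩
  refine le_trans (Finset.card_le_card fun x hx => ?_) (Finset.card_union_le _ _)
  simpa [hx] using h x hx

lemma exists_isMultipacking_ncard_eq {G : SimpleGraph V} {ι : Type*} (S : Finset ι) (f : ι → V)
    (hf : Set.InjOn f S)
    (h : ∀ v r, 1 ≤ r → (S.filter fun i => G.dist (f i) v ≤ r).card ≤ r) :
    ∃ M, IsMultipacking G M ∧ M.ncard = S.card := by
  refine ⟨f '' S, fun v r hr => ?_, ?_⟩
  · have heq : f '' S ∩ {u | G.dist u v ≤ r} = f '' (S.filter fun i => G.dist (f i) v ≤ r) := by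
      ext u
      simp only [Set.mem_inter_iff, Set.mem_image, Finset.mem_coe, Set.mem_ofPred_eq,
        Finset.mem_filter]
      constructor
      · rintro ⟨⟨i, hi, rfl⟩, hd⟩
        exact ⟨i, ⟨hi, hd⟩, rfl⟩
      · rintro ⟨i, ⟨hi, hd⟩, rfl⟩
        exact ⟨⟨i, hi, rfl⟩, hd⟩
    rw [heq]
    refine (Set.ncard_image_le (Finset.finite_toSet _)).trans ?_
    rw [Set.ncard_coe_finset]
    exact h v r hr
  · rw [hf.ncard_image, Set.ncard_coe_finset]

/-- A ball of radius `r ≥ 1` meets a sequence of vertices whose indices differ by at most a third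
of their distances in at most `r` terms. -/
lemma card_filter_dist_le {G : SimpleGraph V} (hG : G.Connected) {f : ℕ → V} {X : Finset ℕ}
    (hf : ∀ i ∈ X, ∀ j ∈ X, i ≤ j → 3 * j ≤ 3 * i + G.dist (f i) (f j)) {v : V} {r : ℕ}
    (hr : 1 ≤ r) (hX : ∀ i ∈ X, G.dist (f i) v ≤ r) : X.card ≤ r := by
  rcases exists_card_le_add_one_sub X with h | ⟨a, ha, b, hb, hab, h⟩
  · simp [h]
  · have h₁ := hf a ha b hb hab
    have h₂ := hG.dist_triangle (u := f a) (v := v) (w := f b)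
    have h₃ := hX a ha
    have h₄ := hX b hb
    rw [SimpleGraph.dist_comm] at h₄
    omega

lemma exists_isMultipacking_of_dist {G : SimpleGraph V} (hG : G.Connected) (a b : V) :
    ∃ M, IsMultipacking G M ∧ G.dist a b + 1 ≤ 3 * M.ncard := by
  have h : ∀ k, ∃ w, k ≤ G.dist a b → G.dist a w = k := by
    intro k
    by_cases hk : k ≤ G.dist a b
    · obtain ⟨w, -, hw, -⟩ := exists_dist_eq_and_dist_eq_sub (hG.preconnected a b) hk
      exact ⟨w, fun _ => hw⟩
    · exact ⟨a, fun h => absurd h hk⟩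
  choose f hf using h
  have hd : ∀ i ∈ Finset.range (G.dist a b / 3 + 1), ∀ j ∈ Finset.range (G.dist a b / 3 + 1),
      i ≤ j → 3 * j ≤ 3 * i + G.dist (f (3 * i)) (f (3 * j)) := by
    intro i hi j hj _
    rw [Finset.mem_range] at hi hj
    have h := hG.dist_triangle (u := a) (v := f (3 * i)) (w := f (3 * j))
    rwa [hf _ (by omega), hf _ (by omega)] at h
  have hinj : Set.InjOn (fun k => f (3 * k)) (Finset.range (G.dist a b / 3 + 1)) := by
    intro i hi j hj hij
    have hij : f (3 * i) = f (3 * j) := hij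
    rcases le_total i j with h | h
    · have := hd i hi j hj h
      rw [hij, dist_self] at this
      omega
    · have := hd j hj i hi h
      rw [hij, dist_self] at this
      omega
  obtain ⟨M, hM, hcard⟩ := exists_isMultipacking_ncard_eq (G := G) _ _ hinj fun v r hr =>
    card_filter_dist_le (f := fun k => f (3 * k)) hG (fun i hi j hj =>
      hd i (Finset.mem_filter.mp hi).1 j (Finset.mem_filter.mp hj).1) hr
      fun i hi => (Finset.mem_filter.mp hi).2
  refine ⟨M, hM, ?_⟩
  rw [hcard, Finset.card_range]
  omega

/-- The counting bound for a ball whose gate lies on the geodesic. Here `X₁` and `X₂` index the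
chosen vertices of the geodesic and of the rest of the cycle that lie in the ball. -/
lemma card_add_card_le_of_gate_mem {X₁ X₂ : Finset ℕ} {n s l r e : ℕ} (h₁ne : X₁.Nonempty)
    (h₂ne : X₂.Nonempty) (hl : 2 * l ≤ n) (hls : l + s + 6 ≤ n) (he : e ≤ s)
    (hX₁ : ∀ i ∈ X₁, ∀ j ∈ X₁, 3 * j ≤ 3 * i + 2 * r)
    (hX₂ : ∀ m ∈ X₂, 3 * m + 6 ≤ l ∧ (e + (3 * m + 6) ≤ r ∨ n ≤ r + e + (3 * m + 6))) :
    X₁.card + X₂.card ≤ r := by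
  rcases exists_card_le_add_one_sub X₁ with h | ⟨k₁, hk₁, k₂, hk₂, hk, h₁⟩
  · simp [h] at h₁ne
  rcases exists_card_le_add_one_sub X₂ with h | ⟨m₁, hm₁, m₂, hm₂, hm, h₂⟩
  · simp [h] at h₂ne
  obtain ⟨xA, xB, hx, hA, hB⟩ := exists_card_le_add fun m hm => (hX₂ m hm).2
  have h₃ := hX₁ k₁ hk₁ k₂ hk₂
  have h₄ := (hX₂ m₂ hm₂).1
  rw [← Finset.card_pos] at h₂ne
  rcases hA with hA | ⟨a₁, -, a₂, -, hA⟩ <;> rcases hB with hB | ⟨b₁, -, b₂, hb₂, hB⟩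
  · omega
  · have := (hX₂ b₂ hb₂).1
    omega
  · omega
  · have := (hX₂ b₂ hb₂).1
    omega

/-- The counting bound for a ball whose gate `p` lies off the geodesic. Here `X₁` and `X₂` index
the chosen vertices of the geodesic and of the rest of the cycle that lie in the ball. -/
lemma card_add_card_le_of_gate_notMem {X₁ X₂ : Finset ℕ} {n s l r p t : ℕ} (h₁ne : X₁.Nonempty)
    (h₂ne : X₂.Nonempty) (hs : 2 * s ≤ n) (hl : 2 * l ≤ n) (hls : l + s + 6 ≤ n) (hp : 0 < p)
    (hp' : p + s < n)
    (hX₁ : ∀ k ∈ X₁, (p + 3 * k ≤ r + t ∧ p + t ≤ r + 3 * k) ∨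
      (n + 3 * k ≤ r + p + t + 2 * s ∧ n + t ≤ r + p + 3 * k))
    (hX₂ : ∀ m ∈ X₂, 3 * m + 6 ≤ l ∧
      ((p ≤ r + (3 * m + 6) ∧ 3 * m + 6 ≤ r + p) ∨ n + (3 * m + 6) ≤ r + p)) :
    X₁.card + X₂.card ≤ r := by
  rcases exists_card_le_add_one_sub X₁ with h | ⟨k₁, hk₁, k₂, hk₂, hk, h₁⟩
  · simp [h] at h₁ne
  rcases exists_card_le_add_one_sub X₂ with h | ⟨m₁, hm₁, m₂, hm₂, hm, h₂⟩
  · simp [h] at h₂ne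
  obtain ⟨xA, xB, hx, hA, hB⟩ := exists_card_le_add hX₁
  have h₃ := hX₁ k₁ hk₁
  have h₄ := hX₁ k₂ hk₂
  have h₅ := hX₂ m₂ hm₂
  rcases hA with hA | ⟨a₁, -, a₂, -, ⟨-, ha₁⟩, ⟨ha₂, -⟩, ha, hA⟩ <;>
    rcases hB with hB | ⟨b₁, -, b₂, -, ⟨-, hb₁⟩, ⟨hb₂, -⟩, hb, hB⟩
  · rw [← Finset.card_pos] at h₁ne
    omega
  · clear h₃ h₄ hk hk₁ hk₂ h₁
    obtain ⟨xN, xW, hx', hN, hW⟩ := exists_card_le_add fun m hm => (hX₂ m hm).2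
    replace hN : xN = 0 ∨ ∃ c₁ c₂, c₁ ≤ c₂ ∧ xN ≤ c₂ + 1 - c₁ ∧ 3 * c₂ + 6 ≤ l ∧
        p ≤ r + (3 * c₁ + 6) := by
      refine hN.imp_right ?_
      rintro ⟨c₁, -, c₂, hc₂, hc⟩
      exact ⟨c₁, c₂, hc.2.2.1, hc.2.2.2, (hX₂ c₂ hc₂).1, hc.1.1⟩
    rcases hN with hN | ⟨c₁, c₂, hN⟩ <;> rcases hW with hW | ⟨d₁, -, d₂, -, hW⟩ <;> omega
  · clear h₃ h₄ hk hk₁ hk₂ h₁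
    omega
  · have hA' : 3 * xA + 2 * p ≤ 2 * r + 3 ∧ p ≤ r := by omega
    have hB' : 3 * xB + 2 * n ≤ 2 * r + 2 * p + 2 * s + 3 ∧ n ≤ r + p + s := by omega
    have hm' : 3 * X₂.card + 3 ≤ l := by omega
    clear hA hB ha₁ ha₂ hb₁ hb₂ ha hb h₂ hm h₅
    rcases h₃ with h₃ | h₃ <;> rcases h₄ with h₄ | h₄ <;> omega

namespace IsCycleGate

variable {G : SimpleGraph V} {n : ℕ} {gate height : V → ℕ}

/-- A long path through the cycle, together with the rest of the cycle, contains a large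
multipacking. -/
lemma exists_isMultipacking (hG : IsCycleGate G n gate height) (hc : G.Connected) {a b : V}
    (ha : gate a = 0) (hb : 0 < gate b) (hn : n ≤ 2 * gate b) :
    ∃ M, IsMultipacking G M ∧ G.dist a b + n / 2 ≤ 3 * M.ncard + 11 := by
  classical
  have hbn := hG.gate_lt b
  obtain ⟨s, hs⟩ : ∃ s, s + gate b = n := ⟨n - gate b, by omega⟩
  have hD : G.dist a b = height a + s + height b := by
    have h₁ := hG.le_dist hc (u := a) (v := b) (by omega)
    have h₂ := hG.dist_le a b
    simp only [cyclicDist, ha] at h₁ h₂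
    omega
  rw [hD]
  have hP : ∀ i, ∃ w, i ≤ height a + s + height b →
      (i ≤ height a ∧ gate w = 0 ∧ height w + i = height a) ∨
      (height a < i ∧ i < height a + s ∧ gate w + i = n + height a ∧ height w = 0) ∨
      (height a + s ≤ i ∧ gate w = gate b ∧ height w + height a + s = i) := by
    intro i
    rcases le_or_gt i (height a) with h | h
    · obtain ⟨w, h₁, h₂⟩ := hG.exists_height_eq a (height a - i) (by omega)
      exact ⟨w, by omega⟩
    rcases lt_or_ge i (height a + s) with h' | h'
    · obtain ⟨w, h₁, h₂⟩ := hG.exists_gate_eq (n + height a - i) (by omega)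
      exact ⟨w, by omega⟩
    · obtain h'' | h'' := le_or_gt (i - height a - s) (height b)
      · obtain ⟨w, h₁, h₂⟩ := hG.exists_height_eq b (i - height a - s) h''
        exact ⟨w, by omega⟩
      · exact ⟨a, by omega⟩
  choose P hP using hP
  have hT : ∀ j, ∃ w, j < n → gate w = j ∧ height w = 0 := by
    intro j
    by_cases hj : j < n
    · obtain ⟨w, hw⟩ := hG.exists_gate_eq j hj
      exact ⟨w, fun _ => hw⟩
    · exact ⟨a, fun h => absurd h hj⟩
  choose T hT using hT
  obtain ⟨l, hl⟩ : ∃ l, l = min (n / 2) (gate b - 6) := ⟨_, rfl⟩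
  set p := (height a + s + height b) / 3 + 1 with hp
  set q := (l - 3) / 3 with hq
  have hPd : ∀ i j, i ≤ j → j ≤ height a + s + height b → j ≤ i + G.dist (P i) (P j) := by
    intro i j hij hj
    have h₁ := hP i (by omega)
    have h₂ := hP j hj
    by_cases h : gate (P i) = gate (P j)
    · have := hG.height_le hc h
      omega
    · have := hG.le_dist hc h
      unfold cyclicDist at this
      omega
  have hTd : ∀ i j, i ≤ j → 2 * j ≤ n → j < n → j ≤ i + G.dist (T i) (T j) := by
    intro i j hij hj hj'
    have h₁ := hT i (by omega)
    have h₂ := hT j hj'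
    rcases hij.eq_or_lt with rfl | hlt
    · omega
    · have := hG.le_dist hc (u := T i) (v := T j) (by omega)
      unfold cyclicDist at this
      omega
  have hPd' : ∀ i < p, ∀ j < p, i ≤ j → 3 * j ≤ 3 * i + G.dist (P (3 * i)) (P (3 * j)) :=
    fun i hi j hj hij => hPd _ _ (by omega) (by omega)
  have hTd' : ∀ i < q, ∀ j < q, i ≤ j →
      3 * j ≤ 3 * i + G.dist (T (3 * i + 6)) (T (3 * j + 6)) := by
    intro i hi j hj hij
    have := hTd (3 * i + 6) (3 * j + 6) (by omega) (by omega) (by omega)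
    omega
  have hPT : ∀ i < p, ∀ j < q, P (3 * i) ≠ T (3 * j + 6) := by
    intro i hi j hj h
    have h₁ := hP (3 * i) (by omega)
    have h₂ := hT (3 * j + 6) (by omega)
    rw [h] at h₁
    omega
  have hinj : Set.InjOn (Sum.elim (fun i => P (3 * i)) fun j => T (3 * j + 6))
      ((Finset.range p).disjSum (Finset.range q)) := by
    rintro (i | i) hi (j | j) hj hij <;>
      simp only [Finset.mem_coe, Finset.inl_mem_disjSum, Finset.inr_mem_disjSum, Finset.mem_range,
        Sum.elim_inl, Sum.elim_inr] at hi hj hij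
    · rcases le_total i j with h | h
      · have := hPd' i hi j hj h
        rw [hij, dist_self] at this
        rw [show i = j by omega]
      · have := hPd' j hj i hi h
        rw [hij, dist_self] at this
        rw [show i = j by omega]
    · exact absurd hij (hPT i hi j hj)
    · exact absurd hij.symm (hPT j hj i hi)
    · rcases le_total i j with h | h
      · have := hTd' i hi j hj h
        rw [hij, dist_self] at this
        rw [show i = j by omega]
      · have := hTd' j hj i hi h
        rw [hij, dist_self] at this
        rw [show i = j by omega]
  have hball : ∀ v r, 1 ≤ r → (((Finset.range p).disjSum (Finset.range q)).filter fun i =>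
      G.dist (Sum.elim (fun i => P (3 * i)) (fun j => T (3 * j + 6)) i) v ≤ r).card ≤ r := by
    intro v r hr
    obtain ⟨X₁, hX₁⟩ : ∃ X, X = (Finset.range p).filter fun i => G.dist (P (3 * i)) v ≤ r :=
      ⟨_, rfl⟩
    obtain ⟨X₂, hX₂⟩ : ∃ X, X = (Finset.range q).filter fun j => G.dist (T (3 * j + 6)) v ≤ r :=
      ⟨_, rfl⟩
    have hX : ((Finset.range p).disjSum (Finset.range q)).filter (fun i =>
        G.dist (Sum.elim (fun i => P (3 * i)) (fun j => T (3 * j + 6)) i) v ≤ r) =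
        X₁.disjSum X₂ := by
      ext (i | i) <;> simp [hX₁, hX₂]
    rw [hX, Finset.card_disjSum]
    replace hX₁ : ∀ i ∈ X₁, i < p ∧ G.dist (P (3 * i)) v ≤ r := by simp [hX₁]
    replace hX₂ : ∀ j ∈ X₂, j < q ∧ G.dist (T (3 * j + 6)) v ≤ r := by simp [hX₂]
    clear hX hinj hPT
    rcases X₂.eq_empty_or_nonempty with h₂ | h₂
    · rw [h₂, Finset.card_empty, add_zero]
      exact card_filter_dist_le (f := fun k => P (3 * k)) hc (fun i hi j hj =>
        hPd' i (hX₁ i hi).1 j (hX₁ j hj).1) hr fun i hi => (hX₁ i hi).2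
    rcases X₁.eq_empty_or_nonempty with h₁ | h₁
    · rw [h₁, Finset.card_empty, zero_add]
      exact card_filter_dist_le (f := fun k => T (3 * k + 6)) hc (fun i hi j hj =>
        hTd' i (hX₂ i hi).1 j (hX₂ j hj).1) hr fun i hi => (hX₂ i hi).2
    have hls : l + s + 6 ≤ n := by
      obtain ⟨j, hj⟩ := h₂
      have := (hX₂ j hj).1
      omega
    have hvn := hG.gate_lt v
    by_cases hv : gate v = 0 ∨ gate b ≤ gate v
    · obtain ⟨e, he, hes⟩ : ∃ e, (gate v = 0 ∧ e = 0 ∨ 0 < gate v ∧ gate v + e = n) ∧ e ≤ s := by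
        rcases hv with hv | hv
        · exact ⟨0, by omega⟩
        · exact ⟨n - gate v, by omega⟩
      refine card_add_card_le_of_gate_mem h₁ h₂ (n := n) (l := l) (e := e) (by omega) hls hes
        ?_ ?_
      · intro i hi j hj
        rcases le_total i j with h | h
        · have hd := hPd' i (hX₁ i hi).1 j (hX₁ j hj).1 h
          have ht := hc.dist_triangle (u := P (3 * i)) (v := v) (w := P (3 * j))
          have hi' := (hX₁ i hi).2
          have hj' := (hX₁ j hj).2
          rw [SimpleGraph.dist_comm] at hj'
          omega
        · omega
      · intro m hm
        obtain ⟨hmq, hmd⟩ := hX₂ m hm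
        have hT' := hT (3 * m + 6) (by omega)
        have hd := hG.le_dist hc (u := T (3 * m + 6)) (v := v) (by omega)
        unfold cyclicDist at hd
        omega
    · push Not at hv
      have hr' : height v ≤ r := by
        obtain ⟨j, hj⟩ := h₂
        obtain ⟨hmq, hmd⟩ := hX₂ j hj
        by_cases h : gate (T (3 * j + 6)) = gate v
        · have := hT (3 * j + 6) (by omega)
          have := hG.height_le hc h
          omega
        · have := hG.le_dist hc h
          omega
      obtain ⟨r', rfl⟩ := Nat.exists_eq_add_of_le' hr'
      refine (card_add_card_le_of_gate_notMem h₁ h₂ (n := n) (s := s) (l := l) (r := r')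
        (p := gate v) (t := height a) (by omega) (by omega) hls (by omega) (by omega) ?_ ?_).trans
        (Nat.le_add_right _ _)
      · intro i hi
        obtain ⟨hip, hid⟩ := hX₁ i hi
        have hP' := hP (3 * i) (by omega)
        have hd := hG.le_dist hc (u := P (3 * i)) (v := v) (by omega)
        unfold cyclicDist at hd
        omega
      · intro m hm
        obtain ⟨hmq, hmd⟩ := hX₂ m hm
        have hT' := hT (3 * m + 6) (by omega)
        by_cases h : gate (T (3 * m + 6)) = gate v
        · have := hG.height_le hc h
          omega
        · have hd := hG.le_dist hc h
          unfold cyclicDist at hd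
          omega
  obtain ⟨M, hM, hcard⟩ := exists_isMultipacking_ncard_eq (G := G) _ _ hinj hball
  refine ⟨M, hM, ?_⟩
  rw [hcard, Finset.card_disjSum, Finset.card_range, Finset.card_range]
  omega

end IsCycleGate

lemma exists_radius [Fintype V] [Nonempty V] (G : SimpleGraph V) :
    ∃ v r, (∀ u, G.dist v u ≤ r) ∧ ∀ p, ∃ z, r ≤ G.dist p z := by
  have h : ∀ p, ∃ z, ∀ u, G.dist p u ≤ G.dist p z := fun p => Finite.exists_max _
  choose z hz using h
  obtain ⟨v, hv⟩ := Finite.exists_min fun p => G.dist p (z p)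
  exact ⟨v, G.dist v (z v), hz v, fun p => ⟨z p, hv p⟩⟩

/-- Every path between the two sides of a bridge passes through the bridge. -/
lemma dist_add_one_add_dist_le_length {G : SimpleGraph V} {u v : V}
    (h : ¬ (G.deleteEdges {s(v, u)}).Reachable u v) {x y : V} (w : G.Walk x y)
    (hx : (G.deleteEdges {s(v, u)}).Reachable x u)
    (hy : (G.deleteEdges {s(v, u)}).Reachable v y) :
    G.dist x u + 1 + G.dist v y ≤ w.length := by
  induction w with
  | nil => exact absurd (hx.symm.trans hy.symm) h
  | @cons x z y hxz p ih =>
    rw [Walk.length_cons]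
    by_cases he : s(x, z) = s(v, u)
    · rcases Sym2.eq_iff.mp he with ⟨rfl, rfl⟩ | ⟨rfl, rfl⟩
      · exact absurd hx.symm h
      · have := dist_le p
        rw [dist_self]
        omega
    · have hadj : (G.deleteEdges {s(v, u)}).Adj x z := by
        rw [deleteEdges_adj]
        exact ⟨hxz, he⟩
      have := ih (hadj.reachable.symm.trans hx) hy
      have h₁ := hxz.reachable.dist_triangle_left u
      rw [dist_eq_one_iff_adj.mpr hxz] at h₁
      omega

/-- On deleting an edge of a connected graph, each vertex remains connected to one of its ends. -/
lemma reachable_deleteEdges_or {G : SimpleGraph V} {u v x y : V} (w : G.Walk x y)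
    (hy : y = u ∨ y = v) :
    (G.deleteEdges {s(v, u)}).Reachable x u ∨ (G.deleteEdges {s(v, u)}).Reachable v x := by
  induction w with
  | nil =>
    rcases hy with rfl | rfl
    · exact .inl (.refl _)
    · exact .inr (.refl _)
  | @cons x z y hxz p ih =>
    by_cases he : s(x, z) = s(v, u)
    · rcases Sym2.eq_iff.mp he with ⟨rfl, rfl⟩ | ⟨rfl, rfl⟩
      · exact .inr (.refl _)
      · exact .inl (.refl _)
    · have hadj : (G.deleteEdges {s(v, u)}).Adj x z := by
        rw [deleteEdges_adj]
        exact ⟨hxz, he⟩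
      exact (ih hy).imp hadj.reachable.trans fun h => h.trans hadj.reachable.symm

lemma exists_two_mul_le_dist_add_one {G : SimpleGraph V} (hG : G.Connected) {u v x : V} {r : ℕ}
    (huv : G.dist v u = 1) (h : ¬ (G.deleteEdges {s(v, u)}).Reachable u v)
    (hv : ∀ z, G.dist v z ≤ r)
    (hu : ∃ z, r ≤ G.dist u z) (hx : G.dist v x = r) (hxu : G.dist u x + 1 = r) :
    ∃ a b, 2 * r ≤ G.dist a b + 1 := by
  obtain ⟨z, hz⟩ := hu
  have hside : ∀ x, (G.deleteEdges {s(v, u)}).Reachable x u ∨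
      (G.deleteEdges {s(v, u)}).Reachable v x := fun x =>
    (hG.preconnected x u).elim fun w => reachable_deleteEdges_or w (.inl rfl)
  have hcross : ∀ {x y}, (G.deleteEdges {s(v, u)}).Reachable x u →
      (G.deleteEdges {s(v, u)}).Reachable v y → G.dist x u + 1 + G.dist v y ≤ G.dist x y := by
    intro x y hx hy
    obtain ⟨w, hw⟩ := hG.exists_walk_length_eq_dist x y
    rw [← hw]
    exact dist_add_one_add_dist_le_length h w hx hy
  have hxs : (G.deleteEdges {s(v, u)}).Reachable x u := by
    rcases hside x with h | h
    · exact h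
    · have := hcross (.refl _) h
      rw [dist_self] at this
      omega
  have hzs : (G.deleteEdges {s(v, u)}).Reachable v z := by
    rcases hside z with h | h
    · have := hcross h (.refl _)
      have hzv := hv z
      rw [dist_self] at this
      rw [SimpleGraph.dist_comm] at hz hzv
      omega
    · exact h
  have h₁ := hcross hxs hzs
  have h₂ := hcross (.refl _) hzs
  have h₃ := hG.dist_triangle (u := u) (v := v) (w := z)
  rw [SimpleGraph.dist_comm] at hxu huv
  exact ⟨x, z, by omega⟩

lemma IsCycleGate.height_add_le {G : SimpleGraph V} {n : ℕ} {gate height : V → ℕ}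
    (hG : IsCycleGate G n gate height) (hc : G.Connected) {u v x : V} {r D : ℕ}
    (hD : ∀ a b, G.dist a b ≤ D) (hv : ∀ z, G.dist v z ≤ r) (hp : ∀ p, ∃ z, r ≤ G.dist p z)
    (hx : G.dist v x = r) (hxu : G.dist u x + 1 = r) (hu0 : height u = 0) (hv0 : height v = 0)
    (hne : u ≠ v) (y : V) : height y + r ≤ D := by
  by_cases hy : gate y = gate v
  · have huv : gate u ≠ gate v := by
      intro h
      have := hG.dist_le u v
      have h' := hc.pos_dist_of_ne hne
      simp only [hu0, hv0, h, cyclicDist] at this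
      omega
    have hxv : gate x ≠ gate v := by
      intro h
      have h₁ := hG.dist_le v x
      have h₂ := hG.le_dist hc (u := u) (v := x) (by rwa [h])
      have h₃ := hG.gate_lt u
      have h₄ := hG.gate_lt v
      rw [h] at h₁ h₂
      unfold cyclicDist at h₁ h₂
      omega
    have h₁ := hG.dist_le v x
    have h₂ := hG.le_dist hc (u := x) (v := y) (by rwa [hy])
    have h₃ := hD x y
    rw [hy, cyclicDist_comm] at h₂
    omega
  · obtain ⟨w, hw, hw0⟩ := hG.exists_gate_eq (gate y) (hG.gate_lt y)
    obtain ⟨z, hz⟩ := hp w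
    have h₁ := hG.dist_le w z
    have hzy : gate z ≠ gate y := by
      intro h
      have h₂ := hG.le_dist hc (u := v) (v := z) (by rw [h]; exact Ne.symm hy)
      have h₃ := hG.gate_lt y
      have h₄ := hG.gate_lt v
      have h₅ := hv z
      rw [h, hw] at h₁
      rw [h] at h₂
      unfold cyclicDist at h₁ h₂
      omega
    have h₂ := hG.le_dist hc (Ne.symm hzy)
    have h₃ := hD y z
    rw [hw] at h₁
    omega

lemma IsCactus.exists_isMultipacking [Fintype V] {G : SimpleGraph V} (hG : IsCactus G) {v : V}
    {r : ℕ} (hv : ∀ u, G.dist v u ≤ r) (hp : ∀ p, ∃ z, r ≤ G.dist p z) :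
    ∃ M, IsMultipacking G M ∧ 2 * r ≤ 3 * M.ncard + 11 := by
  have hc := hG.1
  rcases Nat.eq_zero_or_pos r with rfl | hr
  · obtain ⟨M, hM, -⟩ := exists_isMultipacking_of_dist hc v v
    exact ⟨M, hM, by omega⟩
  obtain ⟨x, hx⟩ := hp v
  replace hx : G.dist v x = r := le_antisymm (hv x) hx
  obtain ⟨u, -, hvu, hux⟩ := exists_dist_eq_and_dist_eq_sub (hc.preconnected v x) (k := 1)
    (by omega)
  have hadj : G.Adj v u := dist_eq_one_iff_adj.mp hvu
  by_cases hb : (G.deleteEdges {s(v, u)}).Reachable u v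
  · obtain ⟨t, c, hcyc, hmem⟩ := adj_and_reachable_delete_edges_iff_exists_cycle.mp
      ⟨hadj, hb.symm⟩
    obtain ⟨n, gate, height, hgate, h0⟩ := hG.exists_isCycleGate hcyc
    have : Nonempty (V × V) := ⟨(v, v)⟩
    obtain ⟨⟨a, b⟩, hab⟩ := Finite.exists_max fun p : V × V => G.dist p.1 p.2
    have hh := hgate.height_add_le hc (fun x y => hab (x, y)) hv hp hx (by omega)
      (h0 u (c.snd_mem_support_of_mem_edges hmem)) (h0 v (c.fst_mem_support_of_mem_edges hmem))
      hadj.ne'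
    have hha := hh a
    have hhb := hh b
    have hhx := hh x
    have hd := hgate.dist_le v x
    rw [h0 v (c.fst_mem_support_of_mem_edges hmem)] at hd
    have hgx := hgate.gate_lt x
    have hgv := hgate.gate_lt v
    by_cases hg : gate a = gate b
    · have hd' := hgate.dist_le a b
      rw [hg] at hd'
      obtain ⟨M, hM, hcard⟩ := exists_isMultipacking_of_dist hc a b
      refine ⟨M, hM, ?_⟩
      simp only [cyclicDist] at hd' hha hhb
      omega
    · obtain ⟨gate', hgate', ha, hb, hn⟩ := hgate.exists_normalized hg
      obtain ⟨M, hM, hcard⟩ := hgate'.exists_isMultipacking hc ha hb hn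
      refine ⟨M, hM, ?_⟩
      simp only [cyclicDist] at hd hhx
      omega
  · obtain ⟨a, b, hab⟩ := exists_two_mul_le_dist_add_one hc hvu hb hv (hp u) hx (by omega)
    obtain ⟨M, hM, hcard⟩ := exists_isMultipacking_of_dist hc a b
    exact ⟨M, hM, by omega⟩

lemma IsMultipacking.ncard_le [Finite V] {G : SimpleGraph V} {M : Set V}
    (hM : IsMultipacking G M) : M.ncard ≤ multipackingNumber G := by
  refine le_csSup ⟨Nat.card V, ?_⟩ ⟨M, hM, rfl⟩
  rintro _ ⟨M', -, rfl⟩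
  exact Set.ncard_le_card M'

lemma broadcastDominationNumber_le [Finite V] {G : SimpleGraph V} (hG : G.Connected) {v : V}
    {r : ℕ} (hv : ∀ u, G.dist v u ≤ r) (hp : ∀ p, ∃ z, r ≤ G.dist p z) :
    broadcastDominationNumber G ≤ r := by
  classical
  have hbdd : BddAbove (Set.range fun p : V × V => G.dist p.1 p.2) := (Set.finite_range _).bddAbove
  obtain ⟨x, hx⟩ := hp v
  have hle : r ≤ gDiam G := hx.trans (le_csSup hbdd ⟨(v, x), rfl⟩)
  rcases Nat.eq_zero_or_pos r with rfl | hr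
  · have hdiam : gDiam G = 0 := by
      refine Nat.le_zero.mp (csSup_le ⟨_, (v, v), rfl⟩ ?_)
      rintro _ ⟨⟨a, b⟩, rfl⟩
      have h := hG.dist_triangle (u := a) (v := v) (w := b)
      rwa [SimpleGraph.dist_comm (u := a) (v := v), Nat.le_zero.mp (hv a),
        Nat.le_zero.mp (hv b)] at h
    refine (Nat.sInf_eq_zero.mpr (.inr ?_)).le
    rw [Set.eq_empty_iff_forall_notMem]
    rintro _ ⟨f, ⟨hf, hdom⟩, -⟩
    obtain ⟨w, hw, -⟩ := hdom v
    have := hf w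
    omega
  · refine Nat.sInf_le ⟨Pi.single v r, ⟨fun w => ?_, fun u => ⟨v, ?_⟩⟩, ?_⟩
    · by_cases h : w = v
      · subst h; simpa using hle
      · simp [h]
    · rw [Pi.single_eq_same, SimpleGraph.dist_comm]
      exact ⟨hr, hv u⟩
    · rw [finsum_eq_single _ v fun w hw => Pi.single_eq_of_ne hw _, Pi.single_eq_same]

/-- If G is a finite cactus graph, then γ_b(G) ≤ (3/2)·MP(G) + 11/2. -/
theorem stmt8 {V : Type*} [Fintype V] (G : SimpleGraph V) (hcactus : IsCactus G) :
    (broadcastDominationNumber G : ℚ) ≤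
      (3 / 2 : ℚ) * multipackingNumber G + 11 / 2 := by
  have := hcactus.1.nonempty
  obtain ⟨v, r, hv, hp⟩ := exists_radius G
  obtain ⟨M, hM, hcard⟩ := hcactus.exists_isMultipacking hv hp
  have h₁ := hM.ncard_le
  have h₂ := broadcastDominationNumber_le hcactus.1 hv hp
  have h₃ : 2 * broadcastDominationNumber G ≤ 3 * multipackingNumber G + 11 := by omega
  have h₄ : (2 * broadcastDominationNumber G : ℚ) ≤ 3 * multipackingNumber G + 11 := by
    exact_mod_cast h₃
  linarith
end

section
/- For every positive integer k, there exists a finite graph G_k that is both a cactus and AT-free, such that MP(G_k) = 3k and γ_b(G_k) = 4k. -/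
open SimpleGraph

variable {V : Type*}

/-- An asteroidal triple: an independent set of three vertices such that each pair is
joined by a path avoiding the closed neighbourhood of the third. A graph is AT-free
if it contains no asteroidal triple. -/
def IsATFree (G : SimpleGraph V) : Prop :=
  ¬∃ x y z : V, x ≠ y ∧ x ≠ z ∧ y ≠ z ∧ ¬G.Adj x y ∧ ¬G.Adj x z ∧ ¬G.Adj y z ∧
    (∃ p : G.Walk x y, ∀ w ∈ p.support, w ≠ z ∧ ¬G.Adj z w) ∧
    (∃ p : G.Walk x z, ∀ w ∈ p.support, w ≠ y ∧ ¬G.Adj y w) ∧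
    (∃ p : G.Walk y z, ∀ w ∈ p.support, w ≠ x ∧ ¬G.Adj x w)

/-- The distance between two vertices of the cycle of length five. -/
def cycDist (p q : Fin 5) : ℕ := (![0, 1, 2, 2, 1] : Fin 5 → ℕ) (q - p)

/-- The chain of `n` cycles of length five, where vertex `2` of each cycle is joined by an edge
to vertex `0` of the next one. -/
def cycleChain (n : ℕ) : SimpleGraph (Fin n × Fin 5) where
  Adj u v := (u.1 = v.1 ∧ (v.2 = u.2 + 1 ∨ u.2 = v.2 + 1)) ∨
    (u.1.val + 1 = v.1.val ∧ u.2 = 2 ∧ v.2 = 0) ∨ (v.1.val + 1 = u.1.val ∧ v.2 = 2 ∧ u.2 = 0)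
  symm := ⟨by
    rintro u v (⟨h, h'⟩ | h | h)
    · exact Or.inl ⟨h.symm, h'.symm⟩
    · exact Or.inr (Or.inr h)
    · exact Or.inr (Or.inl h)⟩
  loopless := ⟨by
    have h5 : ∀ p : Fin 5, ¬(p = p + 1 ∨ p = p + 1) := by decide
    rintro ⟨i, p⟩ (⟨-, h⟩ | ⟨h, -⟩ | ⟨h, -⟩)
    · exact h5 p h
    · simp at h
    · simp at h⟩

namespace cycleChain

variable {n : ℕ}

lemma adj_iff {u v : Fin n × Fin 5} : (cycleChain n).Adj u v ↔
    (u.1 = v.1 ∧ (v.2 = u.2 + 1 ∨ u.2 = v.2 + 1)) ∨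
    (u.1.val + 1 = v.1.val ∧ u.2 = 2 ∧ v.2 = 0) ∨
    (v.1.val + 1 = u.1.val ∧ v.2 = 2 ∧ u.2 = 0) := Iff.rfl

lemma adj_succ (i : Fin n) (p : Fin 5) : (cycleChain n).Adj (i, p) (i, p + 1) :=
  Or.inl ⟨rfl, Or.inl rfl⟩

lemma adj_bridge {i j : Fin n} (h : i.val + 1 = j.val) : (cycleChain n).Adj (i, 2) (j, 0) :=
  Or.inr (Or.inl ⟨h, rfl, rfl⟩)

lemma exists_walk_block (i : Fin n) (p q : Fin 5) :
    ∃ w : (cycleChain n).Walk (i, p) (i, q), w.length ≤ cycDist p q := by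
  have key : ∀ p q : Fin 5, (q = p ∧ cycDist p q = 0) ∨ (q = p + 1 ∧ cycDist p q = 1) ∨
      (q = p + 1 + 1 ∧ cycDist p q = 2) ∨ (p = q + 1 ∧ cycDist p q = 1) ∨
      (p = q + 1 + 1 ∧ cycDist p q = 2) := by decide
  rcases key p q with ⟨rfl, h⟩ | ⟨rfl, h⟩ | ⟨rfl, h⟩ | ⟨rfl, h⟩ | ⟨rfl, h⟩ <;> rw [h]
  · exact ⟨.nil, le_rfl⟩
  · exact ⟨.cons (adj_succ i p) .nil, le_rfl⟩
  · exact ⟨.cons (adj_succ i p) (.cons (adj_succ i (p + 1)) .nil), le_rfl⟩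
  · exact ⟨.cons (adj_succ i q).symm .nil, le_rfl⟩
  · exact ⟨.cons (adj_succ i (q + 1)).symm (.cons (adj_succ i q).symm .nil), le_rfl⟩

lemma dist_block_le (i : Fin n) (p q : Fin 5) :
    (cycleChain n).dist (i, p) (i, q) ≤ cycDist p q :=
  let ⟨w, hw⟩ := exists_walk_block i p q
  (dist_le w).trans hw

lemma connected (hn : 0 < n) : (cycleChain n).Connected := by
  have key : ∀ (m : ℕ) (hm : m < n) (p : Fin 5),
      (cycleChain n).Reachable (⟨0, hn⟩, 0) (⟨m, hm⟩, p) := by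
    intro m
    induction m with
    | zero => exact fun _ p => (exists_walk_block _ 0 p).choose.reachable
    | succ m ih =>
      intro hm p
      have h : (cycleChain n).Adj (⟨m, by omega⟩, 2) (⟨m + 1, hm⟩, 0) := adj_bridge rfl
      exact (ih _ 2).trans (h.reachable.trans (exists_walk_block _ 0 p).choose.reachable)
  have : Nonempty (Fin n × Fin 5) := ⟨(⟨0, hn⟩, 0)⟩
  exact ⟨fun u v => (key u.1 u.1.2 u.2).symm.trans (key v.1 v.1.2 v.2)⟩

/-- The distance in the chain of five-cycles, in closed form. -/
def chainDist (u v : Fin n × Fin 5) : ℕ :=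
  if u.1 = v.1 then cycDist u.2 v.2
  else if u.1 < v.1 then cycDist u.2 2 + (3 * (v.1 - u.1 : ℕ) - 2) + cycDist 0 v.2
  else cycDist v.2 2 + (3 * (u.1 - v.1 : ℕ) - 2) + cycDist 0 u.2

lemma chainDist_adj (u : Fin n × Fin 5) {v w : Fin n × Fin 5} (h : (cycleChain n).Adj v w) :
    chainDist u w ≤ chainDist u v + 1 := by
  have h1 : ∀ p q : Fin 5, cycDist p (q + 1) ≤ cycDist p q + 1 := by decide
  have h2 : ∀ p q : Fin 5, cycDist p q ≤ cycDist p (q + 1) + 1 := by decide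
  have h3 : ∀ p q : Fin 5, cycDist (q + 1) p ≤ cycDist q p + 1 := by decide
  have h4 : ∀ p q : Fin 5, cycDist q p ≤ cycDist (q + 1) p + 1 := by decide
  have c02 : cycDist 0 2 = 2 := by decide
  have c00 : cycDist 0 0 = 0 := by decide
  have c22 : cycDist 2 2 = 0 := by decide
  have sym : ∀ p q : Fin 5, cycDist p q = cycDist q p := by decide
  obtain ⟨i, p⟩ := u
  obtain ⟨j, q⟩ := v
  obtain ⟨l, s⟩ := w
  simp only [adj_iff] at h
  rcases h with ⟨h, rfl | rfl⟩ | ⟨h, rfl, rfl⟩ | ⟨h, rfl, rfl⟩ <;>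
    simp only [chainDist, Fin.ext_iff, Fin.lt_def] at h ⊢
  · have := h1 p q; have := h1 0 q; have := h3 2 q
    rw [h]; split_ifs <;> omega
  · have := h2 p s; have := h2 0 s; have := h4 2 s
    rw [h]; split_ifs <;> omega
  · have := sym 0 p
    split_ifs <;> omega
  · have := sym 0 p
    split_ifs <;> omega

lemma chainDist_le_dist (u v : Fin n × Fin 5) : chainDist u v ≤ (cycleChain n).dist u v := by
  have hn : 0 < n := u.1.pos
  obtain ⟨w, hw⟩ := (connected hn).exists_walk_length_eq_dist v u
  rw [dist_comm, ← hw]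
  have key : ∀ {a b : Fin n × Fin 5} (w : (cycleChain n).Walk a b),
      chainDist b a ≤ w.length := by
    intro a b w
    induction w with
    | nil => simp [chainDist, cycDist]
    | cons h w ih => exact (chainDist_adj _ h.symm).trans (Nat.succ_le_succ ih)
  exact key w

lemma support_of_fst_lt {u v : Fin n × Fin 5} (w : (cycleChain n).Walk u v) :
    (∀ m : Fin n, u.1 < m → m ≤ v.1 → (m, 0) ∈ w.support) ∧
    (∀ m : Fin n, u.1 ≤ m → m < v.1 → (m, 2) ∈ w.support) := by
  induction w with
  | nil => exact ⟨fun m h h' => absurd h h'.not_gt, fun m h h' => absurd h h'.not_ge⟩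
  | @cons u x v h w ih =>
    obtain ⟨i, p⟩ := u
    obtain ⟨j, q⟩ := x
    rw [Walk.support_cons]
    rcases adj_iff.1 h with ⟨h, -⟩ | ⟨h, rfl, rfl⟩ | ⟨h, rfl, rfl⟩ <;> simp only at h ih ⊢
    · subst h
      exact ⟨fun m a b => List.mem_cons_of_mem _ (ih.1 m a b),
        fun m a b => List.mem_cons_of_mem _ (ih.2 m a b)⟩
    · refine ⟨fun m a b => List.mem_cons_of_mem _ ?_, fun m a b => ?_⟩
      · rcases eq_or_ne m j with rfl | hm
        · exact w.start_mem_support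
        · exact ih.1 m (by omega) b
      · rcases eq_or_ne m i with rfl | hm
        · exact List.mem_cons_self
        · exact List.mem_cons_of_mem _ (ih.2 m (by omega) b)
    · exact ⟨fun m a b => List.mem_cons_of_mem _ (ih.1 m (by omega) b),
        fun m a b => List.mem_cons_of_mem _ (ih.2 m (by omega) b)⟩

/-- The blocks of `x`, `y`, `z` and the place of `y` in its block force every walk from `x` to `z`
through the closed neighbourhood of `y`. -/
def Separates (y x z : Fin n × Fin 5) : Prop :=
  (x.1 < y.1 ∧ y.1 ≤ z.1 ∧ (y.2 = 0 ∨ y.2 = 1 ∨ y.2 = 4)) ∨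
  (x.1 ≤ y.1 ∧ y.1 < z.1 ∧ (y.2 = 1 ∨ y.2 = 2 ∨ y.2 = 3))

lemma Separates.exists_mem_support {x y z : Fin n × Fin 5} (h : Separates y x z)
    (w : (cycleChain n).Walk x z) : ∃ v ∈ w.support, v = y ∨ (cycleChain n).Adj y v := by
  obtain ⟨j, q⟩ := y
  rcases h with ⟨h, h', hq⟩ | ⟨h, h', hq⟩
  · refine ⟨_, (support_of_fst_lt w).1 j h h', ?_⟩
    rcases hq with hq | hq | hq <;> simp only at hq <;> subst hq <;> simp [adj_iff]
  · refine ⟨_, (support_of_fst_lt w).2 j h h', ?_⟩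
    rcases hq with hq | hq | hq <;> simp only at hq <;> subst hq <;> simp [adj_iff]

lemma not_separates {x y z : Fin n × Fin 5}
    (w : (cycleChain n).Walk x z) (h : ∀ v ∈ w.support, v ≠ y ∧ ¬(cycleChain n).Adj y v) :
    ¬Separates y x z ∧ ¬Separates y z x := by
  refine ⟨fun hs => ?_, fun hs => ?_⟩
  · obtain ⟨v, hv, h'⟩ := hs.exists_mem_support w
    exact h'.elim (h v hv).1 (h v hv).2
  · obtain ⟨v, hv, h'⟩ := hs.exists_mem_support w.reverse
    rw [Walk.support_reverse, List.mem_reverse] at hv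
    exact h'.elim (h v hv).1 (h v hv).2

lemma isATFree : IsATFree (cycleChain n) := by
  rintro ⟨⟨i, p⟩, ⟨j, q⟩, ⟨l, s⟩, hxy, hxz, hyz, axy, axz, ayz, ⟨w₁, h₁⟩, ⟨w₂, h₂⟩, ⟨w₃, h₃⟩⟩
  obtain ⟨a₁, b₁⟩ := not_separates w₁ h₁
  obtain ⟨a₂, b₂⟩ := not_separates w₂ h₂
  obtain ⟨a₃, b₃⟩ := not_separates w₃ h₃
  have opp : ∀ p q : Fin 5, p ≠ q → ¬(q = p + 1 ∨ p = q + 1) → q = p + 2 ∨ p = q + 2 := by decide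
  have key : ∀ {i j : Fin n} {p q : Fin 5}, (i, p) ≠ (j, q) → ¬(cycleChain n).Adj (i, p) (j, q) →
      i = j → q = p + 2 ∨ p = q + 2 := by
    intro i j p q h₁ h₂ h
    subst h
    exact opp p q (fun h => h₁ (h ▸ rfl)) (fun h => h₂ (Or.inl ⟨rfl, h⟩))
  have exy := key hxy axy
  have exz := key hxz axz
  have eyz := key hyz ayz
  have triple : ∀ p q s : Fin 5, (q = p + 2 ∨ p = q + 2) → (s = p + 2 ∨ p = s + 2) →
      (s = q + 2 ∨ q = s + 2) → False := by decide
  have left : ∀ p q : Fin 5, (q = p + 2 ∨ p = q + 2) →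
      (p = 0 ∨ p = 1 ∨ p = 4) ∨ (q = 0 ∨ q = 1 ∨ q = 4) := by decide
  have right : ∀ p q : Fin 5, (q = p + 2 ∨ p = q + 2) →
      (p = 1 ∨ p = 2 ∨ p = 3) ∨ (q = 1 ∨ q = 2 ∨ q = 3) := by decide
  have cover : ∀ p : Fin 5, (p = 0 ∨ p = 1 ∨ p = 4) ∨ (p = 1 ∨ p = 2 ∨ p = 3) := by decide
  simp only [Separates] at a₁ b₁ a₂ b₂ a₃ b₃
  clear hxy hxz hyz axy axz ayz key opp h₁ h₂ h₃ w₁ w₂ w₃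
  have triple := triple p q s
  have l₁ := left p q
  have l₂ := left p s
  have l₃ := left q s
  have r₁ := right p q
  have r₂ := right p s
  have r₃ := right q s
  have cp := cover p
  have cq := cover q
  have cs := cover s
  clear left right cover
  generalize (q = p + 2 ∨ p = q + 2) = X at *
  generalize (s = p + 2 ∨ p = s + 2) = Y at *
  generalize (s = q + 2 ∨ q = s + 2) = Z at *
  generalize (p = 0 ∨ p = 1 ∨ p = 4) = P at *
  generalize (q = 0 ∨ q = 1 ∨ q = 4) = Q at *
  generalize (s = 0 ∨ s = 1 ∨ s = 4) = S at *
  generalize (p = 1 ∨ p = 2 ∨ p = 3) = P' at *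
  generalize (q = 1 ∨ q = 2 ∨ q = 3) = Q' at *
  generalize (s = 1 ∨ s = 2 ∨ s = 3) = S' at *
  grind

/-- A walk that leaves the initial segment of blocks ending with block `m` does so along the edge
joining this block to the next one. -/
lemma bridge_mem_edges {a b : Fin n × Fin 5} (w : (cycleChain n).Walk a b) {m m' : Fin n}
    (hm : m.val + 1 = m'.val) (ha : a.1 ≤ m) (hb : m < b.1) : s((m, 2), (m', 0)) ∈ w.edges := by
  induction w with
  | nil => exact absurd ha hb.not_ge
  | @cons a c b h w ih =>
    rw [Walk.edges_cons]
    by_cases hc : c.1 ≤ m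
    · exact List.mem_cons_of_mem _ (ih hc hb)
    · obtain ⟨i, p⟩ := a
      obtain ⟨j, q⟩ := c
      rcases adj_iff.1 h with ⟨h, -⟩ | ⟨h, rfl, rfl⟩ | ⟨h, rfl, rfl⟩ <;> simp only at h ha hc
      · exact absurd (h ▸ ha) hc
      · obtain rfl : i = m := by omega
        obtain rfl : j = m' := by omega
        exact List.mem_cons_self
      · omega

/-- Every edge of a cycle lies inside one block. -/
lemma fst_eq_of_mem_cycle {u : Fin n × Fin 5} {c : (cycleChain n).Walk u u} (hc : c.IsCycle)
    {x y : Fin n × Fin 5} (h : s(x, y) ∈ c.edges) : x.1 = y.1 := by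
  have bridge : ∀ {x y : Fin n × Fin 5}, s(x, y) ∈ c.edges → ¬x.1.val + 1 = y.1.val := by
    rintro ⟨i, p⟩ ⟨j, q⟩ h hlt
    have hadj : (cycleChain n).Adj (i, p) (j, q) := c.adj_of_mem_edges h
    have hpq : p = 2 ∧ q = 0 := by
      rcases adj_iff.1 hadj with ⟨h', -⟩ | ⟨-, h'⟩ | ⟨h', -⟩
      · simp only at h' hlt; omega
      · exact h'
      · simp only at h' hlt; omega
    obtain ⟨rfl, rfl⟩ := hpq
    refine (isBridge_iff_forall_cycle_notMem hadj).1 ?_ c hc h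
    exact isBridge_iff_forall_walk_mem_edges.2 fun w =>
      bridge_mem_edges w hlt le_rfl (Fin.lt_def.2 (by simp only at hlt ⊢; omega))
  rcases adj_iff.1 (c.adj_of_mem_edges h) with ⟨h', -⟩ | ⟨h', -⟩ | ⟨h', -⟩
  · exact h'
  · exact (bridge h h').elim
  · exact (bridge (Sym2.eq_swap ▸ h) h').elim

lemma fst_eq_of_mem_edges {u v : Fin n × Fin 5} (w : (cycleChain n).Walk u v)
    (hw : ∀ x y, s(x, y) ∈ w.edges → x.1 = y.1) {x y : Fin n × Fin 5} (h : s(x, y) ∈ w.edges) :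
    x.1 = u.1 := by
  induction w with
  | nil => simp at h
  | @cons a c b hac w ih =>
    have hac' : a.1 = c.1 := hw a c (by simp)
    rw [Walk.edges_cons, List.mem_cons] at h
    rcases h with h | h
    · rcases Sym2.eq_iff.1 h with ⟨rfl, -⟩ | ⟨rfl, -⟩
      · rfl
      · exact hac'.symm
    · rw [hac']
      exact ih (fun x y hxy => hw x y (by simp [hxy])) h

/-- A cycle passing through a vertex contains both edges of the block at this vertex. -/
lemma mem_edges_of_mem_support {u : Fin n × Fin 5} {c : (cycleChain n).Walk u u} (hc : c.IsCycle)
    {i : Fin n} {p : Fin 5} (h : (i, p) ∈ c.support) : s((i, p), (i, p + 1)) ∈ c.edges := by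
  have hcard := hc.ncard_neighborSet_toSubgraph_eq_two h
  have hsub : c.toSubgraph.neighborSet (i, p) ⊆ {(i, p + 1), (i, p - 1)} := by
    rintro ⟨j, q⟩ hq
    have hq : s((i, p), (j, q)) ∈ c.edges := by
      simpa [Walk.adj_toSubgraph_iff_mem_edges] using hq
    obtain rfl : i = j := fst_eq_of_mem_cycle hc hq
    have hs : q = p + 1 ∨ q = p - 1 := by
      rcases adj_iff.1 (c.adj_of_mem_edges hq) with ⟨-, h | h⟩ | ⟨h, -⟩ | ⟨h, -⟩
      · exact Or.inl h
      · exact Or.inr (eq_sub_of_add_eq h.symm)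
      · simp at h
      · simp at h
    rcases hs with rfl | rfl <;> simp
  have heq := Set.eq_of_subset_of_ncard_le hsub
    ((Set.ncard_insert_le _ _).trans (by rw [Set.ncard_singleton, hcard]))
  have hmem : (i, p + 1) ∈ c.toSubgraph.neighborSet (i, p) := heq ▸ Set.mem_insert _ _
  simpa [Walk.adj_toSubgraph_iff_mem_edges] using hmem

lemma edges_of_isCycle {u : Fin n × Fin 5} {c : (cycleChain n).Walk u u} (hc : c.IsCycle) :
    {e | e ∈ c.edges} = Set.range fun p : Fin 5 => s((u.1, p), (u.1, p + 1)) := by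
  have hstep : ∀ p, (u.1, p) ∈ c.support → (u.1, p + 1) ∈ c.support := fun p h =>
    c.snd_mem_support_of_mem_edges (mem_edges_of_mem_support hc h)
  have hall : ∀ p, (u.1, p) ∈ c.support := by
    have h₀ : (u.1, u.2) ∈ c.support := c.start_mem_support
    have h₁ := hstep _ h₀
    have h₂ := hstep _ h₁
    have h₃ := hstep _ h₂
    have h₄ := hstep _ h₃
    intro p
    have : ∀ p q : Fin 5, p = q ∨ p = q + 1 ∨ p = q + 1 + 1 ∨ p = q + 1 + 1 + 1 ∨
        p = q + 1 + 1 + 1 + 1 := by decide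
    rcases this p u.2 with h | h | h | h | h <;> rw [h] <;> assumption
  refine Set.Subset.antisymm ?_ ?_
  · rintro ⟨⟨i, p⟩, ⟨j, q⟩⟩ h
    have h : s((i, p), (j, q)) ∈ c.edges := h
    obtain rfl : i = j := fst_eq_of_mem_cycle hc h
    obtain rfl : i = u.1 :=
      fst_eq_of_mem_edges c (fun x y hxy => fst_eq_of_mem_cycle hc hxy) h
    rcases adj_iff.1 (c.adj_of_mem_edges h) with ⟨-, h | h⟩ | ⟨h, -⟩ | ⟨h, -⟩
    · exact ⟨p, by simp only at h; rw [h]⟩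
    · exact ⟨q, by simp only at h; rw [h]; exact Sym2.eq_swap⟩
    · simp at h
    · simp at h
  · rintro _ ⟨p, rfl⟩
    exact mem_edges_of_mem_support hc (hall p)

lemma isCactus (hn : 0 < n) : IsCactus (cycleChain n) := by
  refine ⟨connected hn, fun u v c₁ c₂ h₁ h₂ e he₁ he₂ => ?_⟩
  have h : u.1 = v.1 := by
    induction e with
    | _ x y =>
      exact (fst_eq_of_mem_edges c₁ (fun _ _ => fst_eq_of_mem_cycle h₁) he₁).symm.trans
        (fst_eq_of_mem_edges c₂ (fun _ _ => fst_eq_of_mem_cycle h₂) he₂)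
  rw [edges_of_isCycle h₁, edges_of_isCycle h₂, h]

lemma ncard_le_of_isMultipacking {M : Set (Fin n × Fin 5)}
    (hM : IsMultipacking (cycleChain n) M) : M.ncard ≤ n := by
  have hinj : Set.InjOn Prod.fst M := by
    rintro ⟨i, p⟩ hp ⟨j, q⟩ hq h
    obtain rfl : i = j := h
    have common : ∀ p q : Fin 5, ∃ s, cycDist p s ≤ 1 ∧ cycDist q s ≤ 1 := by decide
    obtain ⟨s, hps, hqs⟩ := common p q
    exact (Set.ncard_le_one (Set.toFinite _)).1 (hM (i, s) 1 le_rfl)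
      _ ⟨hp, (dist_block_le i p s).trans hps⟩ _ ⟨hq, (dist_block_le i q s).trans hqs⟩
  have := Set.ncard_le_ncard_of_injOn (t := Set.univ) Prod.fst (fun _ _ => Set.mem_univ _) hinj
  simpa using this

/-- A set on which a map to the natural numbers is injective has at most `d` elements if the
images of its elements pairwise differ by less than `d`. -/
lemma ncard_le_of_forall_lt {α : Type*} [Finite α] (S : Set α) (g : α → ℕ)
    (hg : Set.InjOn g S) (d : ℕ) (h : ∀ x ∈ S, ∀ y ∈ S, g y < g x + d) : S.ncard ≤ d := by
  rcases S.eq_empty_or_nonempty with rfl | hne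
  · simp
  obtain ⟨x, hx, hmin⟩ := S.exists_min_image g S.toFinite hne
  have := Set.ncard_le_ncard_of_injOn (t := Set.Ico (g x) (g x + d)) g
    (fun y hy => ⟨hmin y hy, h x hx y hy⟩) hg
  simpa [Set.ncard_eq_toFinset_card'] using this

lemma isMultipacking_snd_eq_one : IsMultipacking (cycleChain n) {u | u.2 = 1} := by
  intro v r hr
  refine ncard_le_of_forall_lt _ (fun u => u.1.val) ?_ r ?_
  · rintro ⟨i, p⟩ ⟨hp, -⟩ ⟨j, q⟩ ⟨hq, -⟩ h
    exact Prod.ext (Fin.ext h) (Eq.trans hp (Eq.symm hq))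
  · rintro ⟨i, p⟩ ⟨rfl, hx⟩ ⟨j, q⟩ ⟨rfl, hy⟩
    have hn : 0 < n := i.pos
    have h : (cycleChain n).dist (i, 1) (j, 1) ≤ r + r :=
      (connected hn).dist_triangle.trans (add_le_add hx (dist_comm.trans_le hy))
    replace h := (chainDist_le_dist _ _).trans h
    have c12 : cycDist 1 2 = 1 := by decide
    have c01 : cycDist 0 1 = 1 := by decide
    simp only [chainDist, Fin.ext_iff, Fin.lt_def, c12, c01] at h ⊢
    split_ifs at h <;> omega

lemma multipackingNumber_eq : multipackingNumber (cycleChain n) = n := by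
  refine IsGreatest.csSup_eq ⟨⟨_, isMultipacking_snd_eq_one, ?_⟩, ?_⟩
  · have : {u : Fin n × Fin 5 | u.2 = 1} = (fun i => (i, 1)) '' Set.univ := by
      ext ⟨i, p⟩
      simp [eq_comm]
    rw [this, Set.ncard_image_of_injective _ (Prod.mk_left_injective 1)]
    simp
  · rintro _ ⟨M, hM, rfl⟩
    exact ncard_le_of_isMultipacking hM

/-- The rank of a vertex other than the vertices `1` of the blocks when these are listed along the
chain. -/
def rank (u : Fin n × Fin 5) : ℕ := 4 * u.1 + (![0, 0, 3, 2, 1] : Fin 5 → ℕ) u.2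

lemma rank_injOn : Set.InjOn (rank (n := n)) {u | u.2 ≠ 1} := by
  have lt : ∀ p : Fin 5, (![0, 0, 3, 2, 1] : Fin 5 → ℕ) p < 4 := by decide
  have inj : ∀ p q : Fin 5, p ≠ 1 → q ≠ 1 →
      (![0, 0, 3, 2, 1] : Fin 5 → ℕ) p = (![0, 0, 3, 2, 1] : Fin 5 → ℕ) q → p = q := by decide
  rintro ⟨i, p⟩ hp ⟨j, q⟩ hq h
  simp only [rank] at h
  have := lt p
  have := lt q
  exact Prod.ext (Fin.ext (by simp only; omega)) (inj p q hp hq (by omega))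

lemma rank_lt {v x y : Fin n × Fin 5} (hx : x.2 ≠ 1) (hy : y.2 ≠ 1) {r : ℕ} (hr : 1 ≤ r)
    (hv : v.2 = 1 → 2 ≤ r) (hvx : chainDist v x ≤ r) (hvy : chainDist v y ≤ r) :
    rank y < rank x + 3 * r := by
  have bounds : ∀ q p : Fin 5, p ≠ 1 →
      let k := (![0, 0, 3, 2, 1] : Fin 5 → ℕ) p
      (k ≤ 3 ∧ k ≤ cycDist 0 p + cycDist 0 p / 2 ∧ 3 ≤ k + cycDist p 2 + cycDist p 2 / 2) ∧
      (cycDist q 2 = 0 → 3 ≤ k + cycDist q p + cycDist q p / 2) ∧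
      (cycDist 0 q = 0 → k ≤ cycDist q p + cycDist q p / 2) := by decide
  have near : ∀ q p s : Fin 5, q ≠ 1 → p ≠ 1 → s ≠ 1 → cycDist q p ≤ 1 → cycDist q s ≤ 1 →
      (![0, 0, 3, 2, 1] : Fin 5 → ℕ) s < (![0, 0, 3, 2, 1] : Fin 5 → ℕ) p + 3 := by decide
  have sum : ∀ q : Fin 5, 2 ≤ cycDist q 2 + cycDist 0 q := by decide
  obtain ⟨j, q⟩ := v
  obtain ⟨i, p⟩ := x
  obtain ⟨l, s⟩ := y
  obtain ⟨⟨b₁, b₂, b₃⟩, b₄, b₅⟩ := bounds q p hx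
  obtain ⟨⟨c₁, c₂, c₃⟩, c₄, c₅⟩ := bounds q s hy
  have near := near q p s
  have sum := sum q
  simp only [chainDist, Fin.ext_iff, Fin.lt_def, rank] at hvx hvy ⊢
  have near : r = 1 → cycDist q p ≤ 1 → cycDist q s ≤ 1 →
      (![0, 0, 3, 2, 1] : Fin 5 → ℕ) s < (![0, 0, 3, 2, 1] : Fin 5 → ℕ) p + 3 := fun h =>
    near (fun hq => by have := hv hq; omega) hx hy
  clear bounds hv hx hy
  split_ifs at hvx hvy <;> omega

lemma ncard_ball_le (v : Fin n × Fin 5) {r : ℕ} (hr : 1 ≤ r) :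
    {u : Fin n × Fin 5 | u.2 ≠ 1 ∧ (cycleChain n).dist u v ≤ r}.ncard ≤ 3 * r := by
  have hle : ∀ {u}, (cycleChain n).dist u v ≤ r → chainDist v u ≤ r := fun h =>
    (chainDist_le_dist _ _).trans (dist_comm.trans_le h)
  by_cases hv : v.2 = 1 → 2 ≤ r
  · exact ncard_le_of_forall_lt _ rank (rank_injOn.mono fun u hu => hu.1) _
      fun x hx y hy => rank_lt hx.1 hy.1 hr hv (hle hx.2) (hle hy.2)
  · obtain ⟨j, q⟩ := v
    obtain ⟨rfl, hr'⟩ : q = 1 ∧ ¬2 ≤ r := Classical.not_imp.1 hv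
    obtain rfl : r = 1 := by omega
    have hsub : {u : Fin n × Fin 5 | u.2 ≠ 1 ∧ (cycleChain n).dist u (j, 1) ≤ 1} ⊆
        {(j, 0), (j, 2)} := by
      rintro ⟨i, p⟩ ⟨hp, h⟩
      have hc : ∀ p : Fin 5, p ≠ 1 → cycDist 1 p ≤ 1 → p = 0 ∨ p = 2 := by decide
      have c12 : cycDist 1 2 = 1 := by decide
      have c01 : cycDist 0 1 = 1 := by decide
      replace h := hle h
      simp only [chainDist, Fin.ext_iff, Fin.lt_def, c12, c01] at h
      split_ifs at h with h₁
      · obtain rfl := Fin.ext h₁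
        rcases hc p hp h with rfl | rfl <;> simp
      · omega
      · omega
    calc _ ≤ _ := Set.ncard_le_ncard hsub
      _ ≤ _ := (Set.ncard_insert_le _ _).trans (by rw [Set.ncard_singleton]; norm_num)

lemma four_mul_le_cost {f : Fin n × Fin 5 → ℕ} (hf : IsDominatingBroadcast (cycleChain n) f) :
    4 * n ≤ 3 * ∑ v, f v := by
  classical
  let W : Finset (Fin n × Fin 5) := Finset.univ.filter fun u => u.2 ≠ 1
  let B (v : Fin n × Fin 5) : Finset (Fin n × Fin 5) :=
    Finset.univ.filter fun u => 0 < f v ∧ u.2 ≠ 1 ∧ (cycleChain n).dist u v ≤ f v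
  have hW : W.card = 4 * n := by
    have : W = Finset.univ ×ˢ Finset.univ.filter fun p : Fin 5 => p ≠ 1 := by
      ext; simp [W]
    rw [this, Finset.card_product, Finset.card_fin, mul_comm]
    rfl
  have hB : ∀ v, (B v).card ≤ 3 * f v := by
    intro v
    rcases Nat.eq_zero_or_pos (f v) with h | h
    · simp [B, h]
    · have := ncard_ball_le v h
      rw [Set.ncard_eq_toFinset_card'] at this
      simpa [B, h] using this
  calc 4 * n = W.card := hW.symm
    _ ≤ (Finset.univ.biUnion B).card := Finset.card_le_card fun u hu => by
        obtain ⟨v, hv, hd⟩ := hf.2 u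
        simp only [W, B, Finset.mem_filter, Finset.mem_biUnion, Finset.mem_univ, true_and] at hu ⊢
        exact ⟨v, hv, hu, hd⟩
    _ ≤ ∑ v, (B v).card := Finset.card_biUnion_le
    _ ≤ ∑ v, 3 * f v := Finset.sum_le_sum fun v _ => hB v
    _ = 3 * ∑ v, f v := (Finset.mul_sum _ _ _).symm

lemma dist_le_gDiam (u v : Fin n × Fin 5) : (cycleChain n).dist u v ≤ gDiam (cycleChain n) :=
  le_csSup (Set.finite_range _).bddAbove ⟨(u, v), rfl⟩

lemma dist_succ_le {i j : Fin n} (h : i.val + 1 = j.val) (p q : Fin 5) :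
    (cycleChain n).dist (i, p) (j, q) ≤ cycDist p 2 + 1 + cycDist 0 q := by
  obtain ⟨w₁, h₁⟩ := exists_walk_block i p 2
  obtain ⟨w₂, h₂⟩ := exists_walk_block j 0 q
  have := dist_le (w₁.append (.cons (adj_bridge h) w₂))
  rw [Walk.length_append, Walk.length_cons] at this
  omega

/-- The middle vertex of the `t`-th group of three consecutive blocks. -/
def center {k : ℕ} (t : Fin k) : Fin (3 * k) × Fin 5 := (⟨3 * t + 1, by omega⟩, 1)

lemma exists_dist_center_le {k : ℕ} (u : Fin (3 * k) × Fin 5) :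
    ∃ t : Fin k, (cycleChain (3 * k)).dist u (center t) ≤ 4 := by
  have hc : ∀ p q : Fin 5, cycDist p q ≤ 2 := by decide
  have c12 : cycDist 1 2 = 1 := by decide
  have c01 : cycDist 0 1 = 1 := by decide
  obtain ⟨⟨i, hi⟩, p⟩ := u
  refine ⟨⟨i / 3, by omega⟩, ?_⟩
  obtain h | h | h : i = 3 * (i / 3) ∨ i = 3 * (i / 3) + 1 ∨ i = 3 * (i / 3) + 2 := by omega
  · refine (dist_succ_le ?_ _ _).trans ?_
    · simp only; omega
    · have := hc p 2; omega
  · simp only [center, ← h]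
    exact (dist_block_le _ _ _).trans ((hc _ _).trans (by norm_num))
  · rw [dist_comm]
    refine (dist_succ_le ?_ _ _).trans ?_
    · simp only; omega
    · have := hc 0 p; omega

lemma exists_isDominatingBroadcast {k : ℕ} (hk : 0 < k) :
    ∃ f, IsDominatingBroadcast (cycleChain (3 * k)) f ∧ ∑ v, f v ≤ 4 * k := by
  classical
  refine ⟨fun v => if v ∈ Finset.univ.image (center (k := k)) then 4 else 0, ⟨?_, ?_⟩, ?_⟩
  · have h : 4 ≤ gDiam (cycleChain (3 * k)) := by
      have h := (chainDist_le_dist _ _).trans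
        (dist_le_gDiam (n := 3 * k) (⟨0, by omega⟩, 0) (⟨2, by omega⟩, 0))
      have c02 : cycDist 0 2 = 2 := by decide
      simp [chainDist, c02] at h
      omega
    intro v
    dsimp only
    split_ifs <;> omega
  · intro u
    obtain ⟨t, ht⟩ := exists_dist_center_le u
    exact ⟨center t, by simp, by simpa using ht⟩
  · rw [← Finset.sum_filter, Finset.sum_const, smul_eq_mul, mul_comm,
      Finset.filter_mem_eq_inter, Finset.univ_inter]
    exact Nat.mul_le_mul_left 4 (Finset.card_image_le.trans_eq (Finset.card_fin k))

lemma broadcastDominationNumber_eq {k : ℕ} (hk : 0 < k) :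
    broadcastDominationNumber (cycleChain (3 * k)) = 4 * k := by
  have lower : ∀ f, IsDominatingBroadcast (cycleChain (3 * k)) f → 4 * k ≤ ∑ v, f v :=
    fun f hf => by have := four_mul_le_cost hf; omega
  refine IsLeast.csInf_eq ⟨?_, ?_⟩
  · obtain ⟨f, hf, hle⟩ := exists_isDominatingBroadcast hk
    exact ⟨f, hf, (finsum_eq_sum_of_fintype f).trans (hle.antisymm (lower f hf))⟩
  · rintro _ ⟨f, hf, rfl⟩
    rw [finsum_eq_sum_of_fintype]
    exact lower f hf

end cycleChain

/-- For every positive integer k, there is a finite graph G_k that is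
both a cactus and AT-free, with MP(G_k) = 3k and γ_b(G_k) = 4k. -/
theorem stmt9 (k : ℕ) (hk : 0 < k) :
    ∃ (V : Type) (G : SimpleGraph V), Finite V ∧ IsCactus G ∧ IsATFree G ∧
      multipackingNumber G = 3 * k ∧ broadcastDominationNumber G = 4 * k := by
  exact ⟨Fin (3 * k) × Fin 5, cycleChain (3 * k), inferInstance, cycleChain.isCactus (by omega),
    cycleChain.isATFree, cycleChain.multipackingNumber_eq,
    cycleChain.broadcastDominationNumber_eq hk⟩
end

section
/- For every natural number N, there exists a finite cactus graph G such that γ_b(G) − MP(G) ≥ N; that is, the difference between the broadcast domination number and the multipacking number can be arbitrarily large for cactus graphs. -/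
open SimpleGraph

variable {V : Type*}

section Lemmas

/-- If the edges of `G` separated by a labelling `χ` are exactly `e` and `e'`, then every cycle
through `e` passes through `e'`. -/
lemma SimpleGraph.Walk.IsCycle.mem_edges_of_cut {G : SimpleGraph V} {e e' : Sym2 V}
    (hne : e ≠ e') (χ : V → Prop)
    (hχ : ∀ x y, G.Adj x y → (¬(χ x ↔ χ y) ↔ s(x, y) = e ∨ s(x, y) = e'))
    {u : V} {c : G.Walk u u} (hc : c.IsCycle) (he : e ∈ c.edges) : e' ∈ c.edges := by
  classical
  have parity : ∀ {x y : V} (p : G.Walk x y),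
      Even (p.edges.count e + p.edges.count e') ↔ (χ x ↔ χ y) := by
    intro x y p
    induction p with
    | nil => simp
    | @cons x y z h p ih =>
      have hxy := hχ x y h
      rw [Walk.edges_cons, List.count_cons, List.count_cons]
      by_cases h1 : s(x, y) = e
      · have h2 : s(x, y) ≠ e' := fun h2 => hne (h1.symm.trans h2)
        simp only [h1, beq_self_eq_true, if_true, beq_iff_eq, hne, if_false]
        have : ¬(χ x ↔ χ y) := hxy.2 (Or.inl h1)
        rw [show p.edges.count e + 1 + (p.edges.count e' + 0)
          = p.edges.count e + p.edges.count e' + 1 by ring, Nat.even_add_one, ih]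
        tauto
      · by_cases h2 : s(x, y) = e'
        · simp only [h2, beq_self_eq_true, if_true, beq_iff_eq, hne.symm, if_false]
          have : ¬(χ x ↔ χ y) := hxy.2 (Or.inr h2)
          rw [show p.edges.count e + 0 + (p.edges.count e' + 1)
            = p.edges.count e + p.edges.count e' + 1 by ring, Nat.even_add_one, ih]
          tauto
        · simp only [beq_iff_eq, h1, h2, if_false, add_zero]
          rw [ih]
          tauto
  have h1 := (parity c).2 Iff.rfl
  have h2 : c.edges.count e = 1 := List.count_eq_one_of_mem hc.isTrail.edges_nodup he
  by_contra h3
  rw [h2, List.count_eq_zero_of_not_mem h3] at h1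
  simp at h1

lemma SimpleGraph.Walk.IsCycle.mem_edges_iff_of_cut {G : SimpleGraph V} {e e' : Sym2 V}
    (hne : e ≠ e') (χ : V → Prop)
    (hχ : ∀ x y, G.Adj x y → (¬(χ x ↔ χ y) ↔ s(x, y) = e ∨ s(x, y) = e'))
    {u : V} {c : G.Walk u u} (hc : c.IsCycle) : e ∈ c.edges ↔ e' ∈ c.edges :=
  ⟨hc.mem_edges_of_cut hne χ hχ,
    hc.mem_edges_of_cut hne.symm χ fun x y h => (hχ x y h).trans or_comm⟩

/-- A walk starting in `S` stays in `S` if its edges cannot leave `S`. -/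
lemma SimpleGraph.Walk.edges_subset_of_closed {G : SimpleGraph V} {E B : Set (Sym2 V)} {S : Set V}
    (hS : ∀ x y, x ∈ S → s(x, y) ∈ E → y ∈ S ∧ s(x, y) ∈ B) {u v : V} (p : G.Walk u v)
    (hu : u ∈ S) (hp : ∀ e ∈ p.edges, e ∈ E) : ∀ e ∈ p.edges, e ∈ B := by
  induction p with
  | nil => simp
  | cons h p ih =>
    simp only [Walk.edges_cons, List.mem_cons, forall_eq_or_imp] at hp ⊢
    have := hS _ _ hu hp.1
    exact ⟨this.2, ih this.1 hp.2⟩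

/-- In a cycle through the edges `s(x, y)` and `s(x, z)`, no further edge contains `x`. -/
lemma SimpleGraph.Walk.IsCycle.eq_or_eq_of_mem_edges {G : SimpleGraph V} {u : V} {c : G.Walk u u}
    (hc : c.IsCycle) {x y z t : V} (hyz : y ≠ z) (hy : s(x, y) ∈ c.edges)
    (hz : s(x, z) ∈ c.edges) (ht : s(x, t) ∈ c.edges) : t = y ∨ t = z := by
  have h2 := hc.ncard_neighborSet_toSubgraph_eq_two (c.fst_mem_support_of_mem_edges hy)
  have hfin : (c.toSubgraph.neighborSet x).Finite := Set.finite_of_ncard_ne_zero (by omega)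
  have hsub : ({y, z} : Set V) ⊆ c.toSubgraph.neighborSet x := by
    rintro w (rfl | rfl)
    · exact Walk.adj_toSubgraph_iff_mem_edges.2 hy
    · exact Walk.adj_toSubgraph_iff_mem_edges.2 hz
  have heq := Set.eq_of_subset_of_ncard_le hsub (by rw [h2, Set.ncard_pair hyz]) hfin
  have : t ∈ ({y, z} : Set V) := heq ▸ Walk.adj_toSubgraph_iff_mem_edges.2 ht
  simpa using this

/-- A cycle containing the four edges of a 4-cycle has no other edges. -/
lemma SimpleGraph.Walk.IsCycle.edges_eq_of_square {G : SimpleGraph V} {u : V} {c : G.Walk u u}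
    (hc : c.IsCycle) {a b d a' : V} (hbd : b ≠ d) (haa : a ≠ a') (hab : s(a, b) ∈ c.edges)
    (had : s(a, d) ∈ c.edges) (hba : s(b, a') ∈ c.edges) (hda : s(d, a') ∈ c.edges) :
    {e | e ∈ c.edges} = {s(a, b), s(a, d), s(b, a'), s(d, a')} := by
  classical
  apply Set.Subset.antisymm
  · have hmem := c.fst_mem_support_of_mem_edges hab
    have key := Walk.edges_subset_of_closed (E := {e | e ∈ c.edges})
      (B := {s(a, b), s(a, d), s(b, a'), s(d, a')}) (S := {a, b, d, a'}) (u := a) (v := a)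
      (by
        rintro x y hx hxy
        simp only [Set.mem_insert_iff, Set.mem_singleton_iff] at hx
        rcases hx with rfl | rfl | rfl | rfl
        · rcases hc.eq_or_eq_of_mem_edges hbd hab had hxy with rfl | rfl <;> simp
        · rcases hc.eq_or_eq_of_mem_edges haa (Sym2.eq_swap ▸ hab) hba hxy with rfl | rfl <;>
            simp [Sym2.eq_swap]
        · rcases hc.eq_or_eq_of_mem_edges haa (Sym2.eq_swap ▸ had) hda hxy with rfl | rfl <;>
            simp [Sym2.eq_swap]
        · rcases hc.eq_or_eq_of_mem_edges hbd (Sym2.eq_swap ▸ hba) (Sym2.eq_swap ▸ hda) hxy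
            with rfl | rfl <;> simp [Sym2.eq_swap])
      (c.rotate a hmem) (by simp) (fun e he => (c.rotate_edges a hmem).mem_iff.1 he)
    exact fun e he => key e ((c.rotate_edges a hmem).mem_iff.2 he)
  · rintro e (rfl | rfl | rfl | rfl) <;> assumption

/-- The level of vertex `k` in a chain of 4-cycles glued at opposite vertices: the 4-cycle number
`i` consists of `3i` (level `2i`), `3i + 1` and `3i + 2` (level `2i + 1`) and `3i + 3`
(level `2i + 2`). -/
def chainLevel (k : ℕ) : ℕ := (2 * k + 1) / 3

/-- A chain of `n` 4-cycles, consecutive ones being glued at opposite vertices. -/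
def squareChain (n : ℕ) : SimpleGraph (Fin (3 * n + 1)) where
  Adj u v := chainLevel v = chainLevel u + 1 ∨ chainLevel u = chainLevel v + 1
  symm := ⟨fun _ _ h => h.symm⟩
  loopless := ⟨fun _ h => by omega⟩

lemma squareChain_adj {n : ℕ} {u v : Fin (3 * n + 1)} : (squareChain n).Adj u v ↔
    chainLevel v = chainLevel u + 1 ∨ chainLevel u = chainLevel v + 1 := Iff.rfl

lemma chainLevel_eq (k : ℕ) : chainLevel k = 2 * (k / 3) + (k % 3 + 1) / 2 := by
  rw [chainLevel]; omega

lemma squareChain_connected (n : ℕ) : (squareChain n).Connected := by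
  have h : ∀ k (hk : k < 3 * n + 1), (squareChain n).Reachable ⟨k, hk⟩ ⟨0, by omega⟩ := by
    intro k
    induction k using Nat.strong_induction_on with
    | _ k ih =>
      intro hk
      by_cases h0 : k = 0
      · subst h0; rfl
      · by_cases h2 : k % 3 = 2
        · refine Reachable.trans (Adj.reachable ?_) (ih (k - 2) (by omega) (by omega))
          simp only [squareChain_adj, chainLevel]; omega
        · refine Reachable.trans (Adj.reachable ?_) (ih (k - 1) (by omega) (by omega))
          simp only [squareChain_adj, chainLevel]; omega
  exact (connected_iff _).2 ⟨fun u v => (h u u.2).trans (h v v.2).symm, ⟨⟨0, by omega⟩⟩⟩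

lemma squareChain_adj_cases {n : ℕ} {u v : Fin (3 * n + 1)} (h : (squareChain n).Adj u v) :
    u.val % 3 = 0 ∧ (v.val = u.val + 1 ∨ v.val = u.val + 2) ∨
      u.val % 3 = 1 ∧ v.val = u.val + 2 ∨ u.val % 3 = 2 ∧ v.val = u.val + 1 ∨
      v.val % 3 = 0 ∧ (u.val = v.val + 1 ∨ u.val = v.val + 2) ∨
      v.val % 3 = 1 ∧ u.val = v.val + 2 ∨ v.val % 3 = 2 ∧ u.val = v.val + 1 := by
  rw [squareChain_adj, chainLevel_eq, chainLevel_eq] at h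
  omega

lemma squareChain_edges_eq {n i : ℕ} (hi : 3 * i + 3 < 3 * n + 1) {u v w : Fin (3 * n + 1)}
    (huv : (squareChain n).Adj u v) (hlt : u.val < v.val) (hu : u.val / 3 = i)
    {c : (squareChain n).Walk w w} (hc : c.IsCycle) (he : s(u, v) ∈ c.edges) :
    {e | e ∈ c.edges} = {s(⟨3 * i, by omega⟩, ⟨3 * i + 1, by omega⟩),
      s(⟨3 * i, by omega⟩, ⟨3 * i + 2, by omega⟩), s(⟨3 * i + 1, by omega⟩, ⟨3 * i + 3, hi⟩),
      s(⟨3 * i + 2, by omega⟩, ⟨3 * i + 3, hi⟩)} := by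
  set a : Fin (3 * n + 1) := ⟨3 * i, by omega⟩ with ha
  set b : Fin (3 * n + 1) := ⟨3 * i + 1, by omega⟩ with hb
  set d : Fin (3 * n + 1) := ⟨3 * i + 2, by omega⟩ with hd
  set a' : Fin (3 * n + 1) := ⟨3 * i + 3, hi⟩ with ha'
  have hba : s(a, b) ∈ c.edges ↔ s(b, a') ∈ c.edges := by
    refine hc.mem_edges_iff_of_cut ?_ (fun x => x.val = 3 * i + 1) fun x y h => ?_
    · simp only [ne_eq, Sym2.eq_iff, Fin.ext_iff, ha, hb, ha']
      omega
    · simp only [Sym2.eq_iff, Fin.ext_iff, ha, hb, ha']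
      rcases squareChain_adj_cases h with h | h | h | h | h | h <;> omega
  have hda : s(a, d) ∈ c.edges ↔ s(d, a') ∈ c.edges := by
    refine hc.mem_edges_iff_of_cut ?_ (fun x => x.val = 3 * i + 2) fun x y h => ?_
    · simp only [ne_eq, Sym2.eq_iff, Fin.ext_iff, ha, hd, ha']
      omega
    · simp only [Sym2.eq_iff, Fin.ext_iff, ha, hd, ha']
      rcases squareChain_adj_cases h with h | h | h | h | h | h <;> omega
  have hbd : s(a, b) ∈ c.edges ↔ s(a, d) ∈ c.edges := by
    refine hc.mem_edges_iff_of_cut ?_ (fun x => x.val ≤ 3 * i) fun x y h => ?_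
    · simp only [ne_eq, Sym2.eq_iff, Fin.ext_iff, ha, hb, hd]
      omega
    · simp only [Sym2.eq_iff, Fin.ext_iff, ha, hb, hd]
      rcases squareChain_adj_cases h with h | h | h | h | h | h <;> omega
  have hcases : s(u, v) = s(a, b) ∨ s(u, v) = s(a, d) ∨ s(u, v) = s(b, a') ∨
      s(u, v) = s(d, a') := by
    have huv' : u.val = 3 * i ∧ v.val = 3 * i + 1 ∨ u.val = 3 * i ∧ v.val = 3 * i + 2 ∨
        u.val = 3 * i + 1 ∧ v.val = 3 * i + 3 ∨ u.val = 3 * i + 2 ∧ v.val = 3 * i + 3 := by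
      rcases squareChain_adj_cases huv with h | h | h | h | h | h <;> omega
    refine huv'.imp ?_ (Or.imp ?_ (Or.imp ?_ ?_)) <;> rintro ⟨hu, hv⟩ <;>
      rw [Fin.eq_mk_iff_val_eq.2 hu, Fin.eq_mk_iff_val_eq.2 hv]
  have hall : s(a, b) ∈ c.edges := by
    rcases hcases with h | h | h | h <;> rw [h] at he <;> tauto
  refine hc.edges_eq_of_square ?_ ?_ hall (hbd.1 hall) (hba.1 hall) (hda.1 (hbd.1 hall))
  · simp [hb, hd]
  · simp [ha, ha']

lemma squareChain_isCactus (n : ℕ) : IsCactus (squareChain n) := by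
  refine ⟨squareChain_connected n, ?_⟩
  intro u v c₁ c₂ h₁ h₂ e he₁ he₂
  induction e using Sym2.ind with
  | _ x y =>
    have hxy := c₁.adj_of_mem_edges he₁
    wlog hlt : x.val < y.val generalizing x y
    · refine this y x (Sym2.eq_swap ▸ he₁) (Sym2.eq_swap ▸ he₂) hxy.symm ?_
      simp only [squareChain_adj, chainLevel] at hxy
      omega
    have hi : 3 * (x.val / 3) + 3 < 3 * n + 1 := by omega
    rw [squareChain_edges_eq hi hxy hlt rfl h₁ he₁, squareChain_edges_eq hi hxy hlt rfl h₂ he₂]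

lemma multipackingNumber_squareChain_le (n : ℕ) :
    multipackingNumber (squareChain n) ≤ 2 * n / 3 + 1 := by
  refine csSup_le' ?_
  rintro _ ⟨M, hM, rfl⟩
  have hcommon : ∀ u v w : Fin (3 * n + 1), u ∈ M → v ∈ M → (u = w ∨ (squareChain n).Adj u w) →
      (v = w ∨ (squareChain n).Adj v w) → u = v := by
    intro u v w hu hv huw hvw
    have hle : ∀ x : Fin (3 * n + 1), x = w ∨ (squareChain n).Adj x w →
        (squareChain n).dist x w ≤ 1 := by
      rintro x (rfl | h)
      · simp
      · exact (dist_eq_one_iff_adj.2 h).le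
    by_contra hne
    have h1 := hM w 1 le_rfl
    have h2 : ({u, v} : Set _) ⊆ M ∩ {x | (squareChain n).dist x w ≤ 1} := by
      rintro x (rfl | rfl)
      exacts [⟨hu, hle _ huw⟩, ⟨hv, hle _ hvw⟩]
    have h3 := Set.ncard_le_ncard h2 (Set.toFinite _)
    rw [Set.ncard_pair hne] at h3
    omega
  have hlt : ∀ u v : Fin (3 * n + 1), u ∈ M → v ∈ M → u.val < v.val →
      chainLevel u / 3 ≠ chainLevel v / 3 := by
    intro u v hu hv huv hl
    obtain ⟨w, hw, hw'⟩ : ∃ w : Fin (3 * n + 1), (u = w ∨ (squareChain n).Adj u w) ∧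
        (v = w ∨ (squareChain n).Adj v w) := by
      have hv' := v.2
      simp only [squareChain_adj, Fin.ext_iff]
      simp only [chainLevel] at hl ⊢
      by_cases h1 : u.val % 3 = 1 ∧ v.val = u.val + 1
      · exact ⟨⟨u.val - 1, by omega⟩, by simp only; omega, by simp only; omega⟩
      · by_cases h2 : u.val % 3 = 0
        · by_cases h3 : v.val = u.val + 3
          · exact ⟨⟨u.val + 1, by omega⟩, by simp only; omega, by simp only; omega⟩
          · exact ⟨u, by omega, by omega⟩
        · by_cases h3 : v.val = u.val / 3 * 3 + 3
          · exact ⟨u, by omega, by omega⟩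
          · exact ⟨⟨u.val / 3 * 3 + 3, by omega⟩, by simp only; omega, by simp only; omega⟩
    have := hcommon u v w hu hv hw hw'
    subst this
    omega
  have hinj : Set.InjOn (fun u : Fin (3 * n + 1) => chainLevel u / 3) M := by
    intro u hu v hv h
    rcases lt_trichotomy u.val v.val with h' | h' | h'
    · exact absurd h (hlt u v hu hv h')
    · exact Fin.ext h'
    · exact absurd h.symm (hlt v u hv hu h')
  have := Set.ncard_le_ncard_of_injOn (t := Set.Iio (2 * n / 3 + 1))
    (fun u : Fin (3 * n + 1) => chainLevel u / 3)
    (fun u _ => by simp only [chainLevel, Set.mem_Iio]; omega) hinj (Set.finite_Iio _)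
  simpa [Set.ncard_eq_toFinset_card'] using this

/-- If every ball of radius `r ≥ 1` has weight at most `m * r`, then `m` times the cost of a
dominating broadcast is at least the total weight. -/
lemma IsDominatingBroadcast.sum_weight_le [Fintype V] {G : SimpleGraph V} {f : V → ℕ}
    (hf : IsDominatingBroadcast G f) (w : V → ℕ) (m : ℕ)
    (hw : ∀ v r, 1 ≤ r → ∑ u with G.dist u v ≤ r, w u ≤ m * r) :
    ∑ u, w u ≤ m * ∑ v, f v := by
  classical
  calc ∑ u, w u ≤ ∑ u, ∑ v, if 0 < f v ∧ G.dist u v ≤ f v then w u else 0 := by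
        refine Finset.sum_le_sum fun u _ => ?_
        obtain ⟨v, hv⟩ := hf.2 u
        refine le_trans ?_ (Finset.single_le_sum (fun _ _ => Nat.zero_le _) (Finset.mem_univ v))
        rw [if_pos hv]
    _ = ∑ v, ∑ u, if 0 < f v ∧ G.dist u v ≤ f v then w u else 0 := Finset.sum_comm
    _ ≤ ∑ v, m * f v := by
        refine Finset.sum_le_sum fun v _ => ?_
        rcases Nat.eq_zero_or_pos (f v) with h | h
        · simp [h]
        · refine le_trans ?_ (hw v (f v) h)
          rw [Finset.sum_filter]
          simp [h]
    _ = m * ∑ v, f v := (Finset.mul_sum _ _ _).symm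

/-- Seven times a fractional multipacking of the chain of 4-cycles. -/
def chainWeight (k : ℕ) : ℕ := if k % 3 = 0 then 3 else 1

lemma sum_range_chainWeight (k : ℕ) :
    ∑ j ∈ Finset.range k, chainWeight j = 5 * (k / 3) + k % 3 + 2 * ((k % 3 + 1) / 2) := by
  induction k with
  | zero => rfl
  | succ k ih =>
    rw [Finset.sum_range_succ, ih, chainWeight]
    split_ifs <;> omega

lemma chainLevel_le_of_walk {n : ℕ} {u v : Fin (3 * n + 1)} (p : (squareChain n).Walk u v) :
    chainLevel u ≤ chainLevel v + p.length := by
  induction p with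
  | nil => simp
  | cons h p ih =>
    rw [squareChain_adj] at h
    rw [Walk.length_cons]
    omega

lemma chainLevel_le_add_dist {n : ℕ} (u v : Fin (3 * n + 1)) :
    chainLevel u ≤ chainLevel v + (squareChain n).dist u v := by
  obtain ⟨p, hp⟩ := (squareChain_connected n).exists_walk_length_eq_dist u v
  exact hp ▸ chainLevel_le_of_walk p

lemma sum_chainWeight_ball_le {n : ℕ} (v : Fin (3 * n + 1)) {r : ℕ} (hr : 1 ≤ r) :
    ∑ u with (squareChain n).dist u v ≤ r, chainWeight u.val ≤ 7 * r := by
  have hsub : ∀ S : Finset ℕ,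
      (∀ u : Fin (3 * n + 1), (squareChain n).dist u v ≤ r → u.val ∈ S) →
      ∑ u with (squareChain n).dist u v ≤ r, chainWeight u.val ≤ ∑ j ∈ S, chainWeight j := by
    intro S hS
    refine (Finset.sum_map _ Fin.valEmbedding chainWeight).symm.trans_le ?_
    refine Finset.sum_le_sum_of_subset fun j hj => ?_
    simp only [Finset.mem_map, Finset.mem_filter, Finset.mem_univ, true_and] at hj
    obtain ⟨u, hu, rfl⟩ := hj
    exact hS u hu
  have hIco : ∀ s t : ℕ, s ≤ t → ∑ j ∈ Finset.Ico s t, chainWeight j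
      + ∑ j ∈ Finset.range s, chainWeight j = ∑ j ∈ Finset.range t, chainWeight j := by
    intro s t hst
    rw [add_comm, Finset.sum_range_add_sum_Ico _ hst]
  rcases Nat.lt_or_ge 1 r with hr2 | hr1
  · have hv : chainLevel v = (2 * v.val + 1) / 3 := rfl
    generalize chainLevel v = L at hv
    have key := hIco (3 * ((L - r) / 2) + (L - r) % 2)
      (3 * ((L + r + 1) / 2) + (L + r + 1) % 2) (by omega)
    rw [sum_range_chainWeight, sum_range_chainWeight] at key
    refine (hsub _ fun u hu => ?_).trans (b := _) (by
      omega : ∑ j ∈ Finset.Ico (3 * ((L - r) / 2) + (L - r) % 2)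
        (3 * ((L + r + 1) / 2) + (L + r + 1) % 2), chainWeight j ≤ 7 * r)
    have h1 := chainLevel_le_add_dist u v
    have h2 := chainLevel_le_add_dist v u
    rw [SimpleGraph.dist_comm] at h2
    simp only [chainLevel] at h1 h2
    rw [Finset.mem_Ico]
    omega
  · obtain rfl : r = 1 := by omega
    have hball : ∀ u : Fin (3 * n + 1), (squareChain n).dist u v ≤ 1 →
        u.val = v.val ∨ (squareChain n).Adj u v := by
      intro u hu
      rcases Nat.le_one_iff_eq_zero_or_eq_one.1 hu with h | h
      · exact Or.inl (congrArg _ ((squareChain_connected n).dist_eq_zero_iff.1 h))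
      · exact Or.inr (dist_eq_one_iff_adj.1 h)
    simp only [squareChain_adj, chainLevel] at hball
    obtain h | h | h : v.val % 3 = 0 ∨ v.val % 3 = 1 ∨ v.val % 3 = 2 := by omega
    · have key := hIco (v.val - 2) (v.val + 3) (by omega)
      rw [sum_range_chainWeight, sum_range_chainWeight] at key
      refine (hsub (Finset.Ico (v.val - 2) (v.val + 3)) fun u hu => ?_).trans (by omega)
      have := hball u hu
      rw [Finset.mem_Ico]
      omega
    · refine (hsub {v.val - 1, v.val, v.val + 2} fun u hu => ?_).trans ?_
      · have := hball u hu
        simp only [Finset.mem_insert, Finset.mem_singleton]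
        omega
      · rw [Finset.sum_insert (by simp; omega), Finset.sum_pair (by omega)]
        simp only [chainWeight]
        split_ifs <;> omega
    · refine (hsub {v.val - 2, v.val, v.val + 1} fun u hu => ?_).trans ?_
      · have := hball u hu
        simp only [Finset.mem_insert, Finset.mem_singleton]
        omega
      · rw [Finset.sum_insert (by simp; omega), Finset.sum_pair (by omega)]
        simp only [chainWeight]
        split_ifs <;> omega

lemma le_broadcastDominationNumber_squareChain {n : ℕ} (hn : 1 ≤ n) :
    5 * n + 3 ≤ 7 * broadcastDominationNumber (squareChain n) := by
  have hne : {c | ∃ f : Fin (3 * n + 1) → ℕ, IsDominatingBroadcast (squareChain n) f ∧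
      ∑ᶠ v, f v = c}.Nonempty := by
    refine ⟨_, fun _ => 1, ⟨fun _ => ?_, fun u => ⟨u, by simp⟩⟩, rfl⟩
    refine le_csSup (Set.finite_range _).bddAbove
      ⟨(⟨0, by omega⟩, ⟨1, by omega⟩), dist_eq_one_iff_adj.2 ?_⟩
    simp [squareChain_adj, chainLevel]
  obtain ⟨f, hf, hcost⟩ := Nat.sInf_mem hne
  rw [finsum_eq_sum_of_fintype] at hcost
  have h := hf.sum_weight_le (fun u => chainWeight u.val) 7
    fun v r hr => sum_chainWeight_ball_le v hr
  rw [Fin.sum_univ_eq_sum_range, sum_range_chainWeight, hcost] at h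
  change 5 * n + 3 ≤ 7 * sInf _
  omega

end Lemmas

/-- For every natural number N, there exists a finite cactus graph G
with γ_b(G) − MP(G) ≥ N. -/
theorem stmt10 (N : ℕ) :
    ∃ (V : Type) (G : SimpleGraph V), Finite V ∧ IsCactus G ∧
      multipackingNumber G + N ≤ broadcastDominationNumber G := by
  refine ⟨_, squareChain (21 * N + 12), inferInstance, squareChain_isCactus _, ?_⟩
  have h₁ := multipackingNumber_squareChain_le (21 * N + 12)
  have h₂ := le_broadcastDominationNumber_squareChain (n := 21 * N + 12) (by omega)
  omega
end

section
/- For every positive integer k, there exists a finite connected (1/2)-hyperbolic graph G_k such that MP(G_k) = 3k and γ_b(G_k) = 4k. -/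
open SimpleGraph

variable {V : Type*}

/-- A graph is δ-hyperbolic if for any four vertices, the two larger of the three
pairwise distance sums differ by at most 2δ. -/
def IsHyperbolic (G : SimpleGraph V) (δ : ℝ) : Prop :=
  ∀ u v w x : V, ((G.dist u v + G.dist w x : ℕ) : ℝ) ≤
    max ((G.dist u w + G.dist v x : ℕ) : ℝ) ((G.dist u x + G.dist v w : ℕ) : ℝ) + 2 * δ

/-- A function satisfying the local rules of a path metric is the graph distance. -/
theorem SimpleGraph.connected_and_dist_eq [Nonempty V] {G : SimpleGraph V} {d : V → V → ℕ}
    (hself : ∀ v, d v v = 0) (hzero : ∀ u v, d u v = 0 → u = v)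
    (hadj : ∀ u v w, G.Adj u v → d u w ≤ d v w + 1)
    (hstep : ∀ u v n, d u v = n + 1 → ∃ w, G.Adj u w ∧ d w v = n) :
    G.Connected ∧ ∀ u v, G.dist u v = d u v := by
  have hwalk : ∀ n u v, d u v = n → ∃ p : G.Walk u v, p.length = n := by
    intro n
    induction n with
    | zero =>
      intro u v h
      obtain rfl := hzero u v h
      exact ⟨.nil, rfl⟩
    | succ n ih =>
      intro u v h
      obtain ⟨w, hw, hd⟩ := hstep u v n h
      obtain ⟨p, hp⟩ := ih w v hd
      exact ⟨.cons hw p, by simp [hp]⟩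
  have hle : ∀ u v (p : G.Walk u v), d u v ≤ p.length := by
    intro u v p
    induction p with
    | nil => simp [hself]
    | cons h p ih =>
      simp only [Walk.length_cons]
      exact (hadj _ _ _ h).trans (by omega)
  have hconn : G.Connected :=
    ⟨fun u v => (hwalk _ u v rfl).elim fun p _ => p.reachable⟩
  refine ⟨hconn, fun u v => le_antisymm ?_ ?_⟩
  · obtain ⟨p, hp⟩ := hwalk _ u v rfl
    exact hp ▸ dist_le p
  · obtain ⟨p, hp⟩ := hconn.exists_walk_length_eq_dist u v
    exact hp ▸ hle u v p

namespace PentagonChain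

/-- The distance in the five-cycle. -/
def cycleDist (p q : Fin 5) : ℕ :=
  if p = q then 0 else if q = p + 1 ∨ p = q + 1 then 1 else 2

/-- The distance in the five-cycle to the left port `0`. -/
def toLeft (p : Fin 5) : ℕ := cycleDist p 0

/-- Two minus the distance in the five-cycle to the right port `2`. -/
def fromRight (p : Fin 5) : ℕ := 2 - cycleDist p 2

/-- The distance in a chain of five-cycles, where the right port of each cycle is joined by an
edge to the left port of the next one. -/
def chainDist {n : ℕ} (u v : Fin n × Fin 5) : ℕ :=
  if u.1 < v.1 then 3 * (v.1 - u.1 : ℕ) + toLeft v.2 - fromRight u.2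
  else if v.1 < u.1 then 3 * (u.1 - v.1 : ℕ) + toLeft u.2 - fromRight v.2
  else cycleDist u.2 v.2

/-- The chain of `n` five-cycles. -/
def chain (n : ℕ) : SimpleGraph (Fin n × Fin 5) where
  Adj u v := chainDist u v = 1
  symm := ⟨by
    intro u v h
    have : ∀ p q, cycleDist p q = cycleDist q p := by decide
    grind [chainDist]⟩
  loopless := ⟨by
    intro u
    simp [chainDist, cycleDist]⟩

theorem cycleDist_comm : ∀ p q, cycleDist p q = cycleDist q p := by decide

theorem toLeft_le : ∀ p, toLeft p ≤ 2 := by decide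

theorem fromRight_le_toLeft : ∀ p, fromRight p ≤ toLeft p := by decide

theorem toLeft_le_fromRight_add_one : ∀ p, toLeft p ≤ fromRight p + 1 := by decide

theorem chainDist_cases {n : ℕ} (u v : Fin n × Fin 5) :
    ((u.1 : ℕ) < v.1 ∧
        chainDist u v + fromRight u.2 + 3 * (u.1 : ℕ) = 3 * (v.1 : ℕ) + toLeft v.2) ∨
      ((v.1 : ℕ) < u.1 ∧
        chainDist u v + fromRight v.2 + 3 * (v.1 : ℕ) = 3 * (u.1 : ℕ) + toLeft u.2) ∨
      ((u.1 : ℕ) = v.1 ∧ chainDist u v = cycleDist u.2 v.2) := by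
  have h1 := toLeft_le u.2
  have h2 := toLeft_le v.2
  have h3 := fromRight_le_toLeft u.2
  have h4 := fromRight_le_toLeft v.2
  simp only [chainDist, Fin.lt_def]
  split_ifs <;> omega

theorem cycleDist_bounds : ∀ p q, toLeft q ≤ cycleDist p q + toLeft p ∧
    fromRight q ≤ cycleDist p q + fromRight p ∧ cycleDist p q ≤ 2 ∧
    (cycleDist p q = 0 → p = q) ∧ cycleDist p q ≤ toLeft p + toLeft q ∧
    cycleDist p q + fromRight p + fromRight q ≤ 4 := by decide

theorem cycleDist_triangle :
    ∀ p q r, cycleDist p r ≤ cycleDist p q + cycleDist q r := by decide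

theorem chainDist_le_of_adj {n : ℕ} (u v w : Fin n × Fin 5) (h : (chain n).Adj u v) :
    chainDist u w ≤ chainDist v w + 1 := by
  have h : chainDist u v = 1 := h
  have := cycleDist_triangle u.2 v.2 w.2
  have := cycleDist_bounds u.2 v.2
  have := cycleDist_bounds v.2 u.2
  have := cycleDist_bounds v.2 w.2
  have := cycleDist_bounds w.2 v.2
  have := cycleDist_bounds u.2 w.2
  have := cycleDist_bounds w.2 u.2
  have := toLeft_le u.2
  have := toLeft_le v.2
  have := toLeft_le w.2
  have := fromRight_le_toLeft u.2
  have := fromRight_le_toLeft v.2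
  have := fromRight_le_toLeft w.2
  have := cycleDist_comm u.2 v.2
  have := cycleDist_comm v.2 w.2
  have := cycleDist_comm u.2 w.2
  rcases chainDist_cases u v with h1 | h1 | h1 <;> rcases chainDist_cases u w with h2 | h2 | h2 <;>
    rcases chainDist_cases v w with h3 | h3 | h3 <;> omega

theorem exists_adj_chainDist {n : ℕ} (u v : Fin n × Fin 5) (m : ℕ)
    (h : chainDist u v = m + 1) : ∃ w, (chain n).Adj u w ∧ chainDist w v = m := by
  have hinner : ∀ p q, cycleDist p q ≠ 0 →
      ∃ r, cycleDist p r = 1 ∧ cycleDist r q + 1 = cycleDist p q := by decide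
  have hright : ∀ p, p = 2 ∨ ∃ r, cycleDist p r = 1 ∧ fromRight r = fromRight p + 1 := by decide
  have hleft : ∀ p, p = 0 ∨ ∃ r, cycleDist p r = 1 ∧ toLeft r + 1 = toLeft p := by decide
  have hsame : ∀ p, chainDist u (u.1, p) = cycleDist u.2 p := fun p => by simp [chainDist]
  rcases chainDist_cases u v with ⟨hlt, he⟩ | ⟨hlt, he⟩ | ⟨heq, he⟩
  · rcases hright u.2 with hu | ⟨r, hr, hr'⟩
    · have hu2 : fromRight u.2 = 2 := by rw [hu]; rfl
      have h0 : toLeft 0 = 0 := rfl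
      have hc0 : cycleDist 0 v.2 = toLeft v.2 := cycleDist_comm _ _
      have h0' : fromRight 0 = 0 := rfl
      let w : Fin n × Fin 5 := (⟨u.1 + 1, by omega⟩, 0)
      have hw1 : (w.1 : ℕ) = u.1 + 1 := rfl
      have hw2 : w.2 = 0 := rfl
      refine ⟨w, show chainDist u w = 1 from ?_, ?_⟩
      · have := chainDist_cases u w
        rw [hw2] at this
        omega
      · have := chainDist_cases w v
        rw [hw2] at this
        omega
    · refine ⟨(u.1, r), (hsame r).trans hr, ?_⟩
      have := chainDist_cases (u.1, r) v
      dsimp only at this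
      omega
  · rcases hleft u.2 with hu | ⟨r, hr, hr'⟩
    · have hu2 : toLeft u.2 = 0 := by rw [hu]; rfl
      have h0 : toLeft 2 = 2 := rfl
      have hc0 : cycleDist 2 v.2 + fromRight v.2 = 2 :=
        (by decide : ∀ p, cycleDist 2 p + fromRight p = 2) v.2
      have h0' : fromRight 2 = 2 := rfl
      let w : Fin n × Fin 5 := (⟨u.1 - 1, by omega⟩, 2)
      have hw1 : (w.1 : ℕ) = u.1 - 1 := rfl
      have hw2 : w.2 = 2 := rfl
      refine ⟨w, show chainDist u w = 1 from ?_, ?_⟩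
      · have := chainDist_cases u w
        rw [hw2] at this
        omega
      · have := chainDist_cases w v
        rw [hw2] at this
        omega
    · refine ⟨(u.1, r), (hsame r).trans hr, ?_⟩
      have := chainDist_cases (u.1, r) v
      dsimp only at this
      omega
  · obtain ⟨r, hr, hr'⟩ := hinner u.2 v.2 (by omega)
    refine ⟨(u.1, r), (hsame r).trans hr, ?_⟩
    have := chainDist_cases (u.1, r) v
    dsimp only at this
    omega

theorem connected_and_dist {n : ℕ} (hn : 0 < n) :
    (chain n).Connected ∧ ∀ u v, (chain n).dist u v = chainDist u v := by
  have : Nonempty (Fin n × Fin 5) := ⟨(⟨0, hn⟩, 0)⟩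
  refine connected_and_dist_eq (fun v => by simp [chainDist, cycleDist]) (fun u v h => ?_)
    chainDist_le_of_adj exists_adj_chainDist
  have := cycleDist_bounds u.2 v.2
  have := toLeft_le u.2
  have := toLeft_le v.2
  have := fromRight_le_toLeft u.2
  have := fromRight_le_toLeft v.2
  have h1 : (u.1 : ℕ) = v.1 := by have := chainDist_cases u v; omega
  have h2 : u.2 = v.2 := by
    have := chainDist_cases u v
    have : cycleDist u.2 v.2 = 0 := by omega
    tauto
  exact Prod.ext (Fin.ext h1) h2

theorem cycleDist_four_point (p q r s : Fin 5) :
    (cycleDist p q + cycleDist r s ≤ cycleDist p r + cycleDist q s + 1 ∨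
      cycleDist p q + cycleDist r s ≤ cycleDist p s + cycleDist q r + 1) ∧
    (cycleDist p r + cycleDist q s ≤ cycleDist p q + cycleDist r s + 1 ∨
      cycleDist p r + cycleDist q s ≤ cycleDist p s + cycleDist q r + 1) ∧
    (cycleDist p s + cycleDist q r ≤ cycleDist p q + cycleDist r s + 1 ∨
      cycleDist p s + cycleDist q r ≤ cycleDist p r + cycleDist q s + 1) := by
  revert p q r s
  decide

theorem cycleDist_three_point_left (q r s : Fin 5) :
    (toLeft q + cycleDist r s ≤ toLeft r + cycleDist q s + 1 ∨
      toLeft q + cycleDist r s ≤ toLeft s + cycleDist q r + 1) ∧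
    (toLeft r + cycleDist q s ≤ toLeft q + cycleDist r s + 1 ∨
      toLeft r + cycleDist q s ≤ toLeft s + cycleDist q r + 1) ∧
    (toLeft s + cycleDist q r ≤ toLeft q + cycleDist r s + 1 ∨
      toLeft s + cycleDist q r ≤ toLeft r + cycleDist q s + 1) := by
  revert q r s
  decide

theorem cycleDist_three_point_right (p q r : Fin 5) :
    (cycleDist p q + fromRight q ≤ cycleDist p r + fromRight r + 1 ∨
      cycleDist p q + fromRight p ≤ cycleDist q r + fromRight r + 1) ∧
    (cycleDist p r + fromRight r ≤ cycleDist p q + fromRight q + 1 ∨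
      cycleDist p r + fromRight p ≤ cycleDist q r + fromRight q + 1) ∧
    (cycleDist q r + fromRight r ≤ cycleDist p q + fromRight p + 1 ∨
      cycleDist q r + fromRight q ≤ cycleDist p r + fromRight p + 1) := by
  revert p q r
  decide

theorem chainDist_comm {n : ℕ} (u v : Fin n × Fin 5) : chainDist u v = chainDist v u := by
  have := cycleDist_comm u.2 v.2
  have := chainDist_cases u v
  have := chainDist_cases v u
  omega

/-- The three instances of the four-point condition with constant one. -/
def FourPoint {n : ℕ} (u v w x : Fin n × Fin 5) : Prop :=
  (chainDist u v + chainDist w x ≤ chainDist u w + chainDist v x + 1 ∨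
      chainDist u v + chainDist w x ≤ chainDist u x + chainDist v w + 1) ∧
    (chainDist u w + chainDist v x ≤ chainDist u v + chainDist w x + 1 ∨
      chainDist u w + chainDist v x ≤ chainDist u x + chainDist v w + 1) ∧
    (chainDist u x + chainDist v w ≤ chainDist u v + chainDist w x + 1 ∨
      chainDist u x + chainDist v w ≤ chainDist u w + chainDist v x + 1)

theorem FourPoint.swap_left {n : ℕ} {u v w x : Fin n × Fin 5} (h : FourPoint u v w x) :
    FourPoint v u w x := by
  have := chainDist_comm u v
  unfold FourPoint at *
  omega

theorem FourPoint.swap_mid {n : ℕ} {u v w x : Fin n × Fin 5} (h : FourPoint u v w x) :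
    FourPoint u w v x := by
  have := chainDist_comm v w
  unfold FourPoint at *
  omega

theorem FourPoint.swap_right {n : ℕ} {u v w x : Fin n × Fin 5} (h : FourPoint u v w x) :
    FourPoint u v x w := by
  have := chainDist_comm w x
  unfold FourPoint at *
  omega

theorem cycleDist_le_or : ∀ p q, cycleDist p q + fromRight q ≤ toLeft p + 1 ∨
    cycleDist p q + fromRight p ≤ toLeft q + 1 := by decide

theorem chainDist_of_lt {n : ℕ} {u v : Fin n × Fin 5} (h : (u.1 : ℕ) < v.1) :
    chainDist u v + fromRight u.2 + 3 * (u.1 : ℕ) = 3 * (v.1 : ℕ) + toLeft v.2 := by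
  have := chainDist_cases u v
  omega

theorem chainDist_of_eq {n : ℕ} {u v : Fin n × Fin 5} (h : (u.1 : ℕ) = v.1) :
    chainDist u v = cycleDist u.2 v.2 := by
  have := chainDist_cases u v
  omega

theorem fourPoint_of_le {n : ℕ} {u v w x : Fin n × Fin 5} (huv : u.1 ≤ v.1) (hvw : v.1 ≤ w.1)
    (hwx : w.1 ≤ x.1) : FourPoint u v w x := by
  have hbounds : ∀ p, fromRight p ≤ toLeft p ∧ toLeft p ≤ fromRight p + 1 ∧ toLeft p ≤ 2 :=
    fun p => ⟨fromRight_le_toLeft p, toLeft_le_fromRight_add_one p, toLeft_le p⟩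
  have tu := hbounds u.2
  have tv := hbounds v.2
  have tw := hbounds w.2
  have tx := hbounds x.2
  rw [Fin.le_def] at huv hvw hwx
  unfold FourPoint
  rcases huv.lt_or_eq with huv | huv <;> rcases hvw.lt_or_eq with hvw | hvw <;>
    rcases hwx.lt_or_eq with hwx | hwx
  · have duv := chainDist_of_lt (u := u) (v := v) (by omega)
    have duw := chainDist_of_lt (u := u) (v := w) (by omega)
    have dux := chainDist_of_lt (u := u) (v := x) (by omega)
    have dvw := chainDist_of_lt (u := v) (v := w) (by omega)
    have dvx := chainDist_of_lt (u := v) (v := x) (by omega)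
    have dwx := chainDist_of_lt (u := w) (v := x) (by omega)
    refine ⟨?_, ?_, ?_⟩ <;> omega
  · have duv := chainDist_of_lt (u := u) (v := v) (by omega)
    have duw := chainDist_of_lt (u := u) (v := w) (by omega)
    have dux := chainDist_of_lt (u := u) (v := x) (by omega)
    have dvw := chainDist_of_lt (u := v) (v := w) (by omega)
    have dvx := chainDist_of_lt (u := v) (v := x) (by omega)
    have dwx := chainDist_of_eq (u := w) (v := x) (by omega)
    have bw := cycleDist_bounds w.2 x.2
    have bw' := cycleDist_bounds x.2 w.2
    have cw := cycleDist_comm w.2 x.2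
    refine ⟨?_, ?_, ?_⟩ <;> omega
  · have duv := chainDist_of_lt (u := u) (v := v) (by omega)
    have duw := chainDist_of_lt (u := u) (v := w) (by omega)
    have dux := chainDist_of_lt (u := u) (v := x) (by omega)
    have dvw := chainDist_of_eq (u := v) (v := w) (by omega)
    have dvx := chainDist_of_lt (u := v) (v := x) (by omega)
    have dwx := chainDist_of_lt (u := w) (v := x) (by omega)
    have bv := cycleDist_bounds v.2 w.2
    have bv' := cycleDist_bounds w.2 v.2
    have cv := cycleDist_comm v.2 w.2
    have := cycleDist_le_or v.2 w.2
    refine ⟨?_, ?_, ?_⟩ <;> omega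
  · have duv := chainDist_of_lt (u := u) (v := v) (by omega)
    have duw := chainDist_of_lt (u := u) (v := w) (by omega)
    have dux := chainDist_of_lt (u := u) (v := x) (by omega)
    have dvw := chainDist_of_eq (u := v) (v := w) (by omega)
    have dvx := chainDist_of_eq (u := v) (v := x) (by omega)
    have dwx := chainDist_of_eq (u := w) (v := x) (by omega)
    obtain ⟨h₁, h₂, h₃⟩ := cycleDist_three_point_left v.2 w.2 x.2
    clear tu tv tw tx
    exact ⟨by clear h₂ h₃; omega, by clear h₁ h₃; omega, by clear h₁ h₂; omega⟩
  · have duv := chainDist_of_eq (u := u) (v := v) (by omega)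
    have duw := chainDist_of_lt (u := u) (v := w) (by omega)
    have dux := chainDist_of_lt (u := u) (v := x) (by omega)
    have dvw := chainDist_of_lt (u := v) (v := w) (by omega)
    have dvx := chainDist_of_lt (u := v) (v := x) (by omega)
    have dwx := chainDist_of_lt (u := w) (v := x) (by omega)
    have bu := cycleDist_bounds u.2 v.2
    have bu' := cycleDist_bounds v.2 u.2
    have cu := cycleDist_comm u.2 v.2
    refine ⟨?_, ?_, ?_⟩ <;> omega
  · have duv := chainDist_of_eq (u := u) (v := v) (by omega)
    have duw := chainDist_of_lt (u := u) (v := w) (by omega)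
    have dux := chainDist_of_lt (u := u) (v := x) (by omega)
    have dvw := chainDist_of_lt (u := v) (v := w) (by omega)
    have dvx := chainDist_of_lt (u := v) (v := x) (by omega)
    have dwx := chainDist_of_eq (u := w) (v := x) (by omega)
    obtain ⟨-, -, -, -, -, bu⟩ := cycleDist_bounds u.2 v.2
    obtain ⟨-, -, -, -, bw, -⟩ := cycleDist_bounds w.2 x.2
    clear tu tv tw tx
    exact ⟨.inl (by omega), .inr (by omega), .inr (by omega)⟩
  · have duv := chainDist_of_eq (u := u) (v := v) (by omega)
    have duw := chainDist_of_eq (u := u) (v := w) (by omega)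
    have dux := chainDist_of_lt (u := u) (v := x) (by omega)
    have dvw := chainDist_of_eq (u := v) (v := w) (by omega)
    have dvx := chainDist_of_lt (u := v) (v := x) (by omega)
    have dwx := chainDist_of_lt (u := w) (v := x) (by omega)
    obtain ⟨h₁, h₂, h₃⟩ := cycleDist_three_point_right u.2 v.2 w.2
    clear tu tv tw tx
    exact ⟨by clear h₂ h₃; omega, by clear h₁ h₃; omega, by clear h₁ h₂; omega⟩
  · have duv := chainDist_of_eq (u := u) (v := v) (by omega)
    have duw := chainDist_of_eq (u := u) (v := w) (by omega)
    have dux := chainDist_of_eq (u := u) (v := x) (by omega)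
    have dvw := chainDist_of_eq (u := v) (v := w) (by omega)
    have dvx := chainDist_of_eq (u := v) (v := x) (by omega)
    have dwx := chainDist_of_eq (u := w) (v := x) (by omega)
    rw [duv, duw, dux, dvw, dvx, dwx]
    exact cycleDist_four_point u.2 v.2 w.2 x.2

theorem fourPoint {n : ℕ} (u v w x : Fin n × Fin 5) : FourPoint u v w x := by
  have sort₃ : ∀ u v w x : Fin n × Fin 5, u.1 ≤ v.1 → v.1 ≤ w.1 → FourPoint u v w x := by
    intro u v w x huv hvw
    rcases le_total w.1 x.1 with hwx | hxw
    · exact fourPoint_of_le huv hvw hwx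
    rcases le_total v.1 x.1 with hvx | hxv
    · exact (fourPoint_of_le huv hvx hxw).swap_right
    rcases le_total u.1 x.1 with hux | hxu
    · exact (fourPoint_of_le hux hxv hvw).swap_mid.swap_right
    · exact (fourPoint_of_le hxu huv hvw).swap_left.swap_mid.swap_right
  have sort₂ : ∀ u v w x : Fin n × Fin 5, u.1 ≤ v.1 → FourPoint u v w x := by
    intro u v w x huv
    rcases le_total v.1 w.1 with hvw | hwv
    · exact sort₃ _ _ _ _ huv hvw
    rcases le_total u.1 w.1 with huw | hwu
    · exact (sort₃ _ _ _ _ huw hwv).swap_mid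
    · exact (sort₃ _ _ _ _ hwu huv).swap_left.swap_mid
  rcases le_total u.1 v.1 with huv | hvu
  · exact sort₂ _ _ _ _ huv
  · exact (sort₂ _ _ _ _ hvu).swap_left

theorem isHyperbolic {n : ℕ} (hn : 0 < n) : IsHyperbolic (chain n) (1 / 2 : ℝ) := by
  intro u v w x
  simp only [(connected_and_dist hn).2]
  have : chainDist u v + chainDist w x ≤
      max (chainDist u w + chainDist v x) (chainDist u x + chainDist v w) + 1 := by
    have := (fourPoint u v w x).1
    omega
  rw [← Nat.cast_max]
  norm_num
  exact_mod_cast this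

/-- Any two vertices of the same cycle have a common closed neighbour, so a multipacking
contains at most one vertex of each cycle. -/
theorem ncard_le_of_isMultipacking {n : ℕ} (hn : 0 < n) {M : Set (Fin n × Fin 5)}
    (hM : IsMultipacking (chain n) M) : M.ncard ≤ n := by
  have hinj : Set.InjOn Prod.fst M := by
    intro u hu v hv huv
    by_contra hne
    have hmid : ∀ p q, ∃ r, cycleDist p r ≤ 1 ∧ cycleDist q r ≤ 1 := by decide
    obtain ⟨r, hr, hr'⟩ := hmid u.2 v.2
    have hball := hM (u.1, r) 1 le_rfl
    have hsub : ({u, v} : Set (Fin n × Fin 5)) ⊆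
        M ∩ {w | (chain n).dist w (u.1, r) ≤ 1} := by
      rintro w (rfl | rfl)
      · exact ⟨hu, by simpa [(connected_and_dist hn).2, chainDist] using hr⟩
      · exact ⟨hv, by simpa [(connected_and_dist hn).2, chainDist, huv] using hr'⟩
    have := Set.ncard_le_ncard hsub (Set.toFinite _)
    rw [Set.ncard_pair hne] at this
    omega
  calc M.ncard = (Prod.fst '' M).ncard := hinj.ncard_image.symm
    _ ≤ (Set.univ : Set (Fin n)).ncard := Set.ncard_le_ncard (Set.subset_univ _)
    _ = n := by simp [Set.ncard_univ]

theorem isMultipacking_range {n : ℕ} (hn : 0 < n) :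
    IsMultipacking (chain n) (Set.range fun i : Fin n => (i, (0 : Fin 5))) := by
  intro v r hr
  let s : ℤ := r + fromRight v.2 + 3 * (v.1 : ℕ)
  let t : ℤ := toLeft v.2 + 3 * (v.1 : ℕ) - r
  have hmaps : ∀ u ∈ Set.range (fun i : Fin n => (i, (0 : Fin 5))) ∩
      {u | (chain n).dist u v ≤ r}, ((u.1 : ℕ) : ℤ) ∈ (Finset.Icc ((t + 2) / 3) (s / 3) : Set ℤ) := by
    rintro _ ⟨⟨i, rfl⟩, hi⟩
    rw [Set.mem_ofPred_eq, (connected_and_dist hn).2] at hi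
    beta_reduce at hi
    have hcases := chainDist_cases (i, 0) v
    have h0 : toLeft 0 = 0 := rfl
    have h0' : fromRight 0 = 0 := rfl
    have hc : cycleDist 0 v.2 = toLeft v.2 := cycleDist_comm _ _
    have := fromRight_le_toLeft v.2
    have := toLeft_le v.2
    dsimp only at hcases ⊢
    simp only [Finset.coe_Icc, Set.mem_Icc, s, t]
    omega
  have hinj : Set.InjOn (fun u : Fin n × Fin 5 => ((u.1 : ℕ) : ℤ))
      (Set.range (fun i : Fin n => (i, (0 : Fin 5))) ∩ {u | (chain n).dist u v ≤ r}) := by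
    rintro _ ⟨⟨i, rfl⟩, -⟩ _ ⟨⟨j, rfl⟩, -⟩ hij
    simp only [Nat.cast_inj, Fin.val_inj] at hij
    rw [hij]
  refine (Set.ncard_le_ncard_of_injOn _ hmaps hinj (Finset.finite_toSet _)).trans ?_
  rw [Set.ncard_coe_finset, Int.card_Icc]
  have := fromRight_le_toLeft v.2
  simp only [s, t]
  omega

theorem multipackingNumber_chain {n : ℕ} (hn : 0 < n) : multipackingNumber (chain n) = n := by
  refine IsGreatest.csSup_eq ⟨⟨_, isMultipacking_range hn, ?_⟩, ?_⟩
  · rw [← Set.image_univ, Set.ncard_image_of_injective _ (fun i j h => (Prod.ext_iff.1 h).1)]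
    simp [Set.ncard_univ]
  · rintro _ ⟨M, hM, rfl⟩
    exact ncard_le_of_isMultipacking hn hM

/-- An enumeration, from left to right, of the vertices of degree two or three of a five-cycle
other than the middle vertex `1`. -/
def rank (p : Fin 5) : ℕ := ![0, 0, 3, 2, 1] p

theorem rank_injOn : ∀ p q, p ≠ 1 → q ≠ 1 → rank p = rank q → p = q := by decide

theorem rank_bounds : ∀ p, p ≠ 1 → 3 * rank p ≤ 4 * toLeft p + 1 ∧ 4 * fromRight p ≤ 3 * rank p
   := by decide

/-- A ball of radius `r ≥ 1` contains at most `3 * r` vertices that are not middle vertices. -/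
theorem card_ball_le {n : ℕ} (v : Fin n × Fin 5) {r : ℕ} (hr : 1 ≤ r) :
    (Finset.univ.filter fun u : Fin n × Fin 5 => u.2 ≠ 1 ∧ chainDist u v ≤ r).card ≤ 3 * r := by
  let s : ℤ := r + fromRight v.2 + 3 * (v.1 : ℕ)
  let t : ℤ := toLeft v.2 + 3 * (v.1 : ℕ) - r
  let e : Fin n × Fin 5 → ℤ := fun u => 4 * (u.1 : ℕ) + rank u.2
  have hrank : ∀ p, rank p ≤ 3 := by decide
  have hinj : Set.InjOn e (Finset.univ.filter fun u : Fin n × Fin 5 =>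
      u.2 ≠ 1 ∧ chainDist u v ≤ r) := by
    intro u hu w hw huw
    simp only [Finset.coe_filter, Finset.mem_univ, true_and, Set.mem_ofPred_eq] at hu hw
    have := hrank u.2
    have := hrank w.2
    simp only [e] at huw
    exact Prod.ext (Fin.ext (by omega)) (rank_injOn _ _ hu.1 hw.1 (by omega))
  have hbounds := fromRight_le_toLeft v.2
  rcases hr.eq_or_lt with rfl | hr
  · by_cases hv : v.2 = 1
    · refine (Finset.card_le_card_of_injOn (t := {4 * (v.1 : ℤ), 4 * (v.1 : ℤ) + 3}) e ?_ hinj).trans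
        (Finset.card_le_two.trans (by norm_num))
      intro u hu
      simp only [Finset.coe_filter, Finset.mem_univ, true_and, Set.mem_ofPred_eq] at hu
      have hcases := chainDist_cases u v
      have h1 : toLeft 1 = 1 := rfl
      have h1' : fromRight 1 = 1 := rfl
      have := toLeft_le u.2
      have := fromRight_le_toLeft u.2
      have hnear : ∀ p, p ≠ 1 → cycleDist p 1 ≤ 1 → rank p = 0 ∨ rank p = 3 := by decide
      have := hnear u.2 hu.1
      rw [hv] at hcases
      simp only [Finset.coe_insert, Finset.coe_singleton, Set.mem_insert_iff,
        Set.mem_singleton_iff, e]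
      omega
    · refine (Finset.card_le_card_of_injOn (t := Finset.Icc (4 * (v.1 : ℤ) + rank v.2 - 1)
        (4 * (v.1 : ℤ) + rank v.2 + 1)) e ?_ hinj).trans (by rw [Int.card_Icc]; omega)
      intro u hu
      simp only [Finset.coe_filter, Finset.mem_univ, true_and, Set.mem_ofPred_eq] at hu
      have hcases := chainDist_cases u v
      have hnear : ∀ p q, p ≠ 1 → q ≠ 1 → cycleDist p q ≤ 1 →
        rank p ≤ rank q + 1 ∧ rank q ≤ rank p + 1 := by decide
      have := hnear u.2 v.2 hu.1 hv
      have := rank_bounds u.2 hu.1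
      have := rank_bounds v.2 hv
      have := toLeft_le u.2
      have := toLeft_le v.2
      simp only [Finset.coe_Icc, Set.mem_Icc, e]
      omega
  · refine (Finset.card_le_card_of_injOn (t := Finset.Icc ((4 * t + 2) / 3) ((4 * s + 1) / 3))
      e ?_ hinj).trans (by rw [Int.card_Icc]; simp only [s, t]; omega)
    intro u hu
    simp only [Finset.coe_filter, Finset.mem_univ, true_and, Set.mem_ofPred_eq] at hu
    have hcases := chainDist_cases u v
    have := rank_bounds u.2 hu.1
    have := toLeft_le u.2
    have := toLeft_le v.2
    have := fromRight_le_toLeft u.2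
    simp only [Finset.coe_Icc, Set.mem_Icc, e, s, t]
    omega

theorem le_sum_of_isDominatingBroadcast {k : ℕ} (hk : 0 < k) {f : Fin (3 * k) × Fin 5 → ℕ}
    (hf : IsDominatingBroadcast (chain (3 * k)) f) : 4 * k ≤ ∑ v, f v := by
  let W : Finset (Fin (3 * k) × Fin 5) := Finset.univ.filter fun u => u.2 ≠ 1
  have hW : W.card = 12 * k := by
    have : W = Finset.univ ×ˢ (Finset.univ.filter fun p : Fin 5 => p ≠ 1) := by
      ext; simp [W]
    rw [this, Finset.card_product, Finset.card_univ, Fintype.card_fin,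
      show (Finset.univ.filter fun p : Fin 5 => p ≠ 1).card = 4 from rfl]
    ring
  let B : Fin (3 * k) × Fin 5 → Finset (Fin (3 * k) × Fin 5) := fun v =>
    if f v = 0 then ∅ else Finset.univ.filter fun u => u.2 ≠ 1 ∧ chainDist u v ≤ f v
  have hcover : W ⊆ Finset.univ.biUnion B := by
    intro u hu
    obtain ⟨v, hv, huv⟩ := hf.2 u
    rw [(connected_and_dist (by omega)).2] at huv
    simp only [W, Finset.mem_filter, Finset.mem_univ, true_and] at hu
    simp only [Finset.mem_biUnion, Finset.mem_univ, true_and, B]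
    exact ⟨v, by simp [hv.ne', hu, huv]⟩
  have hB : ∀ v, (B v).card ≤ 3 * f v := by
    intro v
    simp only [B]
    split_ifs with h
    · simp
    · exact card_ball_le v (by omega)
  have := calc W.card ≤ ∑ v, (B v).card := (Finset.card_le_card hcover).trans Finset.card_biUnion_le
    _ ≤ ∑ v, 3 * f v := Finset.sum_le_sum fun v _ => hB v
    _ = 3 * ∑ v, f v := (Finset.mul_sum _ _ _).symm
  omega

theorem four_le_gDiam {k : ℕ} (hk : 0 < k) : 4 ≤ gDiam (chain (3 * k)) := by
  have hmem : (chain (3 * k)).dist (⟨0, by omega⟩, 0) (⟨1, by omega⟩, 1) ≤ gDiam (chain (3 * k)) :=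
    le_csSup (Set.toFinite _).bddAbove ⟨((⟨0, by omega⟩, 0), (⟨1, by omega⟩, 1)), rfl⟩
  rw [(connected_and_dist (by omega)).2] at hmem
  exact hmem

/-- Balls of radius four around the middle vertices of every third cycle. -/
def broadcast {k : ℕ} (v : Fin (3 * k) × Fin 5) : ℕ :=
  ∑ m : Fin k, if v = (⟨3 * m + 1, by omega⟩, 1) then 4 else 0

theorem broadcast_center {k : ℕ} (m : Fin k) :
    broadcast ((⟨3 * m + 1, by omega⟩, 1) : Fin (3 * k) × Fin 5) = 4 := by
  simp [broadcast, Fin.val_inj]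

theorem isDominatingBroadcast {k : ℕ} (hk : 0 < k) :
    IsDominatingBroadcast (chain (3 * k)) broadcast := by
  constructor
  · intro v
    by_cases h : ∃ m : Fin k, v = (⟨3 * m + 1, by omega⟩, 1)
    · obtain ⟨m, rfl⟩ := h
      exact (broadcast_center m).trans_le (four_le_gDiam hk)
    · push Not at h
      simp [broadcast, h]
  · intro u
    let m : Fin k := ⟨u.1 / 3, by omega⟩
    refine ⟨(⟨3 * m + 1, by omega⟩, 1), by simp [broadcast_center], ?_⟩
    rw [broadcast_center, (connected_and_dist (by omega)).2]
    have hcases := chainDist_cases u (⟨3 * m + 1, by omega⟩, 1)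
    have := cycleDist_bounds u.2 1
    have := toLeft_le u.2
    have h1 : toLeft 1 = 1 := rfl
    have h1' : fromRight 1 = 1 := rfl
    have hm : (m : ℕ) = u.1 / 3 := rfl
    dsimp only at hcases
    omega

theorem sum_broadcast (k : ℕ) : ∑ v : Fin (3 * k) × Fin 5, broadcast v = 4 * k := by
  simp only [broadcast]
  rw [Finset.sum_comm]
  simp [mul_comm]

theorem broadcastDominationNumber_chain {k : ℕ} (hk : 0 < k) :
    broadcastDominationNumber (chain (3 * k)) = 4 * k := by
  refine IsLeast.csInf_eq ⟨⟨_, isDominatingBroadcast hk, ?_⟩, ?_⟩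
  · rw [finsum_eq_sum_of_fintype, sum_broadcast]
  · rintro _ ⟨f, hf, rfl⟩
    rw [finsum_eq_sum_of_fintype]
    exact le_sum_of_isDominatingBroadcast hk hf

end PentagonChain

/-- For every positive integer k, there is a finite connected
(1/2)-hyperbolic graph G_k with MP(G_k) = 3k and γ_b(G_k) = 4k. -/
theorem stmt11 (k : ℕ) (hk : 0 < k) :
    ∃ (V : Type) (G : SimpleGraph V), Finite V ∧ G.Connected ∧
      IsHyperbolic G (1 / 2 : ℝ) ∧
      multipackingNumber G = 3 * k ∧ broadcastDominationNumber G = 4 * k := by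
  have hn : 0 < 3 * k := by omega
  exact ⟨_, PentagonChain.chain (3 * k), inferInstance, (PentagonChain.connected_and_dist hn).1,
    PentagonChain.isHyperbolic hn, PentagonChain.multipackingNumber_chain hn,
    PentagonChain.broadcastDominationNumber_chain hk⟩
end

section
/- For every natural number N, there exists a finite connected (1/2)-hyperbolic graph G such that γ_b(G) − MP(G) ≥ N; that is, the difference between the broadcast domination number and the multipacking number can be arbitrarily large for (1/2)-hyperbolic graphs. -/
open SimpleGraph

variable {V : Type*}

/-! ### Graphs from integer-valued metrics -/

/-- The graph whose edges are the pairs at distance one. -/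
def unitDistGraph {V : Type*} (d : V → V → ℕ) (hself : ∀ u, d u u = 0)
    (hsymm : ∀ u v, d u v = d v u) : SimpleGraph V where
  Adj u v := d u v = 1
  symm := ⟨fun u v h => by rw [hsymm]; exact h⟩
  loopless := ⟨fun u h => by rw [hself] at h; exact absurd h (by norm_num)⟩

section UnitDistGraph

variable {V : Type*} (d : V → V → ℕ) (hself : ∀ u, d u u = 0) (hsymm : ∀ u v, d u v = d v u)

theorem unitDistGraph_exists_walk
    (hstep : ∀ u v, u ≠ v → ∃ w, d u w = 1 ∧ d w v + 1 = d u v) (u v : V) :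
    ∃ p : (unitDistGraph d hself hsymm).Walk u v, p.length = d u v := by
  induction h : d u v generalizing u with
  | zero =>
    by_cases huv : u = v
    · subst huv
      exact ⟨.nil, rfl⟩
    · obtain ⟨w, -, h2⟩ := hstep u v huv
      omega
  | succ k ih =>
    have huv : u ≠ v := by
      rintro rfl
      rw [hself] at h
      omega
    obtain ⟨w, h1, h2⟩ := hstep u v huv
    obtain ⟨p, hp⟩ := ih w (by omega)
    have hadj : (unitDistGraph d hself hsymm).Adj u w := h1
    exact ⟨.cons hadj p, by simp [hp]⟩

theorem le_length_of_unitDistGraph_walk (hlip : ∀ u w v, d u w = 1 → d u v ≤ d w v + 1)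
    {u v : V} (p : (unitDistGraph d hself hsymm).Walk u v) : d u v ≤ p.length := by
  induction p with
  | nil => simp [hself]
  | cons h p ih =>
    rw [SimpleGraph.Walk.length_cons]
    exact (hlip _ _ _ h).trans (by omega)

theorem unitDistGraph_connected [Nonempty V]
    (hstep : ∀ u v, u ≠ v → ∃ w, d u w = 1 ∧ d w v + 1 = d u v) :
    (unitDistGraph d hself hsymm).Connected :=
  ⟨fun u v => ⟨(unitDistGraph_exists_walk d hself hsymm hstep u v).choose⟩⟩

theorem unitDistGraph_dist (hlip : ∀ u w v, d u w = 1 → d u v ≤ d w v + 1)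
    (hstep : ∀ u v, u ≠ v → ∃ w, d u w = 1 ∧ d w v + 1 = d u v) (u v : V) :
    (unitDistGraph d hself hsymm).dist u v = d u v := by
  obtain ⟨p, hp⟩ := unitDistGraph_exists_walk d hself hsymm hstep u v
  obtain ⟨q, hq⟩ := p.reachable.exists_walk_length_eq_dist
  apply le_antisymm
  · rw [← hp]
    exact SimpleGraph.dist_le p
  · rw [← hq]
    exact le_length_of_unitDistGraph_walk d hself hsymm hlip q

end UnitDistGraph

/-! ### The 3-sun and chains of 3-suns -/

/-- Distance in the 3-sun: the vertices `(false, i)` are the tips, the vertices `(true, i)` form a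
triangle, and the tip `i` is adjacent to the triangle vertices `j ≠ i`. -/
def sunDist (s t : Bool × Fin 3) : ℕ :=
  if s = t then 0 else if s.1 = t.1 then (if s.1 then 1 else 2) else if s.2 = t.2 then 2 else 1

/-- The tip by which a 3-sun in a chain is joined to the preceding one. -/
abbrev leftTip : Bool × Fin 3 := (false, 0)

/-- The tip by which a 3-sun in a chain is joined to the following one. -/
abbrev rightTip : Bool × Fin 3 := (false, 1)

theorem sunDist_comm : ∀ s t, sunDist s t = sunDist t s := by decide

theorem sunDist_self : ∀ s, sunDist s s = 0 := by decide

theorem sunDist_le_two : ∀ s t, sunDist s t ≤ 2 := by decide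

theorem sunDist_triangle : ∀ s t r, sunDist s r ≤ sunDist s t + sunDist t r := by decide

theorem eq_of_sunDist_eq_zero : ∀ s t, sunDist s t = 0 → s = t := by decide

theorem exists_sunDist_step :
    ∀ s t, s ≠ t → ∃ r, sunDist s r = 1 ∧ sunDist r t + 1 = sunDist s t := by decide

theorem exists_sunDist_le_one : ∀ s t, ∃ c, sunDist s c ≤ 1 ∧ sunDist t c ≤ 1 := by decide

set_option maxRecDepth 100000 in
set_option maxHeartbeats 4000000 in
theorem sunDist_four_point : ∀ p q r s, sunDist p q + sunDist r s ≤
    max (sunDist p r + sunDist q s) (sunDist p s + sunDist q r) + 1 := by decide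

/-- Distance in the chain of `n` 3-suns, in which the right tip of each sun is adjacent to the left
tip of the next one. -/
def chainDist {n : ℕ} (u v : Fin n × Bool × Fin 3) : ℕ :=
  if u.1 < v.1 then 3 * (v.1 - u.1 : ℕ) - 2 + sunDist u.2 rightTip + sunDist v.2 leftTip
  else if v.1 < u.1 then 3 * (u.1 - v.1 : ℕ) - 2 + sunDist v.2 rightTip + sunDist u.2 leftTip
  else sunDist u.2 v.2

section Chain

variable {n : ℕ}

theorem chainDist_of_lt {u v : Fin n × Bool × Fin 3} (h : u.1 < v.1) :
    chainDist u v = 3 * (v.1 - u.1 : ℕ) - 2 + sunDist u.2 rightTip + sunDist v.2 leftTip :=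
  if_pos h

theorem chainDist_of_eq {u v : Fin n × Bool × Fin 3} (h : u.1 = v.1) :
    chainDist u v = sunDist u.2 v.2 := by
  simp [chainDist, h]

theorem chainDist_mk_mk (i : Fin n) (s t : Bool × Fin 3) :
    chainDist (i, s) (i, t) = sunDist s t :=
  chainDist_of_eq rfl

theorem chainDist_comm (u v : Fin n × Bool × Fin 3) : chainDist u v = chainDist v u := by
  unfold chainDist
  rcases lt_trichotomy u.1 v.1 with h | h | h
  · rw [if_pos h, if_neg h.asymm, if_pos h]
  · simp [h, sunDist_comm]
  · rw [if_pos h, if_neg h.asymm, if_pos h]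

theorem chainDist_self (u : Fin n × Bool × Fin 3) : chainDist u u = 0 := by
  simp [chainDist_of_eq, sunDist_self]

theorem chainDist_triangle (u w v : Fin n × Bool × Fin 3) :
    chainDist u v ≤ chainDist u w + chainDist w v := by
  obtain ⟨i, s⟩ := u
  obtain ⟨j, r⟩ := w
  obtain ⟨k, t⟩ := v
  have h1 := sunDist_triangle s r t
  have h2 := sunDist_triangle s r rightTip
  have h3 := sunDist_triangle s r leftTip
  have h4 := sunDist_triangle t r rightTip
  have h5 := sunDist_triangle t r leftTip
  have h6 := sunDist_triangle s rightTip t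
  have h7 := sunDist_triangle s leftTip t
  have h8 := sunDist_comm leftTip t
  have h9 := sunDist_comm rightTip t
  have h10 := sunDist_comm t r
  have h11 := sunDist_comm leftTip r
  have h12 := sunDist_comm rightTip r
  have h13 := sunDist_triangle leftTip r rightTip
  have h14 : sunDist leftTip rightTip = 2 := by decide
  have h15 := sunDist_le_two s t
  have h16 := sunDist_le_two s leftTip
  have h17 := sunDist_le_two s rightTip
  have h18 := sunDist_le_two t leftTip
  have h19 := sunDist_le_two t rightTip
  simp only [chainDist, Fin.lt_def]
  split_ifs <;> omega

theorem exists_chainDist_step (u v : Fin n × Bool × Fin 3) (huv : u ≠ v) :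
    ∃ w, chainDist u w = 1 ∧ chainDist w v + 1 = chainDist u v := by
  obtain ⟨i, s⟩ := u
  obtain ⟨j, t⟩ := v
  rcases lt_trichotomy i j with hij | rfl | hij
  · by_cases hs : s = rightTip
    · subst hs
      have hij' : i.val < j.val := hij
      refine ⟨(⟨i + 1, by omega⟩, leftTip), ?_, ?_⟩
      · rw [chainDist_of_lt (by simp [Fin.lt_def])]
        simp [sunDist_self]
      · rw [chainDist_of_lt (u := (i, rightTip)) hij]
        have h1 := sunDist_comm leftTip t
        have h2 : sunDist leftTip rightTip = 2 := by decide
        have h3 := sunDist_self rightTip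
        simp only [chainDist, Fin.lt_def]
        split_ifs <;> omega
    · obtain ⟨r, h1, h2⟩ := exists_sunDist_step s rightTip hs
      refine ⟨(i, r), ?_, ?_⟩
      · rw [chainDist_mk_mk]
        exact h1
      · rw [chainDist_of_lt (u := (i, s)) hij, chainDist_of_lt (u := (i, r)) hij]
        simp only
        omega
  · obtain ⟨r, h1, h2⟩ := exists_sunDist_step s t (by rintro rfl; exact huv rfl)
    refine ⟨(i, r), ?_, ?_⟩
    · rw [chainDist_mk_mk]
      exact h1
    · rw [chainDist_mk_mk, chainDist_mk_mk]
      exact h2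
  · have hij' : j.val < i.val := hij
    by_cases hs : s = leftTip
    · subst hs
      refine ⟨(⟨i - 1, by omega⟩, rightTip), ?_, ?_⟩
      · rw [chainDist_comm, chainDist_of_lt (by simp only [Fin.lt_def]; omega)]
        simp only [sunDist_self]
        omega
      · rw [chainDist_comm (i, leftTip), chainDist_of_lt (v := (i, leftTip)) hij]
        have h1 := sunDist_comm rightTip t
        have h2 : sunDist rightTip leftTip = 2 := by decide
        have h3 := sunDist_self leftTip
        simp only [chainDist, Fin.lt_def]
        split_ifs <;> omega
    · obtain ⟨r, h1, h2⟩ := exists_sunDist_step s leftTip hs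
      refine ⟨(i, r), ?_, ?_⟩
      · rw [chainDist_mk_mk]
        exact h1
      · rw [chainDist_comm (i, s), chainDist_comm (i, r), chainDist_of_lt (v := (i, s)) hij,
          chainDist_of_lt (v := (i, r)) hij]
        simp only
        omega

theorem chainDist_four_point_of_le {u v w x : Fin n × Bool × Fin 3} (huv : u.1 ≤ v.1)
    (hvw : v.1 ≤ w.1) (hwx : w.1 ≤ x.1) :
    chainDist u v + chainDist w x ≤
        max (chainDist u w + chainDist v x) (chainDist u x + chainDist v w) + 1 ∧
      chainDist u w + chainDist v x ≤
        max (chainDist u v + chainDist w x) (chainDist u x + chainDist v w) + 1 ∧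
      chainDist u x + chainDist v w ≤
        max (chainDist u v + chainDist w x) (chainDist u w + chainDist v x) + 1 := by
  have hsun : ∀ p q r s, sunDist p q + sunDist r s ≤
        max (sunDist p r + sunDist q s) (sunDist p s + sunDist q r) + 1 ∧
      sunDist p r + sunDist q s ≤
        max (sunDist p q + sunDist r s) (sunDist p s + sunDist q r) + 1 ∧
      sunDist p s + sunDist q r ≤
        max (sunDist p q + sunDist r s) (sunDist p r + sunDist q s) + 1 := by
    intro p q r s
    have h1 := sunDist_four_point p q r s
    have h2 := sunDist_four_point p r q s
    have h3 := sunDist_four_point p s q r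
    have h4 := sunDist_comm r q
    have h5 := sunDist_comm s r
    have h6 := sunDist_comm s q
    omega
  obtain ⟨i, p⟩ := u
  obtain ⟨j, q⟩ := v
  obtain ⟨k, r⟩ := w
  obtain ⟨l, s⟩ := x
  simp only at huv hvw hwx
  have b1 := sunDist_le_two p q
  have b2 := sunDist_le_two r s
  have b3 := sunDist_le_two q leftTip
  have b4 := sunDist_le_two r rightTip
  have hLR : sunDist leftTip rightTip = 2 := by decide
  rcases huv.eq_or_lt with rfl | huv <;> rcases hvw.eq_or_lt with rfl | hvw <;>
    rcases hwx.eq_or_lt with rfl | hwx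
  · have := hsun p q r s
    simpa [chainDist] using this
  · have := hsun p q r rightTip
    simp only [chainDist, Fin.lt_def] at *
    split_ifs <;> omega
  · have h1 := sunDist_triangle p rightTip q
    have h2 := sunDist_comm q rightTip
    have h3 := sunDist_triangle r leftTip s
    have h4 := sunDist_comm s leftTip
    simp only [chainDist, Fin.lt_def] at *
    split_ifs <;> omega
  · have h1 := sunDist_triangle p rightTip q
    have h2 := sunDist_comm q rightTip
    simp only [chainDist, Fin.lt_def] at *
    split_ifs <;> omega
  · have := hsun leftTip q r s
    have h1 := sunDist_comm leftTip q
    have h2 := sunDist_comm leftTip r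
    have h3 := sunDist_comm leftTip s
    simp only [chainDist, Fin.lt_def] at *
    split_ifs <;> omega
  · have := hsun leftTip q r rightTip
    have h1 := sunDist_comm leftTip q
    have h2 := sunDist_comm leftTip r
    simp only [chainDist, Fin.lt_def] at *
    split_ifs <;> omega
  · have h3 := sunDist_triangle r leftTip s
    have h4 := sunDist_comm s leftTip
    simp only [chainDist, Fin.lt_def] at *
    split_ifs <;> omega
  · simp only [chainDist, Fin.lt_def] at *
    split_ifs <;> omega

theorem chainDist_four_point (u v w x : Fin n × Bool × Fin 3) :
    chainDist u v + chainDist w x ≤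
      max (chainDist u w + chainDist v x) (chainDist u x + chainDist v w) + 1 := by
  have c1 := chainDist_comm u v
  have c2 := chainDist_comm u w
  have c3 := chainDist_comm u x
  have c4 := chainDist_comm v w
  have c5 := chainDist_comm v x
  have c6 := chainDist_comm w x
  rcases le_total u.1 v.1 with h1 | h1 <;> rcases le_total u.1 w.1 with h2 | h2 <;>
    rcases le_total u.1 x.1 with h3 | h3 <;> rcases le_total v.1 w.1 with h4 | h4 <;>
    rcases le_total v.1 x.1 with h5 | h5 <;> rcases le_total w.1 x.1 with h6 | h6 <;>
    first
    | (have := chainDist_four_point_of_le h1 h4 h6; omega)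
    | (have := chainDist_four_point_of_le h1 h5 h6; omega)
    | (have := chainDist_four_point_of_le h2 h4 h5; omega)
    | (have := chainDist_four_point_of_le h2 h6 h5; omega)
    | (have := chainDist_four_point_of_le h3 h5 h4; omega)
    | (have := chainDist_four_point_of_le h3 h6 h4; omega)
    | (have := chainDist_four_point_of_le h1 h2 h6; omega)
    | (have := chainDist_four_point_of_le h1 h3 h6; omega)
    | (have := chainDist_four_point_of_le h4 h2 h3; omega)
    | (have := chainDist_four_point_of_le h4 h6 h3; omega)
    | (have := chainDist_four_point_of_le h5 h3 h2; omega)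
    | (have := chainDist_four_point_of_le h5 h6 h2; omega)
    | (have := chainDist_four_point_of_le h2 h1 h5; omega)
    | (have := chainDist_four_point_of_le h2 h3 h5; omega)
    | (have := chainDist_four_point_of_le h4 h1 h3; omega)
    | (have := chainDist_four_point_of_le h4 h5 h3; omega)
    | (have := chainDist_four_point_of_le h6 h3 h1; omega)
    | (have := chainDist_four_point_of_le h6 h5 h1; omega)
    | (have := chainDist_four_point_of_le h3 h1 h4; omega)
    | (have := chainDist_four_point_of_le h3 h2 h4; omega)
    | (have := chainDist_four_point_of_le h5 h1 h2; omega)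
    | (have := chainDist_four_point_of_le h5 h4 h2; omega)
    | (have := chainDist_four_point_of_le h6 h2 h1; omega)
    | (have := chainDist_four_point_of_le h6 h4 h1; omega)

variable (n) in
/-- The chain of `n` 3-suns. -/
def sunChain : SimpleGraph (Fin n × Bool × Fin 3) :=
  unitDistGraph chainDist chainDist_self chainDist_comm

theorem sunChain_dist (u v : Fin n × Bool × Fin 3) : (sunChain n).dist u v = chainDist u v :=
  unitDistGraph_dist _ _ _
    (fun u w v h => by have := chainDist_triangle u w v; omega) exists_chainDist_step u v

theorem sunChain_connected [NeZero n] : (sunChain n).Connected :=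
  unitDistGraph_connected _ _ _ exists_chainDist_step

theorem sunChain_isHyperbolic : IsHyperbolic (sunChain n) (1 / 2 : ℝ) := by
  intro u v w x
  simp only [sunChain_dist]
  have := chainDist_four_point u v w x
  norm_num only
  exact_mod_cast this

theorem multipackingNumber_sunChain_le : multipackingNumber (sunChain n) ≤ n := by
  refine csSup_le' ?_
  rintro _ ⟨M, hM, rfl⟩
  have hinj : Set.InjOn Prod.fst M := by
    rintro ⟨i, s⟩ hu ⟨j, t⟩ hv (rfl : i = j)
    by_contra hne
    obtain ⟨c, hs, ht⟩ := exists_sunDist_le_one s t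
    have hle := hM (i, c) 1 le_rfl
    have hsub : ({(i, s), (i, t)} : Set (Fin n × Bool × Fin 3)) ⊆
        M ∩ {u | (sunChain n).dist u (i, c) ≤ 1} := by
      rintro _ (rfl | rfl)
      · exact ⟨hu, by rw [Set.mem_ofPred_eq, sunChain_dist, chainDist_mk_mk]; exact hs⟩
      · exact ⟨hv, by rw [Set.mem_ofPred_eq, sunChain_dist, chainDist_mk_mk]; exact ht⟩
    have hcard := Set.ncard_le_ncard hsub (Set.toFinite _)
    rw [Set.ncard_pair hne] at hcard
    omega
  rw [← hinj.ncard_image]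
  exact (Set.ncard_le_card _).trans (by simp)

/-- The tips, indexed by their sun and their position in it, within distance `r` of `v`. -/
def tipsInBall (v : Fin n × Bool × Fin 3) (r : ℕ) : Finset (Fin n × Fin 3) :=
  Finset.univ.filter fun p => chainDist (p.1, false, p.2) v ≤ r

theorem card_tipsInBall_left (v : Fin n × Bool × Fin 3) (r : ℕ) :
    ((tipsInBall v r).filter fun p => p.1 < v.1).card ≤ r - sunDist v.2 leftTip := by
  have key : ∀ k : Fin 3, (k - 1).val ≤ sunDist (false, k) rightTip := by decide
  rw [← Nat.add_sub_cancel (r - sunDist v.2 leftTip) 1, ← Nat.card_Icc]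
  refine Finset.card_le_card_of_injOn (fun p => 3 * (v.1 - p.1 : ℕ) - 2 + (p.2 - 1).val) ?_ ?_
  · rintro ⟨j, k⟩ hp
    simp only [tipsInBall, Finset.coe_filter, Finset.mem_filter, Finset.mem_univ, true_and,
      Set.mem_ofPred_eq] at hp
    rw [chainDist_of_lt hp.2] at hp
    simp only [Fin.lt_def] at hp
    have := key k
    simp only [Finset.coe_Icc, Set.mem_Icc]
    omega
  · rintro ⟨j, k⟩ hp ⟨j', k'⟩ hp' h
    simp only [Finset.coe_filter, Set.mem_ofPred_eq, Fin.lt_def] at hp hp' h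
    have hk := (k - 1).isLt
    have hk' := (k' - 1).isLt
    have hkk : k - 1 = k' - 1 := Fin.ext (by omega)
    have hjj : j = j' := Fin.ext (by omega)
    rw [hjj, sub_left_inj.mp hkk]

theorem card_tipsInBall_right (v : Fin n × Bool × Fin 3) (r : ℕ) :
    ((tipsInBall v r).filter fun p => v.1 < p.1).card ≤ r - sunDist v.2 rightTip := by
  have key : ∀ k : Fin 3, k.val ≤ sunDist (false, k) leftTip := by decide
  rw [← Nat.add_sub_cancel (r - sunDist v.2 rightTip) 1, ← Nat.card_Icc]
  refine Finset.card_le_card_of_injOn (fun p => 3 * (p.1 - v.1 : ℕ) - 2 + p.2.val) ?_ ?_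
  · rintro ⟨j, k⟩ hp
    simp only [tipsInBall, Finset.coe_filter, Finset.mem_filter, Finset.mem_univ, true_and,
      Set.mem_ofPred_eq] at hp
    rw [chainDist_comm, chainDist_of_lt hp.2] at hp
    simp only [Fin.lt_def] at hp
    have := key k
    simp only [Finset.coe_Icc, Set.mem_Icc]
    omega
  · rintro ⟨j, k⟩ hp ⟨j', k'⟩ hp' h
    simp only [Finset.coe_filter, Set.mem_ofPred_eq, Fin.lt_def] at hp hp' h
    have hkk : k = k' := Fin.ext (by omega)
    have hjj : j = j' := Fin.ext (by omega)
    rw [hjj, hkk]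

theorem card_tipsInBall_same (v : Fin n × Bool × Fin 3) (r : ℕ) :
    ((tipsInBall v r).filter fun p => p.1 = v.1).card ≤
      (Finset.univ.filter fun k : Fin 3 => sunDist (false, k) v.2 ≤ r).card := by
  refine Finset.card_le_card_of_injOn Prod.snd ?_ ?_
  · rintro ⟨j, k⟩ hp
    simp only [tipsInBall, Finset.coe_filter, Finset.mem_filter, Finset.mem_univ, true_and,
      Set.mem_ofPred_eq] at hp ⊢
    rw [chainDist_of_eq hp.2] at hp
    exact hp.1
  · rintro ⟨j, k⟩ hp ⟨j', k'⟩ hp' h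
    simp only [Finset.coe_filter, Set.mem_ofPred_eq] at hp hp' h
    rw [hp.2, hp'.2, h]

theorem two_mul_card_tipsInBall_le (v : Fin n × Bool × Fin 3) {r : ℕ} (hr : 1 ≤ r) :
    2 * (tipsInBall v r).card ≤ 5 * r := by
  have hl := card_tipsInBall_left v r
  have hs := card_tipsInBall_same v r
  have hg := card_tipsInBall_right v r
  have hsplit : (tipsInBall v r).card ≤ ((tipsInBall v r).filter fun p => p.1 < v.1).card +
      ((tipsInBall v r).filter fun p => p.1 = v.1).card +
      ((tipsInBall v r).filter fun p => v.1 < p.1).card := by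
    refine le_trans (Finset.card_le_card fun p hp => ?_)
      ((Finset.card_union_le _ _).trans (Nat.add_le_add_right (Finset.card_union_le _ _) _))
    simp only [Finset.mem_union, Finset.mem_filter, hp, true_and]
    rcases lt_trichotomy p.1 v.1 with h | h | h <;> simp [h]
  rcases hr.eq_or_lt with rfl | hr
  · have key : ∀ s : Bool × Fin 3,
        (Finset.univ.filter fun k : Fin 3 => sunDist (false, k) s ≤ 1).card +
          (1 - sunDist s leftTip) + (1 - sunDist s rightTip) ≤ 2 := by decide
    have := key v.2
    omega
  · have h3 := (Finset.univ.filter fun k : Fin 3 => sunDist (false, k) v.2 ≤ r).card_le_univ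
    rw [Fintype.card_fin] at h3
    have key : ∀ s : Bool × Fin 3, 2 ≤ sunDist s leftTip + sunDist s rightTip := by decide
    have := key v.2
    have := sunDist_le_two v.2 leftTip
    have := sunDist_le_two v.2 rightTip
    omega

theorem six_mul_le_of_isDominatingBroadcast {f : Fin n × Bool × Fin 3 → ℕ}
    (hf : IsDominatingBroadcast (sunChain n) f) : 6 * n ≤ 5 * ∑ v, f v := by
  have hcover : (Finset.univ : Finset (Fin n × Fin 3)) ⊆
      (Finset.univ.filter fun v => 0 < f v).biUnion fun v => tipsInBall v (f v) := by
    intro p _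
    obtain ⟨v, hv, hd⟩ := hf.2 (p.1, false, p.2)
    rw [sunChain_dist] at hd
    simp only [Finset.mem_biUnion, Finset.mem_filter, Finset.mem_univ, true_and, tipsInBall]
    exact ⟨v, hv, hd⟩
  have hcard := (Finset.card_le_card hcover).trans Finset.card_biUnion_le
  rw [Finset.card_univ, Fintype.card_prod, Fintype.card_fin, Fintype.card_fin] at hcard
  have hsum : ∑ v ∈ Finset.univ.filter (fun v => 0 < f v), 2 * (tipsInBall v (f v)).card ≤
      ∑ v, 5 * f v :=
    (Finset.sum_le_sum fun v hv =>
        two_mul_card_tipsInBall_le v (Finset.mem_filter.mp hv).2).trans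
      (Finset.sum_le_sum_of_subset (Finset.filter_subset _ _))
  rw [← Finset.mul_sum, ← Finset.mul_sum] at hsum
  omega

end Chain

theorem exists_isDominatingBroadcast {V : Type*} [Finite V] [Nontrivial V] {G : SimpleGraph V}
    (hG : G.Connected) : ∃ f, IsDominatingBroadcast G f := by
  obtain ⟨a, b, hab⟩ := exists_pair_ne V
  have hpos : 0 < gDiam G :=
    (hG.pos_dist_of_ne hab).trans_le
      (le_csSup (Set.finite_range _).bddAbove (Set.mem_range_self (a, b)))
  exact ⟨fun _ => gDiam G, fun _ => le_rfl, fun u => ⟨u, hpos, by simp⟩⟩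

/-- For every natural number N, there exists a finite connected
(1/2)-hyperbolic graph G with γ_b(G) − MP(G) ≥ N. -/
theorem stmt12 (N : ℕ) :
    ∃ (V : Type) (G : SimpleGraph V), Finite V ∧ G.Connected ∧
      IsHyperbolic G (1 / 2 : ℝ) ∧
      multipackingNumber G + N ≤ broadcastDominationNumber G := by
  refine ⟨_, sunChain (5 * N + 1), inferInstance, sunChain_connected, sunChain_isHyperbolic, ?_⟩
  refine (Nat.add_le_add_right multipackingNumber_sunChain_le N).trans (le_csInf ?_ ?_)
  · obtain ⟨f, hf⟩ := exists_isDominatingBroadcast (sunChain_connected (n := 5 * N + 1))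
    exact ⟨_, f, hf, rfl⟩
  · rintro _ ⟨f, hf, rfl⟩
    rw [finsum_eq_sum_of_fintype]
    have := six_mul_le_of_isDominatingBroadcast hf
    omega
end

section
/- MMP(2) = 6. That is: every set P of 6 points in ℝ² with pairwise distinct distances admits a multipacking of size at least 2, and there exists a set P of 5 points in ℝ² with pairwise distinct distances that admits no multipacking of size 2. -/
variable {E : Type*} [MetricSpace E]

/-- All pairwise distances between points of `P` are distinct: two pairs of distinct
points at equal distance must be the same (unordered) pair. -/
def DistinctDistances (P : Finset E) : Prop :=
  ∀ p ∈ P, ∀ q ∈ P, ∀ r ∈ P, ∀ s ∈ P, p ≠ q → r ≠ s →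
    dist p q = dist r s → ({p, q} : Set E) = {r, s}

/-- `nbhd P v r` is `N_r[v]`: the set consisting of `v` together with the `r`
points of `P` nearest to `v`. A point `u ∈ P` belongs to it iff at most `r + 1`
points of `P` (including `v` itself) are at distance at most `dist v u` from `v`. -/
def nbhd (P : Finset E) (v : E) (r : ℕ) : Set E :=
  {u | u ∈ P ∧ ({b | b ∈ P ∧ dist v b ≤ dist v u}).ncard ≤ r + 1}

/-- A multipacking of a point set `P`: a subset `M ⊆ P` with
`|N_r[v] ∩ M| ≤ (r+1)/2` for all `v ∈ P` and all integers `r ≥ 1`. -/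
def IsGeoMultipacking (P : Finset E) (M : Set E) : Prop :=
  M ⊆ ↑P ∧ ∀ v ∈ P, ∀ r : ℕ, 1 ≤ r →
    ((nbhd P v r ∩ M).ncard : ℚ) ≤ ((r : ℚ) + 1) / 2

/-- The multipacking number of a point set `P`: the maximum size of a multipacking. -/
noncomputable def geoMultipackingNumber (P : Finset E) : ℕ :=
  sSup {m | ∃ M : Set E, IsGeoMultipacking P M ∧ M.ncard = m}

/-- A dominating broadcast on a point set `P`: a function `f : P → {0, …, n−1}`
(extended by `0` off `P`) such that every `u ∈ P` lies in `N_{f v}[v]` for some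
`v ∈ P` with `f v > 0`. -/
def IsGeoDominatingBroadcast (P : Finset E) (f : E → ℕ) : Prop :=
  (∀ v : E, v ∉ P → f v = 0) ∧ (∀ v ∈ P, f v ≤ P.card - 1) ∧
    ∀ u ∈ P, ∃ v ∈ P, 0 < f v ∧ u ∈ nbhd P v (f v)

/-- The broadcast domination number of a point set `P`: the minimum cost of a
dominating broadcast on `P`. -/
noncomputable def geoBroadcastDominationNumber (P : Finset E) : ℕ :=
  sInf {c | ∃ f : E → ℕ, IsGeoDominatingBroadcast P f ∧ ∑ v ∈ P, f v = c}

lemma exists_eq_triple {α : Type*} [DecidableEq α] {s : Finset α} (hs : s.card = 3) {x y : α}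
    (hx : x ∈ s) (hy : y ∈ s) (hxy : x ≠ y) : ∃ z, z ≠ x ∧ z ≠ y ∧ s = {x, y, z} := by
  have hy' : y ∈ s.erase x := Finset.mem_erase.2 ⟨hxy.symm, hy⟩
  obtain ⟨z, hz⟩ : ∃ z, (s.erase x).erase y = {z} := by
    rw [← Finset.card_eq_one, Finset.card_erase_of_mem hy', Finset.card_erase_of_mem hx, hs]
  have hzm : z ∈ (s.erase x).erase y := by simp [hz]
  simp only [Finset.mem_erase] at hzm
  refine ⟨z, hzm.2.1, hzm.1, ?_⟩
  rw [← hz, Finset.insert_erase hy', Finset.insert_erase hx]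

/-- In a family of triples `T v ∋ v`, indexed by six points and covering all pairs, every point
lies in exactly three triples. -/
lemma card_filter_mem_eq_three {α : Type*} [DecidableEq α] {P : Finset α} (hP : P.card = 6)
    {T : α → Finset α} (hTP : ∀ v ∈ P, T v ⊆ P) (hcard : ∀ v ∈ P, (T v).card = 3)
    (hcov : ∀ u ∈ P, ∀ w ∈ P, u ≠ w → ∃ v ∈ P, u ∈ T v ∧ w ∈ T v) :
    ∀ u ∈ P, (P.filter (fun v => u ∈ T v)).card = 3 := by
  have hge : ∀ u ∈ P, 3 ≤ (P.filter (fun v => u ∈ T v)).card := by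
    intro u hu
    have hsub : P.erase u ⊆ (P.filter (fun v => u ∈ T v)).biUnion (fun v => (T v).erase u) := by
      intro w hw
      rw [Finset.mem_erase] at hw
      obtain ⟨v, hv, huv, hwv⟩ := hcov u hu w hw.2 hw.1.symm
      simp only [Finset.mem_biUnion, Finset.mem_filter, Finset.mem_erase]
      exact ⟨v, ⟨hv, huv⟩, hw.1, hwv⟩
    have h1 := Finset.card_le_card hsub
    have h2 := Finset.card_biUnion_le_card_mul (P.filter (fun v => u ∈ T v))
      (fun v => (T v).erase u) 2 (by
        intro v hv
        rw [Finset.mem_filter] at hv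
        rw [Finset.card_erase_of_mem hv.2, hcard v hv.1])
    rw [Finset.card_erase_of_mem hu, hP] at h1
    omega
  have hsum : ∑ u ∈ P, (P.filter (fun v => u ∈ T v)).card = ∑ u ∈ P, 3 := by
    have := Finset.sum_card_bipartiteAbove_eq_sum_card_bipartiteBelow
      (s := P) (t := P) (fun u v => u ∈ T v)
    simp only [Finset.bipartiteAbove, Finset.bipartiteBelow] at this
    rw [this]
    refine Finset.sum_congr rfl fun v hv => ?_
    rw [Finset.filter_mem_eq_inter, Finset.inter_eq_right.2 (hTP v hv), hcard v hv]
  intro u hu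
  exact ((Finset.sum_eq_sum_iff_of_le hge).1 hsum.symm u hu).symm

/-- On six points, the triples formed by a point and its two nearest points never cover all
pairs. -/
lemma not_covering_of_nearest [DecidableEq E] {P : Finset E}
    (hP : P.card = 6) {T : E → Finset E} (hTP : ∀ v ∈ P, T v ⊆ P) (hself : ∀ v ∈ P, v ∈ T v)
    (hcard : ∀ v ∈ P, (T v).card = 3)
    (hlt : ∀ v ∈ P, ∀ x ∈ T v, ∀ z ∈ P, z ∉ T v → dist v x < dist v z) :
    ¬ ∀ u ∈ P, ∀ w ∈ P, u ≠ w → ∃ v ∈ P, u ∈ T v ∧ w ∈ T v := by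
  intro hcov
  have hdeg := card_filter_mem_eq_three hP hTP hcard hcov
  have hoff : P.offDiag.Nonempty := by
    rw [← Finset.card_pos, Finset.offDiag_card, hP]; norm_num
  obtain ⟨⟨a, b⟩, hab, hmin⟩ := P.offDiag.exists_min_image (fun p => dist p.1 p.2) hoff
  simp only [Finset.mem_offDiag] at hab
  obtain ⟨ha, hb, hab⟩ := hab
  have hclose : ∀ u ∈ P, ∀ w ∈ P, dist u w = dist a b → w ∈ T u := by
    intro u hu w hw h
    by_contra hwu
    obtain ⟨x, hx, hxu⟩ := Finset.exists_mem_ne (by rw [hcard u hu]; norm_num) u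
    have h1 := hlt u hu x hx w hw hwu
    have h2 := hmin (u, x) (Finset.mem_offDiag.2 ⟨hu, hTP u hu hx, hxu.symm⟩)
    simp only at h2
    linarith
  have hbTa : b ∈ T a := hclose a ha b hb rfl
  have haTb : a ∈ T b := hclose b hb a ha (dist_comm _ _)
  -- the triples containing a given point, once two of them are known
  have hthird : ∀ u ∈ P, ∀ p ∈ P, u ∈ T p → u ≠ p → ∃ q ∈ P, q ≠ u ∧ q ≠ p ∧ u ∈ T q ∧
      ∀ w ∈ P, w ∈ T u ∨ w ∈ T p ∨ w ∈ T q := by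
    intro u hu p hp hup hne
    obtain ⟨q, hqu, hqp, hq⟩ := exists_eq_triple (hdeg u hu)
      (Finset.mem_filter.2 ⟨hu, hself u hu⟩) (Finset.mem_filter.2 ⟨hp, hup⟩) hne
    have hqm : q ∈ P.filter (fun v => u ∈ T v) := by rw [hq]; simp
    rw [Finset.mem_filter] at hqm
    refine ⟨q, hqm.1, hqu, hqp, hqm.2, fun w hw => ?_⟩
    by_cases hwu : w = u
    · exact Or.inl (hwu ▸ hself u hu)
    obtain ⟨v, hv, huv, hwv⟩ := hcov u hu w hw (Ne.symm hwu)
    have : v ∈ P.filter (fun v => u ∈ T v) := Finset.mem_filter.2 ⟨hv, huv⟩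
    rw [hq] at this
    simp only [Finset.mem_insert, Finset.mem_singleton] at this
    rcases this with rfl | rfl | rfl <;> simp [hwv]
  obtain ⟨c, hca, hcb, hTa⟩ := exists_eq_triple (hcard a ha) (hself a ha) hbTa hab
  obtain ⟨d, hda, hdb, hTb⟩ := exists_eq_triple (hcard b hb) haTb (hself b hb) hab
  obtain ⟨i, hi, hia, hib, haTi, hcovi⟩ := hthird a ha b hb haTb hab
  obtain ⟨j, hj, hjb, hja, hbTj, hcovj⟩ := hthird b hb a ha hbTa hab.symm
  have hc : c ∈ P := hTP a ha (by simp [hTa])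
  have hd : d ∈ P := hTP b hb (by simp [hTb])
  -- the points outside the triples of `a` and `b`
  have hR2 : 2 ≤ (P \ {a, b, c, d}).card := by
    have h1 := Finset.le_card_sdiff {a, b, c, d} P
    have h2 := Finset.card_le_four (a := a) (b := b) (c := c) (d := d)
    omega
  have hRi : P \ {a, b, c, d} ⊆ (T i).erase a := by
    intro w hw
    simp only [Finset.mem_sdiff, Finset.mem_insert, Finset.mem_singleton, not_or] at hw
    obtain ⟨hwP, hwa, hwb, hwc, hwd⟩ := hw
    have := hcovi w hwP
    simp only [hTa, hTb, Finset.mem_insert, Finset.mem_singleton, hwa, hwb, hwc, hwd,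
      false_or] at this
    exact Finset.mem_erase.2 ⟨hwa, this⟩
  have hRj : P \ {a, b, c, d} ⊆ (T j).erase b := by
    intro w hw
    simp only [Finset.mem_sdiff, Finset.mem_insert, Finset.mem_singleton, not_or] at hw
    obtain ⟨hwP, hwa, hwb, hwc, hwd⟩ := hw
    have := hcovj w hwP
    simp only [hTa, hTb, Finset.mem_insert, Finset.mem_singleton, hwa, hwb, hwc, hwd,
      false_or] at this
    exact Finset.mem_erase.2 ⟨hwb, this⟩
  have hRi' : P \ {a, b, c, d} = (T i).erase a := Finset.eq_of_subset_of_card_le hRi (by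
    rw [Finset.card_erase_of_mem haTi, hcard i hi]; exact hR2)
  have hRj' : P \ {a, b, c, d} = (T j).erase b := Finset.eq_of_subset_of_card_le hRj (by
    rw [Finset.card_erase_of_mem hbTj, hcard j hj]; exact hR2)
  have hiR : i ∈ P \ {a, b, c, d} := by
    rw [hRi']; exact Finset.mem_erase.2 ⟨hia, hself i hi⟩
  have hjR : j ∈ P \ {a, b, c, d} := by
    rw [hRj']; exact Finset.mem_erase.2 ⟨hjb, hself j hj⟩
  have hbTi : b ∉ T i := by
    intro h
    have : b ∈ P \ {a, b, c, d} := by rw [hRi']; exact Finset.mem_erase.2 ⟨hab.symm, h⟩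
    simp at this
  have hij : i ≠ j := by rintro rfl; exact hbTi hbTj
  have hjTi : j ∈ T i := by rw [hRi'] at hjR; exact Finset.mem_of_mem_erase hjR
  have hiTj : i ∈ T j := by rw [hRj'] at hiR; exact Finset.mem_of_mem_erase hiR
  simp only [Finset.mem_sdiff, Finset.mem_insert, Finset.mem_singleton, not_or] at hiR hjR
  obtain ⟨-, -, -, hic, hid⟩ := hiR
  obtain ⟨-, -, -, hjc, hjd⟩ := hjR
  have hTi : T i = {i, j, a} := by
    obtain ⟨z, -, -, hz⟩ := exists_eq_triple (hcard i hi) (hself i hi) hjTi hij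
    rw [hz] at haTi
    simp only [Finset.mem_insert, Finset.mem_singleton, Ne.symm hia, Ne.symm hja, false_or] at haTi
    rw [hz, haTi]
  have hTj : T j = {j, i, b} := by
    obtain ⟨z, -, -, hz⟩ := exists_eq_triple (hcard j hj) (hself j hj) hiTj hij.symm
    rw [hz] at hbTj
    simp only [Finset.mem_insert, Finset.mem_singleton, Ne.symm hib, Ne.symm hjb, false_or] at hbTj
    rw [hz, hbTj]
  have hcd : c ≠ d := by
    rintro rfl
    have h1 : P ⊆ {a, b, c, i, j} := by
      intro w hw
      have := hcovi w hw
      simp only [hTa, hTb, hTi, Finset.mem_insert, Finset.mem_singleton] at this ⊢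
      rcases this with (h | h | h) | (h | h | h) | h | h | h <;> simp [h]
    have h2 := Finset.card_le_card h1
    have h3 := Finset.card_le_five (a := a) (b := b) (c := c) (d := i) (e := j)
    omega
  obtain ⟨k, hk, hki, hkj, hiTk, hcovk⟩ := hthird i hi j hj hiTj hij
  obtain ⟨l, hl, hlj, hli, hjTl, hcovl⟩ := hthird j hj i hi hjTi hij.symm
  have hcTk : c ∈ T k := by
    have := hcovk c hc
    simpa [hTi, hTj, Ne.symm hic, Ne.symm hjc, hca, hcb] using this
  have hdTk : d ∈ T k := by
    have := hcovk d hd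
    simpa [hTi, hTj, Ne.symm hid, Ne.symm hjd, hda, hdb] using this
  have hcTl : c ∈ T l := by
    have := hcovl c hc
    simpa [hTi, hTj, Ne.symm hic, Ne.symm hjc, hca, hcb] using this
  have hdTl : d ∈ T l := by
    have := hcovl d hd
    simpa [hTi, hTj, Ne.symm hid, Ne.symm hjd, hda, hdb] using this
  have hTk : T k = {c, d, i} := by
    obtain ⟨z, -, -, hz⟩ := exists_eq_triple (hcard k hk) hcTk hdTk hcd
    rw [hz] at hiTk
    simp only [Finset.mem_insert, Finset.mem_singleton, hic, hid, false_or] at hiTk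
    rw [hz, hiTk]
  have hTl : T l = {c, d, j} := by
    obtain ⟨z, -, -, hz⟩ := exists_eq_triple (hcard l hl) hcTl hdTl hcd
    rw [hz] at hjTl
    simp only [Finset.mem_insert, Finset.mem_singleton, hjc, hjd, false_or] at hjTl
    rw [hz, hjTl]
  have hk' : k = c ∨ k = d := by
    have := hself k hk
    simpa [hTk, hki] using this
  have hl' : l = c ∨ l = d := by
    have := hself l hl
    simpa [hTl, hlj] using this
  have hkl : k ≠ l := by
    rintro rfl
    rw [hTk] at hTl
    have : i ∈ ({c, d, j} : Finset E) := by rw [← hTl]; simp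
    simp [hic, hid, hij] at this
  have hai : dist a c < dist a i := hlt a ha c (by simp [hTa]) i hi (by
    simp [hTa, hia, hib, hic])
  rcases hk' with rfl | rfl
  · have h1 : dist k i < dist k a := hlt k hk i hiTk a ha (by
      simp [hTk, Ne.symm hca, Ne.symm hda, Ne.symm hia])
    have h2 : dist i a < dist i k := hlt i hi a haTi k hk (by
      simp [hTi, hki, hkj, hca])
    rw [dist_comm k i, dist_comm k a] at h1
    rw [dist_comm i a] at h2
    linarith
  · have hlc : l = c := hl'.resolve_right hkl.symm
    subst hlc
    have h1 : dist j b < dist j l := hlt j hj b hbTj l hl (by simp [hTj, hlj, hli, hcb])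
    have h2 : dist l j < dist l a := hlt l hl j hjTl a ha (by
      simp [hTl, Ne.symm hca, Ne.symm hda, Ne.symm hja])
    have h3 : dist i a < dist i k := hlt i hi a haTi k hk (by simp [hTi, hki, hkj, hda])
    have h4 : dist k i < dist k b := hlt k hk i hiTk b hb (by
      simp [hTk, Ne.symm hcb, Ne.symm hdb, Ne.symm hib])
    have h5 : dist b k < dist b j := hlt b hb k (by simp [hTb]) j hj (by
      simp [hTb, hja, hjb, hjd])
    rw [dist_comm j b, dist_comm j l] at h1
    rw [dist_comm l a] at h2
    rw [dist_comm i a, dist_comm i k] at h3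
    rw [dist_comm k b] at h4
    linarith

/-- The triple formed by a point and its two nearest points contains `N_2[v]`. -/
lemma exists_nearest_triple [DecidableEq E] {P : Finset E}
    (hD : DistinctDistances P) (hP : 3 ≤ P.card) {v : E} (hv : v ∈ P) :
    ∃ T ⊆ P, v ∈ T ∧ T.card = 3 ∧ (∀ x ∈ T, ∀ z ∈ P, z ∉ T → dist v x < dist v z) ∧
      nbhd P v 2 ⊆ T := by
  have hc1 : (P.erase v).card = P.card - 1 := Finset.card_erase_of_mem hv
  obtain ⟨x, hx, hxmin⟩ := (P.erase v).exists_min_image (dist v)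
    (Finset.card_pos.1 (by omega))
  have hc2 : ((P.erase v).erase x).card = P.card - 2 := by
    rw [Finset.card_erase_of_mem hx]; omega
  obtain ⟨y, hy, hymin⟩ := ((P.erase v).erase x).exists_min_image (dist v)
    (Finset.card_pos.1 (by omega))
  simp only [Finset.mem_erase] at hx hy hxmin hymin
  obtain ⟨hxv, hxP⟩ := hx
  obtain ⟨hyx, hyv, hyP⟩ := hy
  have hT3 : ({v, x, y} : Finset E).card = 3 :=
    Finset.card_eq_three.2 ⟨v, x, y, hxv.symm, hyv.symm, hyx.symm, rfl⟩
  have hlt : ∀ u ∈ ({v, x, y} : Finset E), ∀ z ∈ P, z ∉ ({v, x, y} : Finset E) →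
      dist v u < dist v z := by
    intro u hu z hz hzT
    simp only [Finset.mem_insert, Finset.mem_singleton, not_or] at hu hzT
    obtain ⟨hzv, hzx, hzy⟩ := hzT
    have hstrict : ∀ w ∈ P, w ≠ v → w ≠ z → dist v w ≤ dist v z → dist v w < dist v z := by
      intro w hw hwv hwz hle
      refine lt_of_le_of_ne hle fun h => ?_
      have := hD v hv w hw v hv z hz hwv.symm (Ne.symm hzv) h
      have hmem : w ∈ ({v, z} : Set E) := by rw [← this]; simp
      simp [hwv, hwz] at hmem
    rcases hu with rfl | rfl | rfl
    · simpa using Ne.symm hzv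
    · exact hstrict u hxP hxv (Ne.symm hzx) (hxmin z ⟨hzv, hz⟩)
    · exact hstrict u hyP hyv (Ne.symm hzy) (hymin z ⟨hzx, hzv, hz⟩)
  refine ⟨{v, x, y}, ?_, by simp, hT3, hlt, ?_⟩
  · intro z hz
    simp only [Finset.mem_insert, Finset.mem_singleton] at hz
    rcases hz with rfl | rfl | rfl <;> assumption
  · rintro u ⟨hu, hcount⟩
    by_contra huT
    rw [Finset.mem_coe] at huT
    have hsub : ((insert u {v, x, y} : Finset E) : Set E) ⊆
        {b | b ∈ P ∧ dist v b ≤ dist v u} := by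
      intro z hz
      rw [Finset.mem_coe, Finset.mem_insert] at hz
      rcases hz with rfl | hz
      · exact ⟨hu, le_rfl⟩
      · refine ⟨?_, (hlt z hz u hu huT).le⟩
        simp only [Finset.mem_insert, Finset.mem_singleton] at hz
        rcases hz with rfl | rfl | rfl <;> assumption
    have := Set.ncard_le_ncard hsub (P.finite_toSet.subset fun b hb => hb.1)
    rw [Set.ncard_coe_finset, Finset.card_insert_of_notMem huT, hT3] at this
    omega

lemma nbhd_mono (P : Finset E) (v : E) {r s : ℕ} (h : r ≤ s) :
    nbhd P v r ⊆ nbhd P v s :=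
  fun _ hu => ⟨hu.1, hu.2.trans (by omega)⟩

lemma isGeoMultipacking_pair {P : Finset E} {u w : E} (hu : u ∈ P)
    (hw : w ∈ P) (h : ∀ v ∈ P, u ∈ nbhd P v 2 → w ∉ nbhd P v 2) :
    IsGeoMultipacking P {u, w} := by
  refine ⟨by simp [Set.insert_subset_iff, hu, hw], fun v hv r hr => ?_⟩
  have hle2 : (nbhd P v r ∩ {u, w}).ncard ≤ 2 :=
    (Set.ncard_le_ncard Set.inter_subset_right (Set.toFinite _)).trans
      ((Set.ncard_insert_le u {w}).trans (by rw [Set.ncard_singleton]))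
  have hr' : (1 : ℚ) ≤ r := by exact_mod_cast hr
  rcases le_or_gt 3 r with h3 | h3
  · have h3' : (3 : ℚ) ≤ r := by exact_mod_cast h3
    have : ((nbhd P v r ∩ {u, w}).ncard : ℚ) ≤ 2 := by exact_mod_cast hle2
    linarith
  · have hmono := nbhd_mono P v (show r ≤ 2 by omega)
    have hle1 : (nbhd P v r ∩ {u, w}).ncard ≤ 1 := by
      rw [Set.ncard_le_one (Set.toFinite _)]
      rintro x ⟨hx, hx'⟩ y ⟨hy, hy'⟩
      rcases hx' with rfl | rfl <;> rcases hy' with rfl | rfl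
      · rfl
      · exact absurd (hmono hy) (h v hv (hmono hx))
      · exact absurd (hmono hx) (h v hv (hmono hy))
      · rfl
    have : ((nbhd P v r ∩ {u, w}).ncard : ℚ) ≤ 1 := by exact_mod_cast hle1
    linarith

lemma IsGeoMultipacking.ncard_le_geoMultipackingNumber
    {P : Finset E} {M : Set E} (h : IsGeoMultipacking P M) :
    M.ncard ≤ geoMultipackingNumber P := by
  refine le_csSup ⟨P.card, ?_⟩ ⟨M, h, rfl⟩
  rintro _ ⟨M', hM', rfl⟩
  rw [← Set.ncard_coe_finset]
  exact Set.ncard_le_ncard hM'.1 P.finite_toSet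

theorem two_le_geoMultipackingNumber {P : Finset E}
    (hP : P.card = 6) (hD : DistinctDistances P) : 2 ≤ geoMultipackingNumber P := by
  classical
  have hex : ∀ v : E, ∃ T : Finset E, v ∈ P → T ⊆ P ∧ v ∈ T ∧ T.card = 3 ∧
      (∀ x ∈ T, ∀ z ∈ P, z ∉ T → dist v x < dist v z) ∧ nbhd P v 2 ⊆ T := by
    intro v
    by_cases hv : v ∈ P
    · obtain ⟨T, hT⟩ := exists_nearest_triple hD (by omega) hv
      exact ⟨T, fun _ => hT⟩
    · exact ⟨∅, fun h => absurd h hv⟩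
  choose T hT using hex
  have hnot := not_covering_of_nearest hP (fun v hv => (hT v hv).1) (fun v hv => (hT v hv).2.1)
    (fun v hv => (hT v hv).2.2.1) (fun v hv => (hT v hv).2.2.2.1)
  push Not at hnot
  obtain ⟨u, hu, w, hw, huw, hcov⟩ := hnot
  rw [← Set.ncard_pair huw]
  exact (isGeoMultipacking_pair hu hw fun v hv h1 h2 =>
    hcov v hv ((hT v hv).2.2.2.2 h1) ((hT v hv).2.2.2.2 h2)).ncard_le_geoMultipackingNumber

/-- If every pair of points lies in some `N_2[v]`, there is no multipacking of size two. -/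
lemma not_exists_isGeoMultipacking_ncard_two {P : Finset E}
    (h : ∀ u ∈ P, ∀ w ∈ P, u ≠ w → ∃ v ∈ P, u ∈ nbhd P v 2 ∧ w ∈ nbhd P v 2) :
    ¬∃ M : Set E, IsGeoMultipacking P M ∧ M.ncard = 2 := by
  rintro ⟨M, ⟨hMP, hM⟩, hcard⟩
  obtain ⟨u, w, huw, rfl⟩ := Set.ncard_eq_two.1 hcard
  obtain ⟨v, hv, hu, hw⟩ := h u (hMP (by simp)) w (hMP (by simp)) huw
  have := hM v hv 2 (by norm_num)
  rw [Set.inter_eq_right.2 (Set.insert_subset hu (Set.singleton_subset_iff.2 hw)), hcard] at this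
  norm_num at this

/-- Integer coordinates of five points without a multipacking of size two. -/
def fiveCoord : Fin 5 → ℤ × ℤ := ![(0, 5), (1, 0), (4, 5), (0, 3), (4, 2)]

/-- Squared distances between the five points. -/
def fiveSqDist (i j : Fin 5) : ℤ :=
  ((fiveCoord i).1 - (fiveCoord j).1) ^ 2 + ((fiveCoord i).2 - (fiveCoord j).2) ^ 2

/-- The five points in the Euclidean plane. -/
noncomputable def fivePoint (i : Fin 5) : EuclideanSpace ℝ (Fin 2) :=
  !₂[((fiveCoord i).1 : ℝ), ((fiveCoord i).2 : ℝ)]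

lemma dist_fivePoint (i j : Fin 5) :
    dist (fivePoint i) (fivePoint j) = √(fiveSqDist i j : ℝ) := by
  simp [EuclideanSpace.dist_eq, Fin.sum_univ_two, fivePoint, fiveSqDist, Real.dist_eq, sq_abs]

lemma fiveSqDist_nonneg (i j : Fin 5) : (0 : ℝ) ≤ fiveSqDist i j := by
  have : 0 ≤ fiveSqDist i j := by unfold fiveSqDist; positivity
  exact_mod_cast this

lemma dist_fivePoint_le_iff (i j k l : Fin 5) :
    dist (fivePoint i) (fivePoint j) ≤ dist (fivePoint k) (fivePoint l) ↔
      fiveSqDist i j ≤ fiveSqDist k l := by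
  rw [dist_fivePoint, dist_fivePoint, Real.sqrt_le_sqrt_iff (fiveSqDist_nonneg k l)]
  exact Int.cast_le

lemma fivePoint_injective : Function.Injective fivePoint := by
  have key : ∀ i j, fiveSqDist i j ≤ fiveSqDist i i → i = j := by decide
  intro i j h
  exact key i j ((dist_fivePoint_le_iff i j i i).1 (by rw [h]))

/-- The five points as a finite set. -/
noncomputable def fivePoints : Finset (EuclideanSpace ℝ (Fin 2)) :=
  Finset.univ.map ⟨fivePoint, fivePoint_injective⟩

lemma mem_fivePoints {p : EuclideanSpace ℝ (Fin 2)} :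
    p ∈ fivePoints ↔ ∃ i, fivePoint i = p := by
  simp [fivePoints]

lemma distinctDistances_fivePoints : DistinctDistances fivePoints := by
  have key : ∀ i j k l, i ≠ j → k ≠ l → fiveSqDist i j = fiveSqDist k l →
      (i = k ∧ j = l) ∨ (i = l ∧ j = k) := by decide
  intro p hp q hq r hr s hs hpq hrs h
  obtain ⟨i, rfl⟩ := mem_fivePoints.1 hp
  obtain ⟨j, rfl⟩ := mem_fivePoints.1 hq
  obtain ⟨k, rfl⟩ := mem_fivePoints.1 hr
  obtain ⟨l, rfl⟩ := mem_fivePoints.1 hs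
  have heq : fiveSqDist i j = fiveSqDist k l :=
    le_antisymm ((dist_fivePoint_le_iff i j k l).1 h.le) ((dist_fivePoint_le_iff k l i j).1 h.ge)
  rcases key i j k l (fun e => hpq (e ▸ rfl)) (fun e => hrs (e ▸ rfl)) heq with
    ⟨rfl, rfl⟩ | ⟨rfl, rfl⟩
  · rfl
  · exact Set.pair_comm _ _

lemma fivePoint_mem_nbhd {i j : Fin 5}
    (h : (Finset.univ.filter fun k => fiveSqDist i k ≤ fiveSqDist i j).card ≤ 3) :
    fivePoint j ∈ nbhd fivePoints (fivePoint i) 2 := by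
  refine ⟨mem_fivePoints.2 ⟨j, rfl⟩, ?_⟩
  have : {b | b ∈ fivePoints ∧ dist (fivePoint i) b ≤ dist (fivePoint i) (fivePoint j)} =
      fivePoint '' (Finset.univ.filter fun k => fiveSqDist i k ≤ fiveSqDist i j : Finset _) := by
    ext b
    simp only [Set.mem_ofPred_eq, mem_fivePoints, Set.mem_image, Finset.coe_filter,
      Finset.mem_univ, true_and]
    constructor
    · rintro ⟨⟨k, rfl⟩, hk⟩
      exact ⟨k, (dist_fivePoint_le_iff i k i j).1 hk, rfl⟩
    · rintro ⟨k, hk, rfl⟩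
      exact ⟨⟨k, rfl⟩, (dist_fivePoint_le_iff i k i j).2 hk⟩
  rw [this, Set.ncard_image_of_injective _ fivePoint_injective, Set.ncard_coe_finset]
  exact h

/-- MMP(2) = 6: every 6-point set in ℝ² with pairwise distinct
distances has a multipacking of size at least 2, and some 5-point set in ℝ² with
pairwise distinct distances admits no multipacking of size 2. -/
theorem stmt15 :
    (∀ P : Finset (EuclideanSpace ℝ (Fin 2)), P.card = 6 → DistinctDistances P →
      2 ≤ geoMultipackingNumber P) ∧
    (∃ P : Finset (EuclideanSpace ℝ (Fin 2)), P.card = 5 ∧ DistinctDistances P ∧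
      ¬∃ M : Set (EuclideanSpace ℝ (Fin 2)), IsGeoMultipacking P M ∧ M.ncard = 2) := by
  refine ⟨fun P hP hD => two_le_geoMultipackingNumber hP hD, fivePoints, by simp [fivePoints],
    distinctDistances_fivePoints, not_exists_isGeoMultipacking_ncard_two ?_⟩
  have key : ∀ j k, j ≠ k → ∃ i,
      (Finset.univ.filter fun l => fiveSqDist i l ≤ fiveSqDist i j).card ≤ 3 ∧
      (Finset.univ.filter fun l => fiveSqDist i l ≤ fiveSqDist i k).card ≤ 3 := by decide
  intro u hu w hw huw
  obtain ⟨j, rfl⟩ := mem_fivePoints.1 hu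
  obtain ⟨k, rfl⟩ := mem_fivePoints.1 hw
  obtain ⟨i, hj, hk⟩ := key j k (fun e => huw (e ▸ rfl))
  exact ⟨fivePoint i, mem_fivePoints.2 ⟨i, rfl⟩, fivePoint_mem_nbhd hj, fivePoint_mem_nbhd hk⟩
end
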